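/- Let f be a Rademacher random multiplicative function and let ε > 0 be sufficiently small. Then almost surely, for all sufficiently large x (with the threshold depending on the sample point), |∑_{n ≤ x, P(n) > √x} f(n)| ≤ √x · (log log x)^{1/4 + ε}. -/

import Mathlib

open MeasureTheory ProbabilityTheory Filter

noncomputable section

/-- The largest prime factor of `n`, with `P 1 = 1` (and `P 0 = 1`). -/
def Pfac (n : ℕ) : ℕ := if n ≤ 1 then 1 else n.primeFactors.sup id

/-- A Rademacher random multiplicative function: the values at primes are independent,
taking the values `1` and `-1` with probability `1/2` each; `f` vanishes on
non-squarefree integers and is multiplicative on squarefree integers. -/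
structure IsRademacherRMF {Ω : Type*} [MeasurableSpace Ω] (μ : Measure Ω)
    (f : Ω → ℕ → ℝ) : Prop where
  meas : ∀ n : ℕ, Measurable fun ω => f ω n
  indep : iIndepFun (m := fun _ : Nat.Primes => (inferInstance : MeasurableSpace ℝ))
    (fun (p : Nat.Primes) (ω : Ω) => f ω (p : ℕ)) μ
  prob_one : ∀ p : ℕ, p.Prime → μ {ω | f ω p = 1} = 1 / 2
  prob_neg_one : ∀ p : ℕ, p.Prime → μ {ω | f ω p = -1} = 1 / 2
  eq_zero_of_not_squarefree : ∀ (ω : Ω) (n : ℕ), ¬Squarefree n → f ω n = 0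
  eq_prod_of_squarefree : ∀ (ω : Ω) (n : ℕ), Squarefree n →
    f ω n = ∏ p ∈ n.primeFactors, f ω p

namespace RMF
open Finset

/-- average over all sign configurations on `range N`; `s` is the set of `-1` signs -/
def Ex (N : ℕ) (Φ : Finset ℕ → ℝ) : ℝ := (∑ s ∈ (range N).powerset, Φ s) / 2 ^ N

/-- sign at `j` -/
def sg (s : Finset ℕ) (j : ℕ) : ℝ := if j ∈ s then -1 else 1

/-- Walsh character -/
def chi (u s : Finset ℕ) : ℝ := ∏ p ∈ u, sg s p

/-- dependence only on the coordinates below `N` -/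
def Dep {α : Type*} (N : ℕ) (Φ : Finset ℕ → α) : Prop := ∀ s, Φ (s ∩ range N) = Φ s

lemma Ex_succ (N : ℕ) (Φ : Finset ℕ → ℝ) :
    Ex (N + 1) Φ = (Ex N Φ + Ex N (fun s => Φ (insert N s))) / 2 := by
  unfold Ex
  rw [Finset.range_add_one, Finset.sum_powerset_insert (by simp), pow_succ]
  field_simp

lemma Ex_add (N : ℕ) (Φ Ψ : Finset ℕ → ℝ) : Ex N (fun s => Φ s + Ψ s) = Ex N Φ + Ex N Ψ := by
  simp [Ex, Finset.sum_add_distrib, add_div]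

lemma Ex_sub (N : ℕ) (Φ Ψ : Finset ℕ → ℝ) : Ex N (fun s => Φ s - Ψ s) = Ex N Φ - Ex N Ψ := by
  simp [Ex, Finset.sum_sub_distrib, sub_div]

lemma Ex_mul_left (N : ℕ) (c : ℝ) (Φ : Finset ℕ → ℝ) : Ex N (fun s => c * Φ s) = c * Ex N Φ := by
  simp [Ex, ← Finset.mul_sum, mul_div_assoc]

lemma Ex_mul_right (N : ℕ) (c : ℝ) (Φ : Finset ℕ → ℝ) : Ex N (fun s => Φ s * c) = Ex N Φ * c := by
  simp [Ex, ← Finset.sum_mul, div_mul_eq_mul_div]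

lemma Ex_sum {ι : Type*} (N : ℕ) (A : Finset ι) (Φ : ι → Finset ℕ → ℝ) :
    Ex N (fun s => ∑ i ∈ A, Φ i s) = ∑ i ∈ A, Ex N (Φ i) := by
  simp only [Ex]
  rw [Finset.sum_comm, Finset.sum_div]

lemma Ex_const (N : ℕ) (c : ℝ) : Ex N (fun _ => c) = c := by
  simp [Ex, Finset.card_powerset]

lemma Ex_mono {N : ℕ} {Φ Ψ : Finset ℕ → ℝ} (h : ∀ s ∈ (range N).powerset, Φ s ≤ Ψ s) :
    Ex N Φ ≤ Ex N Ψ := by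
  unfold Ex
  exact div_le_div_of_nonneg_right (Finset.sum_le_sum h) (by positivity)

lemma Ex_mono' {N : ℕ} {Φ Ψ : Finset ℕ → ℝ} (h : ∀ s, Φ s ≤ Ψ s) :
    Ex N Φ ≤ Ex N Ψ := Ex_mono fun s _ => h s

lemma Ex_nonneg {N : ℕ} {Φ : Finset ℕ → ℝ} (h : ∀ s, 0 ≤ Φ s) : 0 ≤ Ex N Φ := by
  have := Ex_mono' (N := N) (Φ := fun _ => 0) h
  rwa [Ex_const] at this

lemma Ex_congr {N : ℕ} {Φ Ψ : Finset ℕ → ℝ} (h : ∀ s ∈ (range N).powerset, Φ s = Ψ s) :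
    Ex N Φ = Ex N Ψ := by
  unfold Ex
  rw [Finset.sum_congr rfl h]

lemma Dep.ins {α : Type*} {N j : ℕ} {Φ : Finset ℕ → α} (h : Dep N Φ) (hj : N ≤ j)
    (s : Finset ℕ) : Φ (insert j s) = Φ s := by
  rw [← h (insert j s), ← h s]
  congr 1
  ext x
  simp only [mem_inter, Finset.mem_insert, mem_range]
  constructor
  · rintro ⟨h1 | h1, h2⟩
    · omega
    · exact ⟨h1, h2⟩
  · tauto

lemma Dep.mono {α : Type*} {N M : ℕ} {Φ : Finset ℕ → α} (h : Dep N Φ) (hj : N ≤ M) : Dep M Φ := by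
  intro s
  rw [← h (s ∩ range M), ← h s]
  congr 1
  ext x
  simp only [mem_inter, mem_range]
  constructor
  · tauto
  · rintro ⟨h1, h2⟩
    exact ⟨⟨h1, by omega⟩, h2⟩

lemma dep_const {α : Type*} {N : ℕ} (c : α) : Dep N (fun _ => c) := fun _ => rfl

lemma dep_sg {N j : ℕ} (h : j < N) : Dep N (fun s => sg s j) := by
  intro s; simp [sg, h]

lemma Dep.comp {α β : Type*} {N : ℕ} {Φ : Finset ℕ → α} (h : Dep N Φ) (g : α → β) :
    Dep N (fun s => g (Φ s)) := fun s => by simp only [h s]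

lemma Dep.comp₂ {α β γ : Type*} {N : ℕ} {Φ : Finset ℕ → α} {Ψ : Finset ℕ → β}
    (h : Dep N Φ) (h' : Dep N Ψ) (g : α → β → γ) :
    Dep N (fun s => g (Φ s) (Ψ s)) := fun s => by simp only [h s, h' s]

lemma dep_prod {N : ℕ} {ι R : Type*} [CommMonoid R] (A : Finset ι) (Φ : ι → Finset ℕ → R)
    (h : ∀ i ∈ A, Dep N (Φ i)) : Dep N (fun s => ∏ i ∈ A, Φ i s) := by
  intro s
  exact Finset.prod_congr rfl fun i hi => h i hi s

lemma dep_sum {N : ℕ} {ι R : Type*} [AddCommMonoid R] (A : Finset ι) (Φ : ι → Finset ℕ → R)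
    (h : ∀ i ∈ A, Dep N (Φ i)) : Dep N (fun s => ∑ i ∈ A, Φ i s) := by
  intro s
  exact Finset.sum_congr rfl fun i hi => h i hi s

lemma dep_chi {N : ℕ} {u : Finset ℕ} (h : u ⊆ range N) : Dep N (chi u) := by
  apply dep_prod
  intro i hi
  exact dep_sg (by simpa using h hi)

lemma Ex_dep_succ {N : ℕ} {Φ : Finset ℕ → ℝ} (h : Dep N Φ) : Ex (N + 1) Φ = Ex N Φ := by
  rw [Ex_succ]
  simp only [h.ins le_rfl]
  ring

lemma Ex_dep {N M : ℕ} {Φ : Finset ℕ → ℝ} (h : Dep N Φ) (hM : N ≤ M) : Ex M Φ = Ex N Φ := by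
  induction M, hM using Nat.le_induction with
  | base => rfl
  | succ M hM ih => rw [Ex_dep_succ (h.mono hM), ih]

lemma sg_sq (s : Finset ℕ) (j : ℕ) : sg s j ^ 2 = 1 := by
  unfold sg; split_ifs <;> norm_num

lemma sg_mul_self (s : Finset ℕ) (j : ℕ) : sg s j * sg s j = 1 := by
  unfold sg; split_ifs <;> norm_num

lemma abs_sg (s : Finset ℕ) (j : ℕ) : |sg s j| = 1 := by
  unfold sg; split_ifs <;> norm_num

lemma sg_insert_self (s : Finset ℕ) (j : ℕ) : sg (insert j s) j = -1 := by simp [sg]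

lemma sg_insert_ne (s : Finset ℕ) {i j : ℕ} (h : i ≠ j) : sg (insert j s) i = sg s i := by
  simp [sg, h]

lemma sg_of_not_mem {s : Finset ℕ} {j : ℕ} (h : j ∉ s) : sg s j = 1 := by simp [sg, h]

lemma not_mem_powerset {N : ℕ} {s : Finset ℕ} (h : s ∈ (range N).powerset) : N ∉ s := by
  intro h'
  have := Finset.mem_powerset.1 h h'
  simp at this

/-- one-step conditional averaging: `Φ` sees coordinate `N` only through the sign. -/
lemma Ex_step {N : ℕ} (Ψ : Finset ℕ → ℝ → ℝ) (h : ∀ x, Dep N (fun s => Ψ s x)) :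
    Ex (N + 1) (fun s => Ψ s (sg s N)) = Ex N (fun s => (Ψ s 1 + Ψ s (-1)) / 2) := by
  rw [Ex_succ]
  have h1 : Ex N (fun s => Ψ s (sg s N)) = Ex N (fun s => Ψ s 1) := by
    apply Ex_congr
    intro s hs
    rw [sg_of_not_mem (not_mem_powerset hs)]
  have h2 : Ex N (fun s => Ψ (insert N s) (sg (insert N s) N)) = Ex N (fun s => Ψ s (-1)) := by
    apply Ex_congr
    intro s hs
    rw [sg_insert_self]
    exact (h (-1)).ins le_rfl s
  rw [h1, h2, ← Ex_add]
  simp only [div_eq_mul_inv, Ex_mul_right]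

/-- indicator of a proposition -/
def ind (Q : Prop) : ℝ := by classical exact if Q then 1 else 0

lemma ind_true {Q : Prop} (h : Q) : ind Q = 1 := by simp [ind, h]
lemma ind_false {Q : Prop} (h : ¬ Q) : ind Q = 0 := by simp [ind, h]
lemma ind_nonneg (Q : Prop) : 0 ≤ ind Q := by unfold ind; split_ifs <;> norm_num
lemma ind_le_one (Q : Prop) : ind Q ≤ 1 := by unfold ind; split_ifs <;> norm_num
lemma ind_mono {Q Q' : Prop} (h : Q → Q') : ind Q ≤ ind Q' := by
  by_cases h1 : Q
  · rw [ind_true h1, ind_true (h h1)]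
  · rw [ind_false h1]; exact ind_nonneg _

/-- probability of an event in the finite sign space -/
def Pr (N : ℕ) (Q : Finset ℕ → Prop) : ℝ := Ex N (fun s => ind (Q s))

/-- Doob's maximal inequality. -/
lemma doob {a b : ℕ} (hab : a ≤ b) (R : ℕ → Finset ℕ → ℝ) (G : Finset ℕ → Prop) {lam : ℝ}
    (hdep : ∀ m, a ≤ m → m ≤ b → Dep m (R m)) (hG : Dep a G)
    (hsub : ∀ m, a ≤ m → m < b → ∀ s ∈ (range m).powerset,
      R m s ≤ (R (m + 1) s + R (m + 1) (insert m s)) / 2) (hpos : ∀ m s, 0 ≤ R m s) :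
    lam * Pr b (fun s => G s ∧ ∃ m, a ≤ m ∧ m ≤ b ∧ lam ≤ R m s) ≤
      Ex b (fun s => ind (G s) * R b s) := by
  suffices H : lam * Pr b (fun s => G s ∧ ∃ m, a ≤ m ∧ m ≤ b ∧ lam ≤ R m s) ≤
      Ex b (fun s => ind (G s ∧ ∃ m, a ≤ m ∧ m ≤ b ∧ lam ≤ R m s) * R b s) by
    refine H.trans (Ex_mono' fun s => ?_)
    exact mul_le_mul_of_nonneg_right (ind_mono fun h => h.1) (hpos _ _)
  unfold Pr
  induction b, hab using Nat.le_induction with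
  | base =>
    rw [← Ex_mul_left]
    apply Ex_mono'
    intro s
    by_cases h : (G s ∧ ∃ m, a ≤ m ∧ m ≤ a ∧ lam ≤ R m s)
    · rw [ind_true h]
      obtain ⟨_, m, h1, h2, h3⟩ := h
      have : m = a := by omega
      subst this; simpa using h3
    · rw [ind_false h]; simp
  | succ b hab ih =>
    have ih := ih (fun m h1 h2 => hdep m h1 (by omega)) (fun m h1 h2 => hsub m h1 (by omega))
    obtain ⟨Q, hQ⟩ : ∃ Q : Finset ℕ → Prop,
      Q = fun s => G s ∧ ∃ m, a ≤ m ∧ m ≤ b ∧ lam ≤ R m s := ⟨_, rfl⟩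
    have hQ' : ∀ s, (G s ∧ ∃ m, a ≤ m ∧ m ≤ b ∧ lam ≤ R m s) = Q s := by intro s; rw [hQ]
    simp only [hQ'] at ih
    have hQdep : Dep b Q := by
      intro s
      simp only [hQ]
      have e1 : G (s ∩ range b) = G s := (hG.mono hab) s
      rw [e1]
      congr 1
      apply propext
      constructor
      · rintro ⟨m, h1, h2, h3⟩
        refine ⟨m, h1, h2, ?_⟩
        rwa [((hdep m h1 (by omega)).mono h2) s] at h3
      · rintro ⟨m, h1, h2, h3⟩
        refine ⟨m, h1, h2, ?_⟩
        rwa [((hdep m h1 (by omega)).mono h2) s]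
    have key1 : Ex b (fun s => ind (Q s) * R b s) ≤
        Ex (b + 1) (fun s => ind (Q s) * R (b + 1) s) := by
      rw [Ex_succ, ← Ex_add, div_eq_mul_inv, ← Ex_mul_right]
      apply Ex_mono
      intro s hs
      simp only [hQdep.ins le_rfl s]
      have := mul_le_mul_of_nonneg_left (hsub b hab (by omega) s hs) (ind_nonneg (Q s))
      linarith
    have key2 : Ex b (fun s => ind (Q s)) = Ex (b + 1) (fun s => ind (Q s)) := by
      rw [Ex_dep_succ]
      exact hQdep.comp ind
    have h3 : lam * Ex (b + 1) (fun s => ind (Q s)) ≤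
        Ex (b + 1) (fun s => ind (Q s) * R (b + 1) s) := by
      rw [← key2]; exact ih.trans key1
    have h4 : lam * Ex (b+1) (fun s => ind (G s ∧ lam ≤ R (b+1) s ∧ ¬ Q s)) ≤
        Ex (b+1) (fun s => ind (G s ∧ lam ≤ R (b+1) s ∧ ¬ Q s) * R (b+1) s) := by
      rw [← Ex_mul_left]
      apply Ex_mono'
      intro s
      by_cases h : (G s ∧ lam ≤ R (b+1) s ∧ ¬ Q s)
      · rw [ind_true h]; simpa using h.2.1
      · rw [ind_false h]; simp
    have e : ∀ s, ind (G s ∧ ∃ m, a ≤ m ∧ m ≤ b + 1 ∧ lam ≤ R m s) =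
        ind (Q s) + ind (G s ∧ lam ≤ R (b+1) s ∧ ¬ Q s) := by
      intro s
      by_cases hq : Q s
      · rw [ind_true hq, ind_true, ind_false (by tauto)]
        · simp
        · rw [← hQ'] at hq
          obtain ⟨h1, m, h2, h3, h4⟩ := hq
          exact ⟨h1, m, h2, by omega, h4⟩
      · rw [ind_false hq, zero_add]
        congr 1
        apply propext
        constructor
        · rintro ⟨h1, m, h2, h3, h4⟩
          rcases Nat.lt_or_ge m (b+1) with h5 | h5
          · rw [← hQ'] at hq
            exact absurd ⟨h1, m, h2, by omega, h4⟩ hq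
          · have : m = b + 1 := by omega
            subst this
            exact ⟨h1, h4, hq⟩
        · rintro ⟨h1, h2, h3⟩
          exact ⟨h1, b+1, by omega, le_rfl, h2⟩
    simp only [e, add_mul, Ex_add, mul_add]
    exact add_le_add h3 h4

/-- Walsh polynomial. -/
def walsh (N : ℕ) (c : Finset ℕ → ℝ) (s : Finset ℕ) : ℝ := ∑ u ∈ (range N).powerset, c u * chi u s

lemma dep_walsh (N : ℕ) (c : Finset ℕ → ℝ) : Dep N (walsh N c) := by
  apply dep_sum
  intro u hu
  exact (dep_chi (Finset.mem_powerset.1 hu)).comp (fun x => c u * x)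

lemma walsh_succ (N : ℕ) (c : Finset ℕ → ℝ) (s : Finset ℕ) :
    walsh (N + 1) c s = walsh N c s + sg s N * walsh N (fun u => c (insert N u)) s := by
  unfold walsh
  rw [Finset.range_add_one, Finset.sum_powerset_insert (by simp), Finset.mul_sum]
  congr 1
  apply Finset.sum_congr rfl
  intro u hu
  have : N ∉ u := not_mem_powerset hu
  rw [chi, Finset.prod_insert this]
  unfold chi
  ring

lemma walsh_sq (N : ℕ) (c : Finset ℕ → ℝ) :
    Ex N (fun s => walsh N c s ^ 2) = ∑ u ∈ (range N).powerset, c u ^ 2 := by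
  induction N generalizing c with
  | zero => simp [Ex, walsh, chi]
  | succ N ih =>
    have h1 : Ex (N+1) (fun s => walsh (N+1) c s ^ 2) =
        Ex (N+1) (fun s => (walsh N c s + (sg s N) * walsh N (fun u => c (insert N u)) s)^2) := by
      simp only [walsh_succ]
    rw [h1, Ex_step (fun s x => (walsh N c s + x * walsh N (fun u => c (insert N u)) s)^2)]
    · have : ∀ s, ((walsh N c s + 1 * walsh N (fun u => c (insert N u)) s)^2 +
          (walsh N c s + -1 * walsh N (fun u => c (insert N u)) s)^2) / 2 =
          walsh N c s ^ 2 + walsh N (fun u => c (insert N u)) s ^ 2 := by intro s; ring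
      simp only [this]
      rw [Ex_add, ih, ih, Finset.range_add_one, Finset.sum_powerset_insert (by simp)]
    · intro x
      exact (dep_walsh _ _).comp₂ (dep_walsh _ _) (fun A B => (A + x * B)^2)

lemma Ex_cauchy (N : ℕ) (A B : Finset ℕ → ℝ) :
    Ex N (fun s => A s * B s) ^ 2 ≤ Ex N (fun s => A s ^ 2) * Ex N (fun s => B s ^ 2) := by
  unfold Ex
  rw [div_pow, div_mul_div_comm, ← pow_two]
  exact div_le_div_of_nonneg_right (Finset.sum_mul_sq_le_sq_mul_sq _ _ _) (by positivity)

/-- Bonami's lemma (fourth moment). -/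
lemma bonami (N : ℕ) (c : Finset ℕ → ℝ) :
    Ex N (fun s => walsh N c s ^ 4) ≤ (∑ u ∈ (range N).powerset, c u ^ 2 * 3 ^ u.card) ^ 2 := by
  induction N generalizing c with
  | zero => simp [Ex, walsh, chi]; ring_nf; rfl
  | succ N ih =>
    have h1 : Ex (N+1) (fun s => walsh (N+1) c s ^ 4) =
        Ex (N+1) (fun s => (walsh N c s + (sg s N) * walsh N (fun u => c (insert N u)) s)^4) := by
      simp only [walsh_succ]
    rw [h1, Ex_step (fun s x => (walsh N c s + x * walsh N (fun u => c (insert N u)) s)^4)]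
    · set A := walsh N c with hA
      set B := walsh N (fun u => c (insert N u)) with hB
      have : ∀ s, ((A s + 1 * B s)^4 + (A s + -1 * B s)^4) / 2 =
          A s ^ 4 + 6 * (A s ^ 2 * B s ^ 2) + B s ^ 4 := by intro s; ring
      simp only [this]
      rw [Ex_add, Ex_add, Ex_mul_left]
      set qa := ∑ u ∈ (range N).powerset, c u ^ 2 * 3 ^ u.card with hqa
      set qb := ∑ u ∈ (range N).powerset, c (insert N u) ^ 2 * 3 ^ u.card with hqb
      have ha : Ex N (fun s => A s ^ 4) ≤ qa ^ 2 := ih c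
      have hb : Ex N (fun s => B s ^ 4) ≤ qb ^ 2 := ih _
      have hqa0 : 0 ≤ qa := Finset.sum_nonneg fun _ _ => by positivity
      have hqb0 : 0 ≤ qb := Finset.sum_nonneg fun _ _ => by positivity
      have hab : Ex N (fun s => A s ^ 2 * B s ^ 2) ≤ qa * qb := by
        apply le_of_sq_le_sq _ (by positivity)
        refine (Ex_cauchy N (fun s => A s ^2) (fun s => B s ^ 2)).trans ?_
        simp only [← pow_mul]
        rw [mul_pow]
        exact mul_le_mul ha hb (Ex_nonneg fun s => (by rw [pow_mul]; positivity)) (by positivity)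
      rw [Finset.range_add_one, Finset.sum_powerset_insert (by simp)]
      have e : ∑ t ∈ (range N).powerset, c (insert N t) ^ 2 * (3:ℝ) ^ (insert N t).card = 3 * qb := by
        rw [hqb, Finset.mul_sum]
        apply Finset.sum_congr rfl
        intro u hu
        rw [Finset.card_insert_of_notMem (not_mem_powerset hu)]
        ring
      rw [e]
      nlinarith
    · intro x
      exact (dep_walsh _ _).comp₂ (dep_walsh _ _) (fun A B => (A + x * B)^4)

lemma Pr_mono {N : ℕ} {Q Q' : Finset ℕ → Prop} (h : ∀ s, Q s → Q' s) : Pr N Q ≤ Pr N Q' :=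
  Ex_mono' fun s => ind_mono (h s)

lemma Pr_nonneg {N : ℕ} {Q : Finset ℕ → Prop} : 0 ≤ Pr N Q := Ex_nonneg fun _ => ind_nonneg _

lemma Pr_or {N : ℕ} {Q Q' : Finset ℕ → Prop} : Pr N (fun s => Q s ∨ Q' s) ≤ Pr N Q + Pr N Q' := by
  classical
  unfold Pr
  rw [← Ex_add]
  apply Ex_mono'
  intro s
  by_cases h1 : Q s <;> by_cases h2 : Q' s <;> simp [h1, h2, ind]

lemma Pr_exists {ι : Type*} {N : ℕ} (A : Finset ι) {Q : ι → Finset ℕ → Prop} :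
    Pr N (fun s => ∃ i ∈ A, Q i s) ≤ ∑ i ∈ A, Pr N (Q i) := by
  unfold Pr
  rw [← Ex_sum]
  apply Ex_mono'
  intro s
  by_cases h : ∃ i ∈ A, Q i s
  · rw [ind_true h]
    obtain ⟨i, hi, hq⟩ := h
    have := Finset.single_le_sum (f := fun i => ind (Q i s)) (fun i _ => ind_nonneg _) hi
    simpa [ind_true hq] using this
  · rw [ind_false h]
    exact Finset.sum_nonneg fun i _ => ind_nonneg _

lemma Pr_markov {N : ℕ} {X : Finset ℕ → ℝ} (h : ∀ s, 0 ≤ X s) {c : ℝ} (hc : 0 < c) :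
    Pr N (fun s => c ≤ X s) ≤ Ex N X / c := by
  rw [le_div_iff₀ hc, Pr, ← Ex_mul_right]
  apply Ex_mono'
  intro s
  by_cases h1 : c ≤ X s
  · simpa [ind_true h1] using h1
  · simpa [ind_false h1] using h s

lemma Pr_dep {N M : ℕ} {Q : Finset ℕ → Prop} (h : Dep N Q) (hM : N ≤ M) : Pr M Q = Pr N Q :=
  Ex_dep (h.comp ind) hM

end RMF

namespace RMF
open Finset ArithmeticFunction

/-- sieve support -/
def selD (z : ℕ) : Finset ℕ := (Icc 1 z).filter Squarefree

def selG (z : ℕ) : ℝ := ∑ k ∈ selD z, 1 / (Nat.totient k : ℝ)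

def selL (z d : ℕ) : ℝ :=
  d * (moebius d : ℝ) / selG z * ∑ k ∈ (selD z).filter (d ∣ ·), 1 / (Nat.totient k : ℝ)

lemma mem_selD {z d : ℕ} : d ∈ selD z ↔ (1 ≤ d ∧ d ≤ z) ∧ Squarefree d := by
  simp [selD]

lemma selG_pos {z : ℕ} (hz : 1 ≤ z) : 0 < selG z := by
  apply Finset.sum_pos
  · intro k hk
    rw [mem_selD] at hk
    have : 0 < Nat.totient k := Nat.totient_pos.2 (by omega)
    positivity
  · exact ⟨1, by rw [mem_selD]; simp [hz]⟩

lemma selL_one {z : ℕ} (hz : 1 ≤ z) : selL z 1 = 1 := by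
  have := selG_pos hz
  simp only [selL, one_dvd, Finset.filter_true]
  rw [show ∑ k ∈ selD z, 1 / (Nat.totient k : ℝ) = selG z from rfl]
  simp
  field_simp

lemma abs_selL_le {z d : ℕ} (hz : 1 ≤ z) : |selL z d| ≤ d := by
  have hG := selG_pos hz
  have h0 : 0 ≤ ∑ k ∈ (selD z).filter (d ∣ ·), 1 / (Nat.totient k : ℝ) :=
    Finset.sum_nonneg fun _ _ => by positivity
  have h1 : ∑ k ∈ (selD z).filter (d ∣ ·), 1 / (Nat.totient k : ℝ) ≤ selG z :=
    Finset.sum_le_sum_of_subset_of_nonneg (Finset.filter_subset _ _) fun _ _ _ => by positivity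
  have h2 : |(moebius d : ℝ)| ≤ 1 := by exact_mod_cast abs_moebius_le_one
  rw [selL, abs_mul, abs_div, abs_mul, abs_of_nonneg h0, abs_of_pos hG, Nat.abs_cast,
    div_mul_eq_mul_div, div_le_iff₀ hG]
  calc (d:ℝ) * |(moebius d : ℝ)| * _ ≤ d * 1 * selG z := by gcongr
    _ = _ := by ring

lemma sum_moebius_between {k j : ℕ} (hj : Squarefree j) (hk : k ∣ j) :
    ∑ d ∈ j.divisors.filter (k ∣ ·), (moebius d : ℝ) = if k = j then (moebius k : ℝ) else 0 := by
  obtain ⟨e, rfl⟩ := hk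
  have hj0 : k * e ≠ 0 := hj.ne_zero
  have hk0 : k ≠ 0 := left_ne_zero_of_mul hj0
  have he0 : e ≠ 0 := right_ne_zero_of_mul hj0
  have : (k * e).divisors.filter (k ∣ ·) = e.divisors.image (k * ·) := by
    ext d
    simp only [mem_filter, Nat.mem_divisors, mem_image]
    constructor
    · rintro ⟨⟨h1, h2⟩, ⟨c, rfl⟩⟩
      exact ⟨c, ⟨Nat.dvd_of_mul_dvd_mul_left (Nat.pos_of_ne_zero hk0) h1, he0⟩, rfl⟩
    · rintro ⟨c, ⟨h1, h2⟩, rfl⟩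
      exact ⟨⟨Nat.mul_dvd_mul_left k h1, hj0⟩, Dvd.intro _ rfl⟩
  rw [this, Finset.sum_image (by
    intro x _ y _ h
    exact Nat.eq_of_mul_eq_mul_left (Nat.pos_of_ne_zero hk0) h)]
  have h2 : ∀ c ∈ e.divisors, (moebius (k * c) : ℝ) = moebius k * moebius c := by
    intro c hc
    have hc' := Nat.dvd_of_mem_divisors hc
    have : Nat.Coprime k c := (Nat.squarefree_mul_iff.1 hj).1.coprime_dvd_right hc'
    rw [isMultiplicative_moebius.map_mul_of_coprime this]
    push_cast; ring
  rw [Finset.sum_congr rfl h2, ← Finset.mul_sum]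
  have h3 : ∑ c ∈ e.divisors, (moebius c : ℝ) = if e = 1 then 1 else 0 := by
    have := congrArg (fun f => f e) moebius_mul_coe_zeta
    simp only [coe_mul_zeta_apply, one_apply] at this
    exact_mod_cast this
  rw [h3]
  by_cases he : e = 1
  · simp [he]
  · have : ¬ (k = k * e) := by
      intro h
      apply he
      exact Nat.eq_of_mul_eq_mul_left (Nat.pos_of_ne_zero hk0) (by omega)
    rw [if_neg he, if_neg this, mul_zero]

lemma selL_dual {z k : ℕ} (hk : k ∈ selD z) :
    ∑ d ∈ (selD z).filter (k ∣ ·), selL z d / d = moebius k / (selG z * Nat.totient k) := by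
  have e1 : ∀ d ∈ (selD z).filter (k ∣ ·), selL z d / d =
      ∑ j ∈ selD z, if d ∣ j then (moebius d : ℝ) * (1 / selG z * (1 / (Nat.totient j : ℝ))) else 0 := by
    intro d hd
    rw [mem_filter, mem_selD] at hd
    have hd0 : (d : ℝ) ≠ 0 := by
      have := hd.1.1.1
      positivity
    rw [selL, ← Finset.sum_filter, ← Finset.mul_sum, ← Finset.mul_sum]
    field_simp
  rw [Finset.sum_congr rfl e1, Finset.sum_comm]
  have e2 : ∀ j ∈ selD z, (∑ d ∈ (selD z).filter (k ∣ ·), if d ∣ j then (moebius d : ℝ) * (1 / selG z * (1 / (Nat.totient j : ℝ))) else 0)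
      = if k = j then (moebius k : ℝ) * (1 / selG z * (1 / (Nat.totient j : ℝ))) else 0 := by
    intro j hj
    rw [mem_selD] at hj
    rw [← Finset.sum_filter, ← Finset.sum_mul, Finset.filter_filter]
    have : (selD z).filter (fun d => k ∣ d ∧ d ∣ j) = j.divisors.filter (k ∣ ·) := by
      ext d
      simp only [mem_filter, mem_selD, Nat.mem_divisors]
      constructor
      · rintro ⟨_, h2, h3⟩
        exact ⟨⟨h3, by omega⟩, h2⟩
      · rintro ⟨⟨h1, h2⟩, h3⟩
        exact ⟨⟨⟨Nat.pos_of_dvd_of_pos h1 (by omega),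
          (Nat.le_of_dvd (by omega) h1).trans hj.1.2⟩, hj.2.squarefree_of_dvd h1⟩, h3, h1⟩
    rw [this]
    by_cases hkj : k ∣ j
    · rw [sum_moebius_between hj.2 hkj]
      split_ifs <;> simp
    · have hne : k ≠ j := by rintro rfl; exact hkj dvd_rfl
      have : j.divisors.filter (k ∣ ·) = ∅ := by
        apply Finset.filter_false_of_mem
        intro d hd h
        exact hkj (h.trans (Nat.dvd_of_mem_divisors hd))
      rw [this]; simp [hne]
  rw [Finset.sum_congr rfl e2, Finset.sum_ite_eq, if_pos hk]
  field_simp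

lemma sel_main {z : ℕ} (hz : 1 ≤ z) :
    ∑ d ∈ selD z, ∑ e ∈ selD z, selL z d * selL z e / (Nat.lcm d e : ℝ) = 1 / selG z := by
  have hG := selG_pos hz
  have e1 : ∀ d ∈ selD z, ∀ e ∈ selD z, selL z d * selL z e / (Nat.lcm d e : ℝ) =
      ∑ k ∈ selD z, if (k ∣ d ∧ k ∣ e) then (Nat.totient k : ℝ) * (selL z d / d) * (selL z e / e) else 0 := by
    intro d hd e he
    rw [mem_selD] at hd he
    rw [← Finset.sum_filter, ← Finset.sum_mul, ← Finset.sum_mul]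
    have : (selD z).filter (fun k => k ∣ d ∧ k ∣ e) = (Nat.gcd d e).divisors := by
      ext k
      simp only [mem_filter, mem_selD, Nat.mem_divisors, Nat.dvd_gcd_iff]
      constructor
      · rintro ⟨_, h⟩
        exact ⟨h, (Nat.gcd_pos_of_pos_left _ (by omega)).ne'⟩
      · rintro ⟨⟨h1, h2⟩, h3⟩
        exact ⟨⟨⟨Nat.pos_of_dvd_of_pos h1 (by omega),
          (Nat.le_of_dvd (by omega) h1).trans hd.1.2⟩, hd.2.squarefree_of_dvd h1⟩, h1, h2⟩
    rw [this]
    have h2 : ∑ k ∈ (Nat.gcd d e).divisors, (Nat.totient k : ℝ) = Nat.gcd d e := by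
      exact_mod_cast Nat.sum_totient _
    rw [h2]
    have h3 : (Nat.gcd d e : ℝ) * Nat.lcm d e = d * e := by exact_mod_cast Nat.gcd_mul_lcm d e
    have hd0 : (d : ℝ) ≠ 0 := by have := hd.1.1; positivity
    have he0 : (e : ℝ) ≠ 0 := by have := he.1.1; positivity
    have hl0 : (Nat.lcm d e : ℝ) ≠ 0 := by
      intro h; rw [h] at h3; simp at h3; omega
    field_simp
    linear_combination (-(selL z d * selL z e)) * h3
  rw [Finset.sum_congr rfl fun d hd => Finset.sum_congr rfl fun e he => e1 d hd e he]
  have e2 : ∀ d ∈ selD z, (∑ e ∈ selD z, ∑ k ∈ selD z, if (k ∣ d ∧ k ∣ e) then (Nat.totient k : ℝ) * (selL z d / d) * (selL z e / e) else 0) =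
     ∑ k ∈ selD z, if k ∣ d then (Nat.totient k : ℝ) * (selL z d / d) * (∑ e ∈ (selD z).filter (k ∣ ·), selL z e / e) else 0 := by
    intro d hd
    rw [Finset.sum_comm]
    apply Finset.sum_congr rfl
    intro k hk
    by_cases h : k ∣ d
    · simp only [h, true_and, if_true]
      rw [← Finset.sum_filter, Finset.mul_sum]
    · simp [h]
  rw [Finset.sum_congr rfl e2, Finset.sum_comm]
  have e3 : ∀ k ∈ selD z, (∑ d ∈ selD z, if k ∣ d then (Nat.totient k : ℝ) * (selL z d / d) * (∑ e ∈ (selD z).filter (k ∣ ·), selL z e / e) else 0)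
     = 1 / selG z ^ 2 * (1 / (Nat.totient k : ℝ)) := by
    intro k hk
    rw [← Finset.sum_filter, ← Finset.sum_mul, ← Finset.mul_sum, selL_dual hk]
    rw [mem_selD] at hk
    have : (moebius k : ℝ) ^ 2 = 1 := by exact_mod_cast moebius_sq_eq_one_of_squarefree hk.2
    have hφ : (Nat.totient k : ℝ) ≠ 0 := by
      have : 0 < Nat.totient k := Nat.totient_pos.2 (by omega)
      positivity
    field_simp
    exact this
  rw [Finset.sum_congr rfl e3, ← Finset.mul_sum]
  rw [show ∑ k ∈ selD z, 1 / (Nat.totient k : ℝ) = selG z from rfl]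
  field_simp

lemma card_mult (a h m : ℕ) (hm : 1 ≤ m) :
    |((((Ioc a (a + h)).filter (m ∣ ·)).card : ℕ) : ℝ) - (h : ℝ) / m| ≤ 1 := by
  have h1 : ((Ioc a (a + h)).filter (m ∣ ·)).card + a / m = (a + h) / m := by
    rw [← Nat.Ioc_filter_dvd_card_eq_div, ← Nat.Ioc_filter_dvd_card_eq_div, ← Finset.card_union_of_disjoint]
    · congr 1
      ext x
      simp only [mem_union, mem_filter, mem_Ioc]
      constructor
      · rintro (h | h) <;> refine ⟨by omega, h.2⟩
      · rintro ⟨h1, h2⟩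
        rcases Nat.lt_or_ge a x with h3 | h3
        · left; exact ⟨by omega, h2⟩
        · right; exact ⟨by omega, h2⟩
    · rw [Finset.disjoint_left]
      intro x
      simp only [mem_filter, mem_Ioc]
      omega
  have hm0 : (0:ℝ) < m := by positivity
  set c := ((Ioc a (a + h)).filter (m ∣ ·)).card
  have q1 := Nat.div_add_mod a m
  have q2 := Nat.div_add_mod (a + h) m
  have q3 := Nat.mod_lt a hm
  have q4 := Nat.mod_lt (a + h) hm
  have h5 : (m * c : ℤ) - h = a % m - ((a + h : ℕ) : ℤ) % m := by
    have : ((a + h : ℕ) : ℤ) % m = (((a+h) % m : ℕ) : ℤ) := by simp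
    rw [this]
    have : (a : ℤ) % m = ((a % m : ℕ) : ℤ) := by simp
    rw [this]
    rw [← h1] at q2
    have q1' : (m : ℤ) * ((a / m : ℕ) : ℤ) + ((a % m : ℕ) : ℤ) = a := by exact_mod_cast q1
    have q2' : (m : ℤ) * ((c : ℤ) + ((a / m : ℕ) : ℤ)) + (((a + h) % m : ℕ) : ℤ) = (a : ℤ) + h := by
      exact_mod_cast q2
    linarith
  have h6 : |(m * c : ℤ) - h| ≤ m := by
    rw [h5]
    have : ((a + h : ℕ) : ℤ) % m = (((a+h) % m : ℕ) : ℤ) := by simp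
    rw [this]
    have : (a : ℤ) % m = ((a % m : ℕ) : ℤ) := by simp
    rw [this]
    rw [abs_le]
    omega
  have h7 : |(m * c : ℝ) - h| ≤ m := by exact_mod_cast h6
  have : (c : ℝ) - (h : ℝ) / m = (m * c - h) / m := by field_simp
  rw [this, abs_div, abs_of_pos hm0, div_le_one hm0]
  exact h7

lemma selberg_bound (a h z : ℕ) (hz : 1 ≤ z) :
    ((((Ioc a (a + h)).filter Nat.Prime).card : ℕ) : ℝ) ≤ z + h / selG z + (z : ℝ) ^ 4 := by
  set A := Ioc a (a + h) with hA
  have h1 : (((A.filter Nat.Prime).card : ℕ) : ℝ) ≤ z + ∑ n ∈ A, (∑ d ∈ (selD z).filter (· ∣ n), selL z d) ^ 2 := by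
    have : A.filter Nat.Prime ⊆ Icc 1 z ∪ A.filter (fun p => p.Prime ∧ z < p) := by
      intro p hp
      simp only [mem_union, mem_filter, mem_Icc] at hp ⊢
      rcases Nat.lt_or_ge z p with h | h
      · right; exact ⟨hp.1, hp.2, h⟩
      · left; exact ⟨hp.2.one_lt.le, h⟩
    have h2 := (Finset.card_le_card this).trans (Finset.card_union_le _ _)
    rw [Nat.card_Icc] at h2
    have h3 : (((A.filter (fun p => p.Prime ∧ z < p)).card : ℕ) : ℝ) ≤
        ∑ n ∈ A, (∑ d ∈ (selD z).filter (· ∣ n), selL z d) ^ 2 := by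
      rw [Finset.card_eq_sum_ones, Nat.cast_sum]
      calc _ ≤ ∑ n ∈ A.filter (fun p => p.Prime ∧ z < p), (∑ d ∈ (selD z).filter (· ∣ n), selL z d) ^ 2 := by
            apply Finset.sum_le_sum
            intro p hp
            rw [mem_filter] at hp
            have : (selD z).filter (· ∣ p) = {1} := by
              ext d
              simp only [mem_filter, mem_selD, mem_singleton]
              constructor
              · rintro ⟨⟨⟨h1, h2⟩, _⟩, h3⟩
                rcases (Nat.dvd_prime hp.2.1).1 h3 with h | h
                · exact h
                · omega
              · rintro rfl; simp [hz]
            rw [this]; simp [selL_one hz]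
        _ ≤ _ := Finset.sum_le_sum_of_subset_of_nonneg (Finset.filter_subset _ _) fun _ _ _ => sq_nonneg _
    have h4 : (((A.filter Nat.Prime).card : ℕ) : ℝ) ≤ ((z + 1 - 1 : ℕ) : ℝ) + (((A.filter (fun p => p.Prime ∧ z < p)).card : ℕ) : ℝ) := by
      exact_mod_cast h2
    simp only [Nat.add_sub_cancel] at h4
    linarith
  have h2 : ∑ n ∈ A, (∑ d ∈ (selD z).filter (· ∣ n), selL z d) ^ 2 =
      ∑ d ∈ selD z, ∑ e ∈ selD z, selL z d * selL z e * ((A.filter (Nat.lcm d e ∣ ·)).card : ℕ) := by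
    have : ∀ n ∈ A, (∑ d ∈ (selD z).filter (· ∣ n), selL z d) ^ 2 =
        ∑ d ∈ selD z, ∑ e ∈ selD z, if Nat.lcm d e ∣ n then selL z d * selL z e else 0 := by
      intro n _
      rw [Finset.sum_filter, pow_two, Finset.sum_mul_sum]
      apply Finset.sum_congr rfl; intro d _
      apply Finset.sum_congr rfl; intro e _
      simp only [Nat.lcm_dvd_iff]
      by_cases h1 : d ∣ n <;> by_cases h2 : e ∣ n <;> simp [h1, h2]
    rw [Finset.sum_congr rfl this, Finset.sum_comm]
    apply Finset.sum_congr rfl; intro d _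
    rw [Finset.sum_comm]
    apply Finset.sum_congr rfl; intro e _
    rw [← Finset.sum_filter, Finset.sum_const, nsmul_eq_mul, mul_comm]
  have h3 : ∑ d ∈ selD z, ∑ e ∈ selD z, selL z d * selL z e * ((A.filter (Nat.lcm d e ∣ ·)).card : ℕ)
      ≤ ∑ d ∈ selD z, ∑ e ∈ selD z, (h * (selL z d * selL z e / (Nat.lcm d e : ℝ)) + z * z) := by
    apply Finset.sum_le_sum; intro d hd
    apply Finset.sum_le_sum; intro e he
    rw [mem_selD] at hd he
    have hl : 1 ≤ Nat.lcm d e := Nat.lcm_pos (by omega) (by omega)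
    have hc := card_mult a h (Nat.lcm d e) hl
    set c := (((Ioc a (a + h)).filter (Nat.lcm d e ∣ ·)).card : ℝ)
    have hd1 : |selL z d| ≤ z := (abs_selL_le hz).trans (by exact_mod_cast hd.1.2)
    have he1 : |selL z e| ≤ z := (abs_selL_le hz).trans (by exact_mod_cast he.1.2)
    have : selL z d * selL z e * (c - h / (Nat.lcm d e : ℝ)) ≤ z * z := by
      refine (le_abs_self _).trans ?_
      rw [abs_mul, abs_mul]
      calc _ ≤ (z:ℝ) * z * 1 := by gcongr
        _ = _ := by ring
    have e3 : selL z d * selL z e * c = h * (selL z d * selL z e / (Nat.lcm d e : ℝ)) + selL z d * selL z e * (c - h / (Nat.lcm d e : ℝ)) := by ring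
    rw [e3]; linarith
  have h4 : ∑ d ∈ selD z, ∑ e ∈ selD z, (h * (selL z d * selL z e / (Nat.lcm d e : ℝ)) + z * z) ≤
      h / selG z + (z:ℝ) ^ 4 := by
    simp only [Finset.sum_add_distrib, ← Finset.mul_sum, sel_main hz]
    have hc : ((selD z).card : ℝ) ≤ z := by
      have := Finset.card_filter_le (Icc 1 z) Squarefree
      rw [Nat.card_Icc] at this
      exact_mod_cast this
    simp only [Finset.sum_const, nsmul_eq_mul]
    have : ((selD z).card : ℝ) * ((selD z).card * (z * z)) ≤ z * (z * (z * z)) := by gcongr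
    have e4 : (h : ℝ) * (1 / selG z) = h / selG z := by ring
    rw [e4]; nlinarith
  linarith

lemma sum_sqfree_ge (z : ℕ) : Real.log (z + 1) ≤ 2 * ∑ k ∈ selD z, 1 / (k : ℝ) := by
  have h1 : Real.log (z + 1) ≤ ∑ m ∈ Icc 1 z, 1 / (m : ℝ) := by
    have := log_add_one_le_harmonic z
    rw [harmonic_eq_sum_Icc] at this
    push_cast at this
    simpa using this
  have h2 : ∑ m ∈ Icc 1 z, 1 / (m : ℝ) ≤ ∑ q ∈ selD z ×ˢ Icc 1 z, 1 / (q.1 : ℝ) * (1 / (q.2 : ℝ) ^ 2) := by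
    have hex : ∀ m : ℕ, ∃ a b : ℕ, b ^ 2 * a = m ∧ Squarefree a := fun m => Nat.sq_mul_squarefree m
    choose fa fb hf using hex
    have hinj : Set.InjOn (fun m => (fa m, fb m)) (Icc 1 z : Finset ℕ) := by
      intro x _ y _ h
      simp only [Prod.mk.injEq] at h
      rw [← (hf x).1, ← (hf y).1, h.1, h.2]
    have : ∑ m ∈ Icc 1 z, 1 / (m : ℝ) = ∑ q ∈ (Icc 1 z).image (fun m => (fa m, fb m)), 1 / (q.1 : ℝ) * (1 / (q.2 : ℝ) ^ 2) := by
      rw [Finset.sum_image hinj]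
      apply Finset.sum_congr rfl
      intro m _
      have : (m : ℝ) = (fb m : ℝ) ^ 2 * fa m := by exact_mod_cast (hf m).1.symm
      rw [this, one_div_mul_one_div, mul_comm]
    rw [this]
    apply Finset.sum_le_sum_of_subset_of_nonneg
    · intro q hq
      rw [mem_image] at hq
      obtain ⟨m, hm, rfl⟩ := hq
      rw [mem_Icc] at hm
      have e := (hf m).1
      have ha : fa m ≠ 0 := by intro h; rw [h] at e; omega
      have hb : fb m ≠ 0 := by intro h; rw [h] at e; simp at e; omega
      have h3 : fa m ∣ m := Dvd.intro_left _ e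
      have h4 : fb m ∣ m := (dvd_pow_self _ (by norm_num)).trans (Dvd.intro _ e)
      simp only [mem_product, mem_selD, mem_Icc]
      exact ⟨⟨⟨by omega, (Nat.le_of_dvd (by omega) h3).trans hm.2⟩, (hf m).2⟩, by omega,
        (Nat.le_of_dvd (by omega) h4).trans hm.2⟩
    · intro _ _ _; positivity
  rw [Finset.sum_product] at h2
  simp only [] at h2
  rw [← Finset.sum_mul_sum] at h2
  have h3 : ∑ b ∈ Icc 1 z, 1 / (b : ℝ) ^ 2 ≤ 2 := by
    have : ∀ n : ℕ, ∑ b ∈ Icc 1 (n + 1), 1 / (b : ℝ) ^ 2 ≤ 2 - 1 / ((n : ℝ) + 1) := by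
      intro n
      induction n with
      | zero => norm_num
      | succ n ih =>
        rw [Finset.sum_Icc_succ_top (by omega)]
        have : 1 / (((n + 1 + 1 : ℕ) : ℝ)) ^ 2 ≤ 1 / ((n:ℝ) + 1) - 1 / (((n + 1 : ℕ) : ℝ) + 1) := by
          push_cast
          rw [div_sub_div _ _ (by positivity) (by positivity), div_le_div_iff₀ (by positivity) (by positivity)]
          nlinarith
        linarith
    rcases z with _ | z
    · norm_num
    have h := this z
    have : (0:ℝ) ≤ 1 / ((z:ℝ) + 1) := by positivity
    linarith
  have h5 : 0 ≤ ∑ k ∈ selD z, 1 / (k : ℝ) := Finset.sum_nonneg fun _ _ => by positivity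
  calc Real.log (z + 1) ≤ _ := h1.trans h2
    _ ≤ (∑ k ∈ selD z, 1 / (k : ℝ)) * 2 := by gcongr
    _ = _ := by ring

lemma selG_ge (z : ℕ) : Real.log (z + 1) ≤ 2 * selG z := by
  have h4 : ∑ k ∈ selD z, 1 / (k : ℝ) ≤ selG z := by
    apply Finset.sum_le_sum
    intro k hk
    rw [mem_selD] at hk
    have : 0 < Nat.totient k := Nat.totient_pos.2 (by omega)
    apply one_div_le_one_div_of_le (by positivity)
    exact_mod_cast Nat.totient_le k
  have := sum_sqfree_ge z
  linarith

theorem brun_titchmarsh (a h : ℕ) (hh : 2 ≤ h) :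
    ((((Ioc a (a + h)).filter Nat.Prime).card : ℕ) : ℝ) ≤ 20 * h / Real.log h := by
  obtain ⟨z, hz1, hz2, hz3⟩ : ∃ z : ℕ, 1 ≤ z ∧ z ^ 8 ≤ h ∧ h < (z + 1) ^ 8 := by
    have hex : ∃ z : ℕ, h < (z + 1) ^ 8 := ⟨h, by
      calc h < h + 1 := by omega
        _ ≤ (h + 1) ^ 8 := Nat.le_self_pow (by norm_num) _⟩
    refine ⟨Nat.find hex, ?_, ?_, Nat.find_spec hex⟩
    · by_contra hc
      have h0 : Nat.find hex = 0 := by omega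
      have := Nat.find_spec hex
      rw [h0] at this
      norm_num at this; omega
    · by_contra hc
      have h0 : Nat.find hex ≠ 0 := by
        intro h0; rw [h0] at hc; simp at hc
      have := Nat.find_min hex (m := Nat.find hex - 1) (by omega)
      rw [Nat.sub_add_cancel (by omega)] at this
      exact hc (by omega)
  have hb := selberg_bound a h z hz1
  have hg := selG_ge z
  have hG := selG_pos hz1
  have hh' : (2:ℝ) ≤ h := by exact_mod_cast hh
  have hlog : 0 < Real.log h := Real.log_pos (by linarith)
  have h1 : Real.log h ≤ 16 * selG z := by
    have : Real.log h ≤ Real.log (((z:ℝ) + 1) ^ 8) := by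
      apply Real.log_le_log (by linarith)
      exact_mod_cast hz3.le
    rw [Real.log_pow] at this
    push_cast at this
    linarith
  have h2 : h / selG z ≤ 16 * h / Real.log h := by
    rw [div_le_div_iff₀ hG hlog]
    nlinarith
  have h3 : (z:ℝ) ^ 4 ≤ Real.sqrt h := by
    apply Real.le_sqrt_of_sq_le
    rw [← pow_mul]
    exact_mod_cast hz2
  have h4 : (z:ℝ) ≤ (z:ℝ) ^ 4 := by
    have : (1:ℝ) ≤ z := by exact_mod_cast hz1
    exact le_self_pow₀ this (by norm_num)
  have h5 : Real.sqrt h ≤ 2 * h / Real.log h := by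
    rw [le_div_iff₀ hlog]
    have hs : 0 < Real.sqrt h := Real.sqrt_pos.2 (by linarith)
    have e := Real.mul_self_sqrt (show (0:ℝ) ≤ h by linarith)
    have : Real.log h ≤ 2 * Real.sqrt h := by
      have := Real.log_le_sub_one_of_pos hs
      rw [Real.log_sqrt (by linarith)] at this
      linarith
    nlinarith
  calc _ ≤ _ := hb
    _ ≤ 16 * h / Real.log h + 2 * (2 * h / Real.log h) := by linarith
    _ = _ := by ring

end RMF

namespace RMF
open Finset

/-- squared coefficient: `1/p` at primes -/
def aq (j : ℕ) : ℝ := if j.Prime then 1 / (j : ℝ) else 0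

def Pi (m : ℕ) : ℝ := ∏ j ∈ range m, (1 + aq j)

lemma aq_nonneg (j : ℕ) : 0 ≤ aq j := by
  unfold aq; split_ifs <;> positivity

lemma aq_le_half (j : ℕ) : aq j ≤ 1 / 2 := by
  unfold aq; split_ifs with h
  · exact one_div_le_one_div_of_le (by norm_num) (by exact_mod_cast h.two_le)
  · norm_num

lemma Pi_pos (m : ℕ) : 0 < Pi m := Finset.prod_pos fun j _ => by have := aq_nonneg j; linarith

lemma Pi_succ (m : ℕ) : Pi (m + 1) = Pi m * (1 + aq m) := Finset.prod_range_succ _ _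

lemma Pi_mono {m m' : ℕ} (h : m ≤ m') : Pi m ≤ Pi m' := by
  induction m', h using Nat.le_induction with
  | base => rfl
  | succ M hM ih =>
    rw [Pi_succ]
    nlinarith [Pi_pos M, aq_nonneg M]

lemma one_le_Pi (m : ℕ) : 1 ≤ Pi m := by
  have := Pi_mono (Nat.zero_le m)
  simpa [Pi] using this

lemma mertens1 (n : ℕ) (hn : 1 ≤ n) :
    ∑ j ∈ range (n + 1), aq j * Real.log j ≤ Real.log n + Real.log 4 := by
  have hn0 : (0:ℝ) < n := by exact_mod_cast hn
  have h1 : ∀ j ∈ Icc 1 n, ∑ p ∈ (range (n + 1)).filter Nat.Prime, (if p ∣ j then Real.log p else 0) ≤ Real.log n := by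
    intro j hj
    rw [mem_Icc] at hj
    rw [← Finset.sum_filter, Finset.filter_filter]
    have : (range (n + 1)).filter (fun p => p.Prime ∧ p ∣ j) = j.primeFactors := by
      ext p
      simp only [mem_filter, mem_range, Nat.mem_primeFactors]
      constructor
      · rintro ⟨_, h1, h2⟩; exact ⟨h1, h2, by omega⟩
      · rintro ⟨h1, h2, _⟩
        exact ⟨by have := Nat.le_of_dvd (by omega) h2; omega, h1, h2⟩
    rw [this, ← Real.log_prod (fun p hp => by
      have := (Nat.prime_of_mem_primeFactors hp).pos; positivity)]
    apply Real.log_le_log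
    · apply Finset.prod_pos; intro p hp
      have := (Nat.prime_of_mem_primeFactors hp).pos; positivity
    · have h3 := Nat.le_of_dvd (by omega) (Nat.prod_primeFactors_dvd j)
      have h4 := h3.trans hj.2
      rw [← Nat.cast_prod]
      exact_mod_cast h4
  have h2 := Finset.sum_le_sum h1
  rw [Finset.sum_comm, Finset.sum_const, Nat.card_Icc, nsmul_eq_mul, Nat.add_sub_cancel] at h2
  have h3 : ∀ p ∈ (range (n + 1)).filter Nat.Prime, (n:ℝ) * (aq p * Real.log p) - Real.log p ≤
      ∑ j ∈ Icc 1 n, (if p ∣ j then Real.log p else 0) := by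
    intro p hp
    rw [mem_filter] at hp
    rw [← Finset.sum_filter, Finset.sum_const, nsmul_eq_mul]
    have hp0 := hp.2.pos
    have hl : 0 ≤ Real.log p := Real.log_natCast_nonneg p
    have hc : (n:ℝ) / p - 1 ≤ (((Icc 1 n).filter (p ∣ ·)).card : ℝ) := by
      have h5 : Icc 1 n = Ioc 0 n := by ext; simp; omega
      rw [h5, Nat.Ioc_filter_dvd_card_eq_div]
      have := Nat.lt_floor_add_one ((n:ℝ) / p)
      rw [Nat.floor_div_natCast, Nat.floor_natCast] at this
      linarith
    have : aq p = 1 / p := by simp [aq, hp.2]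
    rw [this]
    calc _ = ((n:ℝ) / p - 1) * Real.log p := by ring
      _ ≤ _ := by gcongr
  have h4 := Finset.sum_le_sum h3
  rw [Finset.sum_sub_distrib, ← Finset.mul_sum] at h4
  have h5 : ∑ p ∈ (range (n + 1)).filter Nat.Prime, Real.log p ≤ Real.log 4 * n := by
    have := Chebyshev.theta_le_log4_mul_x (x := n) (by positivity)
    rw [Chebyshev.theta_eq_sum_Icc, Nat.floor_natCast] at this
    convert this using 2
    ext p; simp
  have h6 : ∑ p ∈ (range (n + 1)).filter Nat.Prime, aq p * Real.log p = ∑ j ∈ range (n + 1), aq j * Real.log j := by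
    rw [Finset.sum_filter]
    apply Finset.sum_congr rfl
    intro j _
    split_ifs with h
    · rfl
    · simp [aq, h]
  rw [h6] at h4
  have h7 : (n:ℝ) * ∑ j ∈ range (n + 1), aq j * Real.log j ≤ n * (Real.log n + Real.log 4) := by
    linarith
  exact le_of_mul_le_mul_left h7 hn0

lemma mertens2 (n : ℕ) (hn : 2 ≤ n) :
    ∑ j ∈ range (n + 1), aq j ≤ Real.log (Real.log n) + 4 := by
  set A : ℕ → ℝ := fun n => ∑ j ∈ range (n + 1), aq j * Real.log j with hA
  have key : ∀ n : ℕ, 2 ≤ n → ∑ j ∈ range (n + 1), aq j - A n / Real.log n ≤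
      Real.log (Real.log n) - Real.log (Real.log 2) + Real.log 4 * (1 / Real.log 2 - 1 / Real.log n) := by
    intro n hn
    induction n, hn using Nat.le_induction with
    | base =>
      have : A 2 = aq 2 * Real.log 2 := by simp [hA, Finset.sum_range_succ, aq]
      rw [this]
      have h2 : Real.log 2 ≠ 0 := (Real.log_pos (by norm_num)).ne'
      simp [Finset.sum_range_succ, aq, Nat.prime_two, Nat.not_prime_one, h2]
    | succ n hn ih =>
      have hn' : (2:ℝ) ≤ n := by exact_mod_cast hn
      have l1 : 0 < Real.log n := Real.log_pos (by linarith)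
      have l2 : 0 < Real.log ((n + 1 : ℕ) : ℝ) := Real.log_pos (by push_cast; linarith)
      have l12 : Real.log n ≤ Real.log ((n + 1 : ℕ) : ℝ) :=
        Real.log_le_log (by linarith) (by push_cast; linarith)
      have hAs : A (n + 1) = A n + aq (n + 1) * Real.log ((n + 1 : ℕ) : ℝ) := by
        simp only [hA]; rw [Finset.sum_range_succ]
      have hm : A n ≤ Real.log n + Real.log 4 := mertens1 n (by omega)
      rw [Finset.sum_range_succ, hAs, add_div, mul_div_assoc, div_self l2.ne']
      have s1 : A n * (1 / Real.log n - 1 / Real.log ((n + 1 : ℕ) : ℝ)) ≤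
          (Real.log n + Real.log 4) * (1 / Real.log n - 1 / Real.log ((n + 1 : ℕ) : ℝ)) := by
        apply mul_le_mul_of_nonneg_right hm
        rw [sub_nonneg]
        exact one_div_le_one_div_of_le l1 l12
      have s2 : Real.log n * (1 / Real.log n - 1 / Real.log ((n + 1 : ℕ) : ℝ)) ≤
          Real.log (Real.log ((n + 1 : ℕ) : ℝ)) - Real.log (Real.log n) := by
        have := Real.log_le_sub_one_of_pos (div_pos l1 l2)
        rw [Real.log_div l1.ne' l2.ne'] at this
        have e : Real.log n * (1 / Real.log n - 1 / Real.log ((n + 1 : ℕ) : ℝ)) = 1 - Real.log n / Real.log ((n + 1 : ℕ) : ℝ) := by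
          field_simp
        rw [e]; linarith
      have e3 : A n / Real.log n - A n / Real.log ((n + 1 : ℕ) : ℝ) = A n * (1 / Real.log n - 1 / Real.log ((n + 1 : ℕ) : ℝ)) := by ring
      nlinarith
  have k := key n hn
  have hm : A n ≤ Real.log n + Real.log 4 := mertens1 n (by omega)
  have hn' : (2:ℝ) ≤ n := by exact_mod_cast hn
  have l1 : 0 < Real.log n := Real.log_pos (by linarith)
  have h1 : A n / Real.log n ≤ 1 + Real.log 4 * (1 / Real.log n) := by
    rw [div_le_iff₀ l1]
    have : (1 + Real.log 4 * (1 / Real.log n)) * Real.log n = Real.log n + Real.log 4 := by field_simp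
    linarith
  have h4 : Real.log 4 = 2 * Real.log 2 := by
    rw [show (4:ℝ) = 2 ^ 2 by norm_num, Real.log_pow]; norm_num
  have h2 : Real.log 4 * (1 / Real.log 2) = 2 := by
    rw [h4]; have : Real.log 2 ≠ 0 := (Real.log_pos (by norm_num)).ne'
    field_simp
  have h3 : -1 ≤ Real.log (Real.log 2) := by
    rw [Real.le_log_iff_exp_le (Real.log_pos (by norm_num))]
    have := Real.log_two_gt_d9
    have h5 : Real.exp (-1) ≤ 1/2 := by
      rw [Real.exp_neg, inv_le_comm₀ (Real.exp_pos _) (by norm_num)]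
      have := Real.exp_one_gt_d9; norm_num; linarith
    linarith
  nlinarith

lemma Pi_le (m : ℕ) (hm : 2 ≤ m) : Pi m ≤ Real.exp 4 * Real.log m := by
  have hn' : (2:ℝ) ≤ m := by exact_mod_cast hm
  have l1 : 0 < Real.log m := Real.log_pos (by linarith)
  calc Pi m ≤ ∏ j ∈ range m, Real.exp (aq j) := by
        apply Finset.prod_le_prod
        · intro j _; have := aq_nonneg j; linarith
        · intro j _; rw [add_comm]; exact Real.add_one_le_exp _
    _ = Real.exp (∑ j ∈ range m, aq j) := (Real.exp_sum _ _).symm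
    _ ≤ Real.exp (Real.log (Real.log m) + 4) := by
        apply Real.exp_le_exp.2
        refine le_trans ?_ (mertens2 m hm)
        rw [Finset.sum_range_succ]; linarith [aq_nonneg m]
    _ = _ := by rw [Real.exp_add, Real.exp_log l1, mul_comm]

/-- product over the elements -/
def nn (u : Finset ℕ) : ℕ := ∏ p ∈ u, p

lemma Pi_expand (m : ℕ) : Pi m = ∑ u ∈ (range m).powerset, ∏ j ∈ u, aq j := Finset.prod_one_add _

lemma Pi_ge (m : ℕ) (hm : 1 ≤ m) : Real.log m ≤ 2 * Pi m := by
  obtain ⟨z, rfl⟩ : ∃ z, m = z + 1 := ⟨m - 1, by omega⟩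
  have h := sum_sqfree_ge z
  push_cast
  refine h.trans ?_
  gcongr
  rw [Pi_expand]
  have hinj : Set.InjOn Nat.primeFactors (selD z) := by
    intro a ha b hb hab
    have ha' := (mem_selD.1 ha).2
    have hb' := (mem_selD.1 hb).2
    rw [← Nat.prod_primeFactors_of_squarefree ha', ← Nat.prod_primeFactors_of_squarefree hb', hab]
  have : ∑ k ∈ selD z, 1 / (k : ℝ) = ∑ u ∈ (selD z).image Nat.primeFactors, ∏ j ∈ u, aq j := by
    rw [Finset.sum_image hinj]
    apply Finset.sum_congr rfl
    intro k hk
    have hk' := (mem_selD.1 hk).2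
    rw [Finset.prod_congr rfl (g := fun j : ℕ => 1 / (j : ℝ)) (by
      intro j hj; simp [aq, Nat.prime_of_mem_primeFactors hj])]
    rw [Finset.prod_div_distrib, Finset.prod_const_one]
    congr 1
    rw [← Nat.cast_prod, Nat.prod_primeFactors_of_squarefree hk']
  rw [this]
  apply Finset.sum_le_sum_of_subset_of_nonneg
  · intro u hu
    rw [mem_image] at hu
    obtain ⟨k, hk, rfl⟩ := hu
    rw [mem_powerset]
    intro p hp
    rw [mem_range]
    have := Nat.le_of_mem_primeFactors hp
    have := (mem_selD.1 hk).1.2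
    omega
  · intro u _ _
    exact Finset.prod_nonneg fun j _ => aq_nonneg j

end RMF

namespace RMF
open Finset

def gam : NNReal := Real.toNNReal (1 / (4 * Real.pi))

lemma gam_coe : (gam : ℝ) = 1 / (4 * Real.pi) := Real.coe_toNNReal _ (by positivity)

lemma gam_ne : gam ≠ 0 := by
  intro h
  have : (gam : ℝ) = 0 := by rw [h]; rfl
  rw [gam_coe] at this
  have h2 : 0 < 1 / (4 * Real.pi) := by positivity
  linarith

/-- the Cauchy measure with characteristic function `exp(-|v|/2)` -/
def nu : Measure ℝ := (cauchyMeasure 0 gam).map (fun x => 2 * Real.pi * x)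

instance : IsProbabilityMeasure nu :=
  Measure.isProbabilityMeasure_map (by fun_prop)

def gexp (x : ℝ) : ℂ := Complex.exp (-(|x| / 2 : ℝ))

lemma gexp_cont : Continuous gexp := by unfold gexp; fun_prop

lemma gexp_mul_pos (ξ : ℝ) : Set.EqOn (fun x : ℝ => Complex.exp (↑(-2 * Real.pi * x * ξ) * Complex.I) • gexp x)
    (fun x : ℝ => Complex.exp ((-1/2 - 2 * Real.pi * ξ * Complex.I) * x)) (Set.Ioi 0) := by
  intro x hx
  simp only [gexp, smul_eq_mul, ← Complex.exp_add]
  rw [abs_of_pos hx]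
  congr 1; push_cast; ring

lemma gexp_mul_neg (ξ : ℝ) : Set.EqOn (fun x : ℝ => Complex.exp (↑(-2 * Real.pi * x * ξ) * Complex.I) • gexp x)
    (fun x : ℝ => Complex.exp ((1/2 - 2 * Real.pi * ξ * Complex.I) * x)) (Set.Iic 0) := by
  intro x hx
  simp only [gexp, smul_eq_mul, ← Complex.exp_add]
  rw [abs_of_nonpos hx]
  congr 1; push_cast; ring

lemma re1 (ξ : ℝ) : (-1/2 - 2 * Real.pi * ξ * Complex.I : ℂ).re = -1/2 := by
  simp

lemma re2 (ξ : ℝ) : (1/2 - 2 * Real.pi * ξ * Complex.I : ℂ).re = 1/2 := by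
  simp

lemma gexp_int1 (ξ : ℝ) : IntegrableOn (fun x : ℝ => Complex.exp (↑(-2 * Real.pi * x * ξ) * Complex.I) • gexp x) (Set.Ioi 0) := by
  rw [integrableOn_congr_fun (gexp_mul_pos ξ) measurableSet_Ioi]
  exact integrableOn_exp_mul_complex_Ioi (by rw [re1]; norm_num) 0

lemma gexp_int2 (ξ : ℝ) : IntegrableOn (fun x : ℝ => Complex.exp (↑(-2 * Real.pi * x * ξ) * Complex.I) • gexp x) (Set.Iic 0) := by
  rw [integrableOn_congr_fun (gexp_mul_neg ξ) measurableSet_Iic]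
  exact integrableOn_exp_mul_complex_Iic (by rw [re2]; norm_num) 0

lemma gexp_integrable : Integrable gexp := by
  have h1 := gexp_int1 0
  have h2 := gexp_int2 0
  simp only [mul_zero, Complex.ofReal_zero, zero_mul, Complex.exp_zero, one_smul] at h1 h2
  have := h2.union h1
  rwa [Set.Iic_union_Ioi, integrableOn_univ] at this

lemma fourier_gexp (ξ : ℝ) : FourierTransform.fourier gexp ξ = (cauchyPDFReal 0 gam ξ : ℂ) := by
  rw [Real.fourier_real_eq_integral_exp_smul, ← intervalIntegral.integral_Iic_add_Ioi (gexp_int2 ξ) (gexp_int1 ξ),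
    setIntegral_congr_fun measurableSet_Iic (gexp_mul_neg ξ), setIntegral_congr_fun measurableSet_Ioi (gexp_mul_pos ξ),
    integral_exp_mul_complex_Iic (by rw [re2]; norm_num), integral_exp_mul_complex_Ioi (by rw [re1]; norm_num)]
  simp only [cauchyPDFReal, gam_coe]
  have n1 : (1/2 - 2 * Real.pi * ξ * Complex.I : ℂ) ≠ 0 := by
    intro h; have := re2 ξ; rw [h] at this; norm_num at this
  have n2 : (-1/2 - 2 * Real.pi * ξ * Complex.I : ℂ) ≠ 0 := by
    intro h; have := re1 ξ; rw [h] at this; norm_num at this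
  have hpi : (Real.pi : ℂ) ≠ 0 := by exact_mod_cast Real.pi_ne_zero
  have n3 : ((ξ:ℂ) ^ 2 + (1 / (4 * (Real.pi:ℂ))) ^ 2) ≠ 0 := by
    have : (ξ ^ 2 + (1 / (4 * Real.pi)) ^ 2 : ℝ) ≠ 0 := by positivity
    exact_mod_cast this
  have n4 : (16 * Real.pi ^ 2 * ξ ^ 2 + 1 : ℂ) ≠ 0 := by
    have : (16 * Real.pi ^ 2 * ξ ^ 2 + 1 : ℝ) ≠ 0 := by positivity
    exact_mod_cast this
  have e : ((ξ:ℂ) ^ 2 + (1 / (4 * (Real.pi:ℂ))) ^ 2) = (16 * Real.pi ^ 2 * ξ ^ 2 + 1) / (16 * Real.pi ^ 2) := by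
    field_simp; ring
  push_cast
  simp only [mul_zero, Complex.exp_zero, sub_zero]
  rw [e, div_add_div _ _ n1 n2, inv_div]
  have e2 : (1/2 - 2 * Real.pi * ξ * Complex.I : ℂ) * (-1/2 - 2 * Real.pi * ξ * Complex.I) = -(16 * Real.pi ^ 2 * ξ ^ 2 + 1) / 4 := by
    ring_nf; rw [Complex.I_sq]; ring
  rw [e2]
  field_simp
  ring

lemma cauchy_charFun (v : ℝ) : ∫ t, Complex.exp (↑(2 * Real.pi * t * v) * Complex.I) • (cauchyPDFReal 0 gam t : ℂ) = gexp v := by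
  have h := gexp_cont.fourierInv_fourier_eq gexp_integrable (by
    have : FourierTransform.fourier gexp = fun ξ => (cauchyPDFReal 0 gam ξ : ℂ) := funext fourier_gexp
    rw [this]
    exact (integrable_cauchyPDFReal 0).ofReal)
  have h2 := congrFun h v
  rw [Real.fourierInv_eq'] at h2
  rw [← h2]
  apply integral_congr_ae
  filter_upwards with t
  rw [fourier_gexp]
  simp only [smul_eq_mul]
  congr 3
  simp; ring

lemma charFun_nu (v : ℝ) : charFun nu v = gexp v := by
  rw [charFun_apply_real, nu, integral_map (by fun_prop) (by
    apply Continuous.aestronglyMeasurable; fun_prop), cauchyMeasure_of_scale_ne_zero _ gam_ne,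
    integral_withDensity_eq_integral_toReal_smul (by fun_prop) (by
      filter_upwards with x; simp [cauchyPDF]), ← cauchy_charFun]
  apply integral_congr_ae
  filter_upwards with t
  rw [cauchyPDF, ENNReal.toReal_ofReal (cauchyPDF_pos 0 gam_ne t).le, smul_eq_mul, Complex.real_smul, mul_comm]
  congr 2
  push_cast; ring

lemma nu_cos (v : ℝ) : ∫ t, Real.cos (v * t) ∂nu = Real.exp (-(|v| / 2)) := by
  have h := charFun_nu v
  rw [charFun_apply_real] at h
  have h2 := congrArg Complex.re h
  have h3 : (gexp v).re = Real.exp (-(|v| / 2)) := by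
    rw [gexp, ← Complex.ofReal_neg, ← Complex.ofReal_exp, Complex.ofReal_re]
  rw [h3] at h2
  rw [← h2]
  have : ∫ t, Real.cos (v * t) ∂nu = ∫ t, RCLike.re (Complex.exp (↑v * ↑t * Complex.I)) ∂nu := by
    apply integral_congr_ae
    filter_upwards with t
    rw [← Complex.ofReal_mul]
    exact (Complex.exp_ofReal_mul_I_re _).symm
  rw [this, integral_re]
  · rfl
  · apply Integrable.of_bound (C := 1)
    · apply Continuous.aestronglyMeasurable; fun_prop
    · filter_upwards with t
      rw [← Complex.ofReal_mul, Complex.norm_exp_ofReal_mul_I]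

lemma nu_tail {r : ℝ} (hr : 0 < r) : nu.real {x | r < |x|} ≤ 2 / r := by
  refine (measureReal_abs_gt_le_integral_charFun hr).trans ?_
  have : ‖∫ t in (-2 * r⁻¹)..(2 * r⁻¹), 1 - charFun nu t‖ ≤ (1 / r) * |2 * r⁻¹ - (-2 * r⁻¹)| := by
    apply intervalIntegral.norm_integral_le_of_norm_le_const
    intro t ht
    rw [Set.uIoc_of_le (by have : 0 < r⁻¹ := by positivity
                           linarith)] at ht
    rw [charFun_nu, gexp]
    have h1 : (1 : ℂ) - Complex.exp (-((|t| / 2 : ℝ) : ℂ)) = ((1 - Real.exp (-(|t| / 2)) : ℝ) : ℂ) := by push_cast; ring_nf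
    have h4 : |t| ≤ 2 * r⁻¹ := abs_le.2 ⟨by linarith [ht.1], ht.2⟩
    have h2 := Real.add_one_le_exp (-(|t| / 2))
    have h3 : Real.exp (-(|t| / 2)) ≤ 1 := Real.exp_le_one_iff.2 (by have := abs_nonneg t; linarith)
    rw [h1, Complex.norm_real, Real.norm_eq_abs, abs_of_nonneg (by linarith), one_div]
    linarith
  calc _ ≤ 2⁻¹ * r * ((1 / r) * |2 * r⁻¹ - (-2 * r⁻¹)|) := by gcongr
    _ = _ := by
      rw [show 2 * r⁻¹ - (-2 * r⁻¹) = 4 * r⁻¹ by ring, abs_of_pos (by positivity)]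
      field_simp; norm_num

end RMF

namespace RMF
open Finset

def aa (j : ℕ) : ℝ := Real.sqrt (aq j)
lemma aa_nonneg (j : ℕ) : 0 ≤ aa j := Real.sqrt_nonneg _
lemma aa_sq (j : ℕ) : aa j ^ 2 = aq j := Real.sq_sqrt (aq_nonneg j)
lemma aa_le_one (j : ℕ) : aa j ≤ 1 := by
  have := aq_le_half j
  rw [← aa_sq] at this
  nlinarith [aa_nonneg j]

def ZZ (M : ℕ) (t : ℝ) (s : Finset ℕ) : ℝ :=
  ∏ j ∈ range M, (1 + 2 * sg s j * aa j * Real.cos (t * Real.log j) + aq j)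

def aU (u : Finset ℕ) : ℝ := ∏ j ∈ u, aa j
def lamU (u : Finset ℕ) : ℝ := ∑ j ∈ u, Real.log j

lemma walsh_congr {N : ℕ} {c c' : Finset ℕ → ℝ} (h : ∀ u ∈ (range N).powerset, c u = c' u) (s : Finset ℕ) :
    walsh N c s = walsh N c' s := by
  unfold walsh
  exact Finset.sum_congr rfl fun u hu => by rw [h u hu]

lemma walsh_lin {N : ℕ} (c c' : Finset ℕ → ℝ) (x y : ℝ) (s : Finset ℕ) :
    walsh N (fun u => x * c u + y * c' u) s = x * walsh N c s + y * walsh N c' s := by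
  unfold walsh
  rw [Finset.mul_sum, Finset.mul_sum, ← Finset.sum_add_distrib]
  exact Finset.sum_congr rfl fun u _ => by ring

def CC (M : ℕ) (t : ℝ) (s : Finset ℕ) : ℝ := walsh M (fun u => aU u * Real.cos (t * lamU u)) s
def DD (M : ℕ) (t : ℝ) (s : Finset ℕ) : ℝ := walsh M (fun u => aU u * Real.sin (t * lamU u)) s

lemma CC_succ (M : ℕ) (t : ℝ) (s : Finset ℕ) : CC (M + 1) t s = CC M t s +
    sg s M * aa M * (Real.cos (t * Real.log M) * CC M t s - Real.sin (t * Real.log M) * DD M t s) := by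
  rw [CC, walsh_succ, walsh_congr (c := fun u => aU (insert M u) * Real.cos (t * lamU (insert M u))) (c' := fun u => (aa M * Real.cos (t * Real.log M)) * (aU u * Real.cos (t * lamU u)) +
    (- aa M * Real.sin (t * Real.log M)) * (aU u * Real.sin (t * lamU u))), walsh_lin]
  · simp only [CC, DD]; ring
  · intro u hu
    have := not_mem_powerset hu
    simp only [aU, lamU, Finset.prod_insert this, Finset.sum_insert this, mul_add, Real.cos_add]
    ring

lemma DD_succ (M : ℕ) (t : ℝ) (s : Finset ℕ) : DD (M + 1) t s = DD M t s +
    sg s M * aa M * (Real.sin (t * Real.log M) * CC M t s + Real.cos (t * Real.log M) * DD M t s) := by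
  rw [DD, walsh_succ, walsh_congr (c := fun u => aU (insert M u) * Real.sin (t * lamU (insert M u))) (c' := fun u => (aa M * Real.sin (t * Real.log M)) * (aU u * Real.cos (t * lamU u)) +
    (aa M * Real.cos (t * Real.log M)) * (aU u * Real.sin (t * lamU u))), walsh_lin]
  · simp only [CC, DD]; ring
  · intro u hu
    have := not_mem_powerset hu
    simp only [aU, lamU, Finset.prod_insert this, Finset.sum_insert this, mul_add, Real.sin_add]
    ring

lemma ZZ_succ (M : ℕ) (t : ℝ) (s : Finset ℕ) : ZZ (M + 1) t s = ZZ M t s *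
    (1 + 2 * sg s M * aa M * Real.cos (t * Real.log M) + aq M) := Finset.prod_range_succ _ _

lemma ZZ_eq (M : ℕ) (t : ℝ) (s : Finset ℕ) : ZZ M t s = CC M t s ^ 2 + DD M t s ^ 2 := by
  induction M with
  | zero => simp [ZZ, CC, DD, walsh, chi, aU, lamU]
  | succ M ih =>
    rw [ZZ_succ, CC_succ, DD_succ, ih, ← aa_sq]
    have h1 := sg_sq s M
    have h2 := Real.sin_sq_add_cos_sq (t * Real.log M)
    set x := CC M t s; set y := DD M t s; set a := aa M; set σ := sg s M
    set c := Real.cos (t * Real.log M); set d := Real.sin (t * Real.log M)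
    have e : (x + σ * a * (c * x - d * y)) ^ 2 + (y + σ * a * (d * x + c * y)) ^ 2 =
      x ^ 2 + y ^ 2 + 2 * σ * a * c * (x ^ 2 + y ^ 2) + σ ^ 2 * a ^ 2 * ((d ^ 2 + c ^ 2) * (x ^ 2 + y ^ 2)) := by ring
    rw [e, h1, h2]; ring

lemma ZZ_nonneg (M : ℕ) (t : ℝ) (s : Finset ℕ) : 0 ≤ ZZ M t s := by
  rw [ZZ_eq]; positivity

lemma dep_ZZ (M : ℕ) (t : ℝ) : Dep M (ZZ M t) := by
  apply dep_prod
  intro i hi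
  exact (dep_sg (mem_range.1 hi)).comp (fun x => 1 + 2 * x * aa i * Real.cos (t * Real.log i) + aq i)

lemma ZZ_cont (M : ℕ) (s : Finset ℕ) : Continuous (fun t => ZZ M t s) := by
  unfold ZZ; fun_prop

lemma ZZ_bound (M : ℕ) (t : ℝ) (s : Finset ℕ) : ZZ M t s ≤ 4 ^ M := by
  induction M with
  | zero => simp [ZZ]
  | succ M ih =>
    rw [ZZ_succ, pow_succ]
    have h1 := abs_sg s M
    have h2 := Real.abs_cos_le_one (t * Real.log M)
    have h3 : |2 * sg s M * aa M * Real.cos (t * Real.log M)| ≤ 2 := by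
      rw [abs_mul, abs_mul, abs_mul, h1, abs_of_nonneg (aa_nonneg M), abs_of_pos (by norm_num : (0:ℝ) < 2)]
      have := aa_le_one M
      have := aa_nonneg M
      calc 2 * 1 * aa M * |Real.cos (t * Real.log M)| ≤ 2 * 1 * 1 * 1 := by gcongr
        _ = 2 := by norm_num
    have h4 := (abs_le.1 h3).2
    have h5 := aq_le_half M
    nlinarith [ZZ_nonneg M t s]

lemma ZZ_integrable (M : ℕ) (s : Finset ℕ) : Integrable (fun t => ZZ M t s) nu := by
  apply Integrable.of_bound (C := 4 ^ M) (ZZ_cont M s).aestronglyMeasurable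
  filter_upwards with t
  rw [Real.norm_eq_abs, abs_of_nonneg (ZZ_nonneg M t s)]
  exact ZZ_bound M t s

lemma ZZ_avg (M : ℕ) (t : ℝ) (s : Finset ℕ) (hs : s ∈ (range M).powerset) :
    (ZZ (M + 1) t s + ZZ (M + 1) t (insert M s)) / 2 = (1 + aq M) * ZZ M t s := by
  rw [ZZ_succ, ZZ_succ, (dep_ZZ M t).ins le_rfl, sg_insert_self, sg_of_not_mem (not_mem_powerset hs)]
  ring

lemma Ex_ZZ (M : ℕ) (t : ℝ) : Ex M (ZZ M t) = Pi M := by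
  induction M with
  | zero => simp [Ex, ZZ, Pi]
  | succ M ih =>
    rw [Ex_succ, Pi_succ, ← ih, ← Ex_add, ← Ex_mul_right, ]
    rw [show ∀ x : ℝ, x / 2 = (1/2) * x by intro x; ring, ← Ex_mul_left]
    apply Ex_congr
    intro s hs
    have := ZZ_avg M t s hs
    linarith

def II (M : ℕ) (s : Finset ℕ) : ℝ := ∫ t, ZZ M t s ∂nu

lemma II_nonneg (M : ℕ) (s : Finset ℕ) : 0 ≤ II M s := integral_nonneg fun t => ZZ_nonneg M t s

lemma dep_II (M : ℕ) : Dep M (II M) := by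
  intro s
  unfold II
  simp only [dep_ZZ M _ s]

lemma II_avg (M : ℕ) (s : Finset ℕ) (hs : s ∈ (range M).powerset) :
    (II (M + 1) s + II (M + 1) (insert M s)) / 2 = (1 + aq M) * II M s := by
  unfold II
  rw [← integral_add (ZZ_integrable _ _) (ZZ_integrable _ _), ← integral_div, ← integral_const_mul]
  exact integral_congr_ae (by filter_upwards with t; exact ZZ_avg M t s hs)

/-- the normalized martingale -/
def RR (M : ℕ) (s : Finset ℕ) : ℝ := II M s / Pi M

lemma RR_nonneg (M : ℕ) (s : Finset ℕ) : 0 ≤ RR M s := div_nonneg (II_nonneg M s) (Pi_pos M).le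

lemma dep_RR (M : ℕ) : Dep M (RR M) := (dep_II M).comp (fun x => x / Pi M)

lemma RR_avg (M : ℕ) (s : Finset ℕ) (hs : s ∈ (range M).powerset) :
    (RR (M + 1) s + RR (M + 1) (insert M s)) / 2 = RR M s := by
  have h := II_avg M s hs
  have h1 := Pi_pos M
  have h2 : 0 < 1 + aq M := by have := aq_nonneg M; linarith
  unfold RR
  rw [Pi_succ, ← add_div, div_div, div_eq_div_iff (by positivity) (by positivity)]
  linear_combination 2 * Pi M * h

/-! ### arithmetic -/
def fs (s : Finset ℕ) (m : ℕ) : ℝ := if Squarefree m then chi m.primeFactors s else 0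
def SS (s : Finset ℕ) (j : ℕ) : ℝ := ∑ m ∈ Icc 1 j, fs s m

def PP (M : ℕ) : Finset ℕ := (range M).filter Nat.Prime

lemma nn_pos {M : ℕ} {u : Finset ℕ} (hu : u ⊆ PP M) : 1 ≤ nn u :=
  Finset.prod_pos fun p hp => (mem_filter.1 (hu hp)).2.pos

lemma nn_primeFactors {m : ℕ} (h : Squarefree m) : nn m.primeFactors = m :=
  Nat.prod_primeFactors_of_squarefree h

lemma primeFactors_nn {M : ℕ} {u : Finset ℕ} (hu : u ⊆ PP M) : (nn u).primeFactors = u :=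
  Nat.primeFactors_prod fun p hp => (mem_filter.1 (hu hp)).2

lemma squarefree_nn {M : ℕ} {u : Finset ℕ} (hu : u ⊆ PP M) : Squarefree (nn u) := by
  unfold nn
  apply Finset.squarefree_prod_of_pairwise_isCoprime
  · intro a ha b hb hab
    exact Nat.coprime_iff_isRelPrime.1 ((Nat.coprime_primes (mem_filter.1 (hu ha)).2 (mem_filter.1 (hu hb)).2).2 hab)
  · intro p hp
    exact (Nat.Prime.prime (mem_filter.1 (hu hp)).2).squarefree

lemma primeFactors_subset_PP {m M : ℕ} (hm : m < M) : m.primeFactors ⊆ PP M := by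
  intro p hp
  have := Nat.le_of_mem_primeFactors hp
  simp only [PP, mem_filter, mem_range]
  exact ⟨by omega, Nat.prime_of_mem_primeFactors hp⟩

/-- transfer between square-free integers and sets of primes -/
lemma sum_sqfree_bij {M j : ℕ} (hj : j < M) (g : Finset ℕ → ℝ) :
    ∑ u ∈ (PP M).powerset.filter (fun u => nn u ≤ j), g u =
      ∑ m ∈ Icc 1 j, if Squarefree m then g m.primeFactors else 0 := by
  rw [← Finset.sum_filter]
  apply Finset.sum_nbij' nn Nat.primeFactors
  · intro u hu
    rw [mem_filter, mem_powerset] at hu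
    rw [mem_filter, mem_Icc]
    exact ⟨⟨nn_pos hu.1, hu.2⟩, squarefree_nn hu.1⟩
  · intro m hm
    rw [mem_filter, mem_Icc] at hm
    rw [mem_filter, mem_powerset, nn_primeFactors hm.2]
    exact ⟨primeFactors_subset_PP (by omega), hm.1.2⟩
  · intro u hu
    rw [mem_filter, mem_powerset] at hu
    exact primeFactors_nn hu.1
  · intro m hm
    rw [mem_filter] at hm
    exact nn_primeFactors hm.2
  · intro u hu
    rw [mem_filter, mem_powerset] at hu
    rw [primeFactors_nn hu.1]

lemma II_expand (M : ℕ) (s : Finset ℕ) : II M s =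
    ∑ u ∈ (range M).powerset, ∑ v ∈ (range M).powerset, chi u s * chi v s * (aU u * aU v * Real.exp (-(|lamU u - lamU v| / 2))) := by
  have h : ∀ t, ZZ M t s = ∑ u ∈ (range M).powerset, ∑ v ∈ (range M).powerset,
      chi u s * chi v s * (aU u * aU v * Real.cos ((lamU u - lamU v) * t)) := by
    intro t
    rw [ZZ_eq, CC, DD, walsh, walsh, pow_two, pow_two, Finset.sum_mul_sum, Finset.sum_mul_sum, ← Finset.sum_add_distrib]
    apply Finset.sum_congr rfl; intro u _
    rw [← Finset.sum_add_distrib]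
    apply Finset.sum_congr rfl; intro v _
    rw [show (lamU u - lamU v) * t = t * lamU u - t * lamU v by ring, Real.cos_sub]
    ring
  have hi : ∀ v : ℝ, Integrable (fun t => Real.cos (v * t)) nu := by
    intro v
    apply Integrable.of_bound (C := 1) (by apply Continuous.aestronglyMeasurable; fun_prop)
    filter_upwards with t
    exact Real.abs_cos_le_one _
  unfold II
  simp only [h]
  rw [integral_finset_sum _ (by
    intro u _
    apply integrable_finset_sum; intro v _
    exact ((hi _).const_mul _).const_mul _)]
  apply Finset.sum_congr rfl; intro u _
  rw [integral_finset_sum _ (by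
    intro v _
    exact ((hi _).const_mul _).const_mul _)]
  apply Finset.sum_congr rfl; intro v _
  rw [integral_const_mul, integral_const_mul, nu_cos]

lemma aU_zero {M : ℕ} {u : Finset ℕ} (hu : u ∈ (range M).powerset) (h : u ∉ (PP M).powerset) : aU u = 0 := by
  rw [mem_powerset] at hu h
  obtain ⟨p, hp, hp2⟩ := Finset.not_subset.1 h
  apply Finset.prod_eq_zero hp
  have : ¬ p.Prime := fun h3 => hp2 (mem_filter.2 ⟨hu hp, h3⟩)
  simp [aa, aq, this]

lemma aU_sq {M : ℕ} {u : Finset ℕ} (hu : u ⊆ PP M) : aU u = Real.exp (-(lamU u / 2)) := by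
  unfold aU lamU
  rw [Finset.sum_div, ← Finset.sum_neg_distrib, Real.exp_sum]
  apply Finset.prod_congr rfl
  intro p hp
  have hp1 := (mem_filter.1 (hu hp)).2
  have hp0 : (0:ℝ) < p := by exact_mod_cast hp1.pos
  rw [aa, aq, if_pos hp1, Real.sqrt_eq_iff_eq_sq (by positivity) (by positivity), ← Real.exp_nat_mul]
  push_cast
  rw [show (2:ℝ) * -(Real.log p / 2) = - Real.log p by ring, Real.exp_neg, Real.exp_log hp0, one_div]

lemma lamU_eq {M : ℕ} {u : Finset ℕ} (hu : u ⊆ PP M) : lamU u = Real.log (nn u) := by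
  unfold lamU nn
  rw [Nat.cast_prod, Real.log_prod]
  intro p hp
  have hp1 := (mem_filter.1 (hu hp)).2.pos
  positivity

lemma kernel_eq {M : ℕ} {u v : Finset ℕ} (hu : u ⊆ PP M) (hv : v ⊆ PP M) :
    aU u * aU v * Real.exp (-(|lamU u - lamU v| / 2)) = 1 / ((max (nn u) (nn v) : ℕ) : ℝ) := by
  have h1 : (0:ℝ) < nn u := by exact_mod_cast nn_pos hu
  have h2 : (0:ℝ) < nn v := by exact_mod_cast nn_pos hv
  rw [aU_sq hu, aU_sq hv, ← Real.exp_add, ← Real.exp_add, lamU_eq hu, lamU_eq hv]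
  rcases le_total (nn u) (nn v) with h | h
  · have h' : Real.log (nn u) ≤ Real.log (nn v) := Real.log_le_log h1 (by exact_mod_cast h)
    rw [max_eq_right h, abs_of_nonpos (by linarith),
      show -(Real.log (nn u) / 2) + -(Real.log (nn v) / 2) + -(-(Real.log (nn u) - Real.log (nn v)) / 2) = - Real.log (nn v) by ring,
      Real.exp_neg, Real.exp_log h2, one_div]
  · have h' : Real.log (nn v) ≤ Real.log (nn u) := Real.log_le_log h2 (by exact_mod_cast h)
    rw [max_eq_left h, abs_of_nonneg (by linarith),
      show -(Real.log (nn u) / 2) + -(Real.log (nn v) / 2) + -((Real.log (nn u) - Real.log (nn v)) / 2) = - Real.log (nn u) by ring,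
      Real.exp_neg, Real.exp_log h1, one_div]

lemma inv_tele {a J : ℕ} (ha : 1 ≤ a) (hJ : a ≤ J) :
    1 / (a : ℝ) = ∑ j ∈ Ico 1 J, (if a ≤ j then 1 / ((j : ℝ) * (j + 1)) else 0) + 1 / J := by
  induction J, hJ using Nat.le_induction with
  | base =>
    rw [Finset.sum_eq_zero]
    · simp
    · intro j hj; rw [mem_Ico] at hj; rw [if_neg (by omega)]
  | succ J hJ ih =>
    rw [Finset.sum_Ico_succ_top (by omega), if_pos hJ, ih]
    have : (0:ℝ) < J := by exact_mod_cast (by omega : 0 < J)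
    push_cast
    field_simp
    ring

lemma II_ge (M : ℕ) (s : Finset ℕ) :
    ∑ j ∈ Ico 1 M, SS s j ^ 2 / ((j : ℝ) * (j + 1)) ≤ II M s := by
  have h0 : II M s = ∑ u ∈ (PP M).powerset, ∑ v ∈ (PP M).powerset, chi u s * chi v s * (1 / ((max (nn u) (nn v) : ℕ) : ℝ)) := by
    have hsub : (PP M).powerset ⊆ (range M).powerset := Finset.powerset_mono.2 (Finset.filter_subset _ _)
    rw [II_expand]
    rw [← Finset.sum_subset hsub (by
      intro u hu hu2
      apply Finset.sum_eq_zero; intro v _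
      rw [aU_zero hu hu2]; ring)]
    apply Finset.sum_congr rfl; intro u hu
    rw [← Finset.sum_subset hsub (by
      intro v hv hv2
      rw [aU_zero hv hv2]; ring)]
    apply Finset.sum_congr rfl; intro v hv
    rw [kernel_eq (mem_powerset.1 hu) (mem_powerset.1 hv)]
  set J := M + nn (PP M) with hJ
  have hle : ∀ u ∈ (PP M).powerset, nn u ≤ J := by
    intro u hu
    rw [mem_powerset] at hu
    have : nn u ≤ nn (PP M) := by
      apply Finset.prod_le_prod_of_subset_of_one_le' hu
      intro p hp _
      exact (mem_filter.1 hp).2.pos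
    omega
  have h1 : II M s = ∑ j ∈ Ico 1 J, (∑ u ∈ (PP M).powerset.filter (fun u => nn u ≤ j), chi u s) ^ 2 / ((j : ℝ) * (j + 1)) +
      (∑ u ∈ (PP M).powerset, chi u s) ^ 2 * (1 / J) := by
    have e1 : ∀ u ∈ (PP M).powerset, ∀ v ∈ (PP M).powerset, chi u s * chi v s * (1 / ((max (nn u) (nn v) : ℕ) : ℝ)) =
        ∑ j ∈ Ico 1 J, ((if nn u ≤ j then chi u s else 0) * (if nn v ≤ j then chi v s else 0)) / ((j : ℝ) * (j + 1)) + chi u s * chi v s * (1 / J) := by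
      intro u hu v hv
      rw [inv_tele (le_max_of_le_left (nn_pos (mem_powerset.1 hu))) (max_le (hle u hu) (hle v hv)), mul_add, Finset.mul_sum]
      congr 1
      apply Finset.sum_congr rfl; intro j _
      by_cases h1 : nn u ≤ j <;> by_cases h2 : nn v ≤ j <;> simp [h1, h2]
      rw [div_eq_mul_inv, mul_inv]; ring
    rw [h0, Finset.sum_congr rfl fun u hu => Finset.sum_congr rfl fun v hv => e1 u hu v hv]
    simp only [Finset.sum_add_distrib]
    congr 1
    · rw [Finset.sum_congr rfl fun u _ => Finset.sum_comm, Finset.sum_comm]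
      apply Finset.sum_congr rfl; intro j _
      rw [Finset.sum_filter, pow_two, Finset.sum_mul_sum, Finset.sum_div]
      apply Finset.sum_congr rfl; intro u _
      rw [Finset.sum_div]
    · rw [pow_two, Finset.sum_mul_sum, Finset.sum_mul]
      apply Finset.sum_congr rfl; intro u _
      rw [Finset.sum_mul]
  rw [h1]
  have h2 : ∑ j ∈ Ico 1 M, SS s j ^ 2 / ((j : ℝ) * (j + 1)) ≤ ∑ j ∈ Ico 1 J, (∑ u ∈ (PP M).powerset.filter (fun u => nn u ≤ j), chi u s) ^ 2 / ((j : ℝ) * (j + 1)) := by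
    calc _ = ∑ j ∈ Ico 1 M, (∑ u ∈ (PP M).powerset.filter (fun u => nn u ≤ j), chi u s) ^ 2 / ((j : ℝ) * (j + 1)) := by
          apply Finset.sum_congr rfl; intro j hj
          rw [mem_Ico] at hj
          rw [sum_sqfree_bij hj.2]; rfl
      _ ≤ _ := by
          apply Finset.sum_le_sum_of_subset_of_nonneg
          · apply Finset.Ico_subset_Ico_right; omega
          · intro _ _ _; positivity
  have h3 : 0 ≤ (∑ u ∈ (PP M).powerset, chi u s) ^ 2 * (1 / (J:ℝ)) := by positivity
  linarith

end RMF

namespace RMF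
open Finset

/-! ### a convexity inequality -/

lemma rpow_pair_ge {κ v : ℝ} (h1 : κ ≤ 1) (hv0 : 0 ≤ v) (hv : v < 1) :
    2 ≤ (1 + v) ^ (κ - 1) + (1 - v) ^ (κ - 1) := by
  have a1 : 0 < 1 + v := by linarith
  have a2 : 0 < 1 - v := by linarith
  rw [Real.rpow_def_of_pos a1, Real.rpow_def_of_pos a2]
  have e1 := Real.add_one_le_exp (Real.log (1 + v) * (κ - 1))
  have e2 := Real.add_one_le_exp (Real.log (1 - v) * (κ - 1))
  have e3 := Real.log_le_sub_one_of_pos a1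
  have e4 := Real.log_le_sub_one_of_pos a2
  nlinarith

lemma psi_nonneg {κ v : ℝ} (h0 : 0 ≤ κ) (h1 : κ ≤ 1) (hv0 : 0 ≤ v) (hv : v < 1) :
    2 * κ * v ≤ (1 + v) ^ κ - (1 - v) ^ κ := by
  have hd : ∀ x ∈ Set.Ico (0:ℝ) 1, HasDerivAt (fun v : ℝ => (1 + v) ^ κ - (1 - v) ^ κ - 2 * κ * v)
      (1 * κ * (1 + x) ^ (κ - 1) - (-1) * κ * (1 - x) ^ (κ - 1) - 2 * κ * 1) x := by
    intro x hx
    have a1 : 1 + x ≠ 0 := by have := hx.1; positivity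
    have a2 : 1 - x ≠ 0 := by have := hx.2; linarith
    exact ((((hasDerivAt_id x).const_add 1).rpow_const (Or.inl a1)).sub
      (((hasDerivAt_id x).const_sub 1).rpow_const (Or.inl a2))).sub ((hasDerivAt_id x).const_mul _)
  have hm : MonotoneOn (fun v : ℝ => (1 + v) ^ κ - (1 - v) ^ κ - 2 * κ * v) (Set.Ico 0 1) := by
    apply monotoneOn_of_deriv_nonneg (convex_Ico 0 1)
    · exact fun x hx => (hd x hx).continuousAt.continuousWithinAt
    · intro x hx
      exact (hd x (interior_subset hx)).differentiableAt.differentiableWithinAt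
    · intro x hx
      have hx' := interior_subset hx
      rw [(hd x hx').deriv]
      have := rpow_pair_ge h1 hx'.1 hx'.2
      nlinarith
  have := hm (show (0:ℝ) ∈ Set.Ico (0:ℝ) 1 by simp) (show v ∈ Set.Ico (0:ℝ) 1 from ⟨hv0, hv⟩) hv0
  simp at this
  linarith

lemma HH_ge_aux {κ v : ℝ} (h0 : 0 ≤ κ) (h1 : κ ≤ 1) (hv0 : 0 ≤ v) (hv : v < 1) :
    2 + κ * (1 + κ) * v ^ 2 ≤ (1 + v) ^ (1 + κ) + (1 - v) ^ (1 + κ) := by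
  have hd : ∀ x ∈ Set.Ico (0:ℝ) 1, HasDerivAt (fun v : ℝ => (1 + v) ^ (1 + κ) + (1 - v) ^ (1 + κ) - κ * (1 + κ) * v ^ 2)
      (1 * (1 + κ) * (1 + x) ^ (1 + κ - 1) + (-1) * (1 + κ) * (1 - x) ^ (1 + κ - 1) - κ * (1 + κ) * ((2:ℕ) * x ^ (2 - 1) * 1)) x := by
    intro x hx
    have a1 : 1 + x ≠ 0 := by have := hx.1; positivity
    have a2 : 1 - x ≠ 0 := by have := hx.2; linarith
    exact ((((hasDerivAt_id x).const_add 1).rpow_const (Or.inl a1)).add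
      (((hasDerivAt_id x).const_sub 1).rpow_const (Or.inl a2))).sub (((hasDerivAt_id x).pow 2).const_mul _)
  have hm : MonotoneOn (fun v : ℝ => (1 + v) ^ (1 + κ) + (1 - v) ^ (1 + κ) - κ * (1 + κ) * v ^ 2) (Set.Ico 0 1) := by
    apply monotoneOn_of_deriv_nonneg (convex_Ico 0 1)
    · exact fun x hx => (hd x hx).continuousAt.continuousWithinAt
    · intro x hx
      exact (hd x (interior_subset hx)).differentiableAt.differentiableWithinAt
    · intro x hx
      have hx' := interior_subset hx
      rw [(hd x hx').deriv]
      have := psi_nonneg h0 h1 hx'.1 hx'.2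
      rw [add_sub_cancel_left]
      simp only [Nat.cast_ofNat, Nat.add_one_sub_one, pow_one]
      nlinarith
  have := hm (show (0:ℝ) ∈ Set.Ico (0:ℝ) 1 by simp) (show v ∈ Set.Ico (0:ℝ) 1 from ⟨hv0, hv⟩) hv0
  simp at this
  linarith

lemma HH_ge {κ v : ℝ} (h0 : 0 ≤ κ) (h1 : κ ≤ 1) (hv : |v| < 1) :
    2 + κ * (1 + κ) * v ^ 2 ≤ (1 + v) ^ (1 + κ) + (1 - v) ^ (1 + κ) := by
  have h := HH_ge_aux h0 h1 (abs_nonneg v) hv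
  rcases abs_cases v with ⟨h2, _⟩ | ⟨h2, _⟩
  · rwa [h2] at h
  · rw [h2] at h
    rw [sub_neg_eq_add, ← sub_eq_add_neg, neg_sq] at h
    linarith

lemma log_one_add_ge {x : ℝ} (hx : 0 ≤ x) : x - x ^ 2 ≤ Real.log (1 + x) := by
  have h := Real.one_sub_inv_le_log_of_pos (show 0 < 1 + x by linarith)
  have : x - x ^ 2 ≤ 1 - (1 + x)⁻¹ := by
    have h1 : 0 < 1 + x := by linarith
    have : 1 - (1 + x)⁻¹ = x / (1 + x) := by field_simp; ring
    rw [this, le_div_iff₀ h1]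
    nlinarith [pow_nonneg hx 3]
  linarith

/-! ### local factors -/

def rr (t : ℝ) (j : ℕ) (x : ℝ) : ℝ := 1 + 2 * x * aa j * Real.cos (t * Real.log j) + aq j

def cc (κ t : ℝ) (j : ℕ) : ℝ := (rr t j 1 ^ (1 + κ) + rr t j (-1) ^ (1 + κ)) / 2

def CK (κ t : ℝ) (m : ℕ) : ℝ := ∏ j ∈ range m, cc κ t j

lemma aa_lt (j : ℕ) : aa j < 1 := by
  have := aq_le_half j
  rw [← aa_sq] at this
  nlinarith [aa_nonneg j]

lemma rr_pos (t : ℝ) (j : ℕ) {x : ℝ} (hx : |x| = 1) : 0 < rr t j x := by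
  unfold rr
  rw [← aa_sq]
  have h1 : |x * Real.cos (t * Real.log j)| ≤ 1 := by
    rw [abs_mul, hx, one_mul]; exact Real.abs_cos_le_one _
  have h2 := (abs_le.1 h1).1
  have h3 := aa_lt j
  have h4 := aa_nonneg j
  nlinarith [mul_le_mul_of_nonneg_left h2 h4, pow_pos (sub_pos.2 h3) 2]

lemma rr_le (t : ℝ) (j : ℕ) {x : ℝ} (hx : |x| = 1) : rr t j x ≤ 4 := by
  unfold rr
  rw [← aa_sq]
  have h1 : |x * Real.cos (t * Real.log j)| ≤ 1 := by
    rw [abs_mul, hx, one_mul]; exact Real.abs_cos_le_one _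
  have h2 := (abs_le.1 h1).2
  have h3 := aa_lt j
  have h4 := aa_nonneg j
  nlinarith [mul_le_mul_of_nonneg_left h2 h4]

lemma ZZ_succ' (M : ℕ) (t : ℝ) (s : Finset ℕ) : ZZ (M + 1) t s = ZZ M t s * rr t M (sg s M) := ZZ_succ M t s

lemma ZZ_pos (M : ℕ) (t : ℝ) (s : Finset ℕ) : 0 < ZZ M t s :=
  Finset.prod_pos fun j _ => rr_pos t j (abs_sg s j)

lemma cc_pos (κ t : ℝ) (j : ℕ) : 0 < cc κ t j := by
  unfold cc
  have h1 := Real.rpow_pos_of_pos (rr_pos t j (x := 1) (by simp)) (1 + κ)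
  have h2 := Real.rpow_pos_of_pos (rr_pos t j (x := -1) (by simp)) (1 + κ)
  linarith

lemma CK_pos (κ t : ℝ) (m : ℕ) : 0 < CK κ t m := Finset.prod_pos fun j _ => cc_pos κ t j
lemma CK_succ (κ t : ℝ) (m : ℕ) : CK κ t (m + 1) = CK κ t m * cc κ t m := Finset.prod_range_succ _ _

set_option maxHeartbeats 600000 in
lemma log_cc_ge {κ : ℝ} (t : ℝ) (j : ℕ) (h0 : 0 ≤ κ) (h1 : κ ≤ 1) :
    (1 + κ) * Real.log (1 + aq j) + max 0 (κ * (1 + κ) * aq j * (1 + Real.cos (2 * (t * Real.log j))) - 24 * κ * aq j ^ 2)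
      ≤ Real.log (cc κ t j) := by
  set a := aq j with ha
  have ha0 : 0 ≤ a := aq_nonneg j
  have ha1 : a ≤ 1 / 2 := aq_le_half j
  set c := Real.cos (t * Real.log j) with hc
  have hc2 : 1 + Real.cos (2 * (t * Real.log j)) = 2 * c ^ 2 := by
    rw [Real.cos_two_mul]; ring
  have hρ : 0 < 1 + a := by linarith
  have hcle : |c| ≤ 1 := Real.abs_cos_le_one _
  have hcsq : c ^ 2 ≤ 1 := (sq_le_one_iff_abs_le_one c).2 hcle
  set v := 2 * aa j * c / (1 + a) with hv
  have hvlt : |v| < 1 := by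
    rw [hv, abs_div, abs_of_pos hρ, div_lt_one hρ, abs_mul, abs_of_nonneg (by have := aa_nonneg j; positivity), ha, ← aa_sq]
    have h3 := aa_lt j
    have h4 := aa_nonneg j
    nlinarith [pow_pos (sub_pos.2 h3) 2]
  have hv2 : v ^ 2 = 4 * a * c ^ 2 / (1 + a) ^ 2 := by
    rw [hv, div_pow, ha, ← aa_sq]; ring
  have e1 : rr t j 1 = (1 + a) * (1 + v) := by
    rw [hv]; unfold rr; field_simp; rw [← hc]; ring
  have e2 : rr t j (-1) = (1 + a) * (1 - v) := by
    rw [hv]; unfold rr; field_simp; rw [← hc]; ring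
  have hv' := abs_lt.1 hvlt
  set x := κ * (1 + κ) * v ^ 2 / 2 with hx
  have hx0 : 0 ≤ x := by positivity
  have h3 : (1 + a) ^ (1 + κ) * (1 + x) ≤ cc κ t j := by
    unfold cc
    rw [e1, e2, Real.mul_rpow hρ.le (by linarith), Real.mul_rpow hρ.le (by linarith), ← mul_add, mul_div_assoc]
    apply mul_le_mul_of_nonneg_left _ (Real.rpow_nonneg hρ.le _)
    have := HH_ge h0 h1 hvlt
    rw [hx]; linarith
  have h4 : Real.log ((1 + a) ^ (1 + κ) * (1 + x)) ≤ Real.log (cc κ t j) :=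
    Real.log_le_log (mul_pos (Real.rpow_pos_of_pos hρ _) (by linarith)) h3
  rw [Real.log_mul (Real.rpow_pos_of_pos hρ _).ne' (by linarith), Real.log_rpow hρ] at h4
  refine le_trans ?_ h4
  apply add_le_add le_rfl
  apply max_le (Real.log_nonneg (by linarith))
  refine le_trans ?_ (log_one_add_ge hx0)
  rw [hc2]
  have hxe : x = 2 * κ * (1 + κ) * a * c ^ 2 / (1 + a) ^ 2 := by rw [hx, hv2]; ring
  have hinv : 1 - 2 * a ≤ 1 / (1 + a) ^ 2 := by
    rw [le_div_iff₀ (by positivity)]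
    nlinarith [pow_nonneg ha0 2, pow_nonneg ha0 3]
  have hinv1 : 1 / (1 + a) ^ 2 ≤ 1 := by
    rw [div_le_one (by positivity)]; nlinarith
  set w := 2 * κ * (1 + κ) * a * c ^ 2 with hw
  have hw0 : 0 ≤ w := by positivity
  have hw4 : w ≤ 4 * κ * a := by
    rw [hw]
    have i1 : κ * a * ((1 + κ) * c ^ 2) ≤ κ * a * 2 := by
      apply mul_le_mul_of_nonneg_left _ (by positivity)
      calc (1 + κ) * c ^ 2 ≤ 2 * 1 := mul_le_mul (by linarith) hcsq (sq_nonneg c) (by norm_num)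
        _ = 2 := by norm_num
    calc _ = 2 * (κ * a * ((1 + κ) * c ^ 2)) := by ring
      _ ≤ 2 * (κ * a * 2) := by linarith
      _ = _ := by ring
  have hx1 : w * (1 - 2 * a) ≤ x := by
    rw [hxe, div_eq_mul_one_div]
    exact mul_le_mul_of_nonneg_left hinv hw0
  have hx2 : x ≤ w := by
    rw [hxe, div_eq_mul_one_div]
    exact mul_le_of_le_one_right hw0 hinv1
  have hxs : x ^ 2 ≤ 16 * κ * a ^ 2 := by
    have : x ^ 2 ≤ (4 * κ * a) ^ 2 := pow_le_pow_left₀ hx0 (hx2.trans hw4) 2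
    have k2 : κ ^ 2 ≤ κ := by nlinarith
    have k3 := mul_le_mul_of_nonneg_right k2 (sq_nonneg a)
    have k4 : (4 * κ * a) ^ 2 = 16 * (κ ^ 2 * a ^ 2) := by ring
    rw [k4] at this
    linarith
  have h9 : w * a ≤ 4 * κ * a ^ 2 := by
    have := mul_le_mul_of_nonneg_right hw4 ha0
    calc _ ≤ _ := this
      _ = _ := by ring
  have h10 : κ * (1 + κ) * a * (2 * c ^ 2) = w := by rw [hw]; ring
  have h11 : w * (1 - 2 * a) = w - 2 * (w * a) := by ring
  rw [h10]
  rw [h11] at hx1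
  linarith

lemma sum_aq_sq (z m : ℕ) : ∑ j ∈ Ico z m, aq j ^ 2 ≤ 1 := by
  have h1 : ∀ j, aq j ^ 2 ≤ if j ≤ 1 then 0 else 1 / ((j:ℝ) - 1) - 1 / j := by
    intro j
    unfold aq
    split_ifs with hp hj hj
    · have := hp.two_le; omega
    · have h2 : (2:ℝ) ≤ j := by exact_mod_cast (show 2 ≤ j by omega)
      rw [div_sub_div _ _ (by linarith) (by linarith), div_pow, div_le_div_iff₀ (by positivity) (by nlinarith)]
      nlinarith
    · simp
    · have h2 : (2:ℝ) ≤ j := by exact_mod_cast (show 2 ≤ j by omega)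
      rw [zero_pow two_ne_zero, sub_nonneg]
      exact one_div_le_one_div_of_le (by linarith) (by linarith)
  have h2 : ∑ j ∈ Ico z m, aq j ^ 2 ≤ ∑ j ∈ range m, aq j ^ 2 := by
    apply Finset.sum_le_sum_of_subset_of_nonneg
    · intro j hj; simp at hj ⊢; exact hj.2
    · intros; positivity
  have h3 : ∀ m, ∑ j ∈ range m, aq j ^ 2 ≤ if m ≤ 1 then 0 else 1 - 1 / ((m:ℝ) - 1) := by
    intro m
    induction m with
    | zero => simp
    | succ m ih =>
      rw [Finset.sum_range_succ]
      have := h1 m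
      rcases Nat.lt_or_ge m 2 with h | h
      · interval_cases m
        · simp at this ⊢; simpa using this
        · simp at this ih; norm_num [this, ih]
      · rw [if_neg (by omega)] at ih this
        rw [if_neg (by omega)]
        push_cast
        rw [add_sub_cancel_right]
        linarith
  have := h3 m
  split_ifs at this with h
  · linarith
  · have : (0:ℝ) ≤ 1 / ((m:ℝ) - 1) := by
      have : (2:ℝ) ≤ m := by exact_mod_cast (show 2 ≤ m by omega)
      apply one_div_nonneg.2; linarith
    linarith

lemma log_Pi (m : ℕ) : Real.log (Pi m) = ∑ j ∈ range m, Real.log (1 + aq j) := by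
  unfold Pi
  rw [Real.log_prod]
  intro j _
  have := aq_nonneg j; linarith

lemma log_Pi_diff {z m : ℕ} (h : z ≤ m) : Real.log (Pi m) - Real.log (Pi z) ≤ ∑ j ∈ Ico z m, aq j := by
  rw [log_Pi, log_Pi, ← Finset.sum_Ico_eq_sub _ h]
  apply Finset.sum_le_sum
  intro j _
  have := aq_nonneg j
  have := Real.log_le_sub_one_of_pos (show 0 < 1 + aq j by linarith)
  linarith

lemma log_CK_ge0 {κ : ℝ} (t : ℝ) (m : ℕ) (h0 : 0 ≤ κ) (h1 : κ ≤ 1) :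
    (1 + κ) * Real.log (Pi m) ≤ Real.log (CK κ t m) := by
  unfold CK
  rw [log_Pi, Real.log_prod (fun j _ => (cc_pos κ t j).ne'), Finset.mul_sum]
  apply Finset.sum_le_sum
  intro j _
  refine le_trans ?_ (log_cc_ge t j h0 h1)
  have := le_max_left 0 (κ * (1 + κ) * aq j * (1 + Real.cos (2 * (t * Real.log j))) - 24 * κ * aq j ^ 2)
  linarith

lemma log_CK_ge {κ : ℝ} (t : ℝ) {z m : ℕ} (hzm : z ≤ m) (h0 : 0 ≤ κ) (h1 : κ ≤ 1) {C1 : ℝ} (hC : 0 ≤ C1)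
    (h : -C1 ≤ ∑ j ∈ Ico z m, aq j * Real.cos (2 * (t * Real.log j))) :
    (1 + κ) * Real.log (Pi m) + κ * (1 + κ) * (Real.log (Pi m) - Real.log (Pi z)) - κ * (2 * C1 + 24) ≤ Real.log (CK κ t m) := by
  have e : Real.log (CK κ t m) = ∑ j ∈ range z, Real.log (cc κ t j) + ∑ j ∈ Ico z m, Real.log (cc κ t j) := by
    unfold CK
    rw [Real.log_prod (fun j _ => (cc_pos κ t j).ne'), Finset.sum_range_add_sum_Ico _ hzm]
  have e' : Real.log (Pi m) = ∑ j ∈ range z, Real.log (1 + aq j) + ∑ j ∈ Ico z m, Real.log (1 + aq j) := by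
    rw [log_Pi, Finset.sum_range_add_sum_Ico _ hzm]
  have b1 : (1 + κ) * ∑ j ∈ range z, Real.log (1 + aq j) ≤ ∑ j ∈ range z, Real.log (cc κ t j) := by
    have := log_CK_ge0 t z h0 h1
    unfold CK at this
    rwa [log_Pi, Real.log_prod (fun j _ => (cc_pos κ t j).ne')] at this
  have b2 : (1 + κ) * ∑ j ∈ Ico z m, Real.log (1 + aq j) + (κ * (1 + κ) * (∑ j ∈ Ico z m, aq j) +
      κ * (1 + κ) * (∑ j ∈ Ico z m, aq j * Real.cos (2 * (t * Real.log j))) - 24 * κ * ∑ j ∈ Ico z m, aq j ^ 2) ≤ ∑ j ∈ Ico z m, Real.log (cc κ t j) := by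
    rw [Finset.mul_sum, Finset.mul_sum, Finset.mul_sum, Finset.mul_sum, ← Finset.sum_add_distrib, ← Finset.sum_sub_distrib, ← Finset.sum_add_distrib]
    apply Finset.sum_le_sum
    intro j _
    refine le_trans ?_ (log_cc_ge t j h0 h1)
    have := le_max_right 0 (κ * (1 + κ) * aq j * (1 + Real.cos (2 * (t * Real.log j))) - 24 * κ * aq j ^ 2)
    linarith
  have b3 := log_Pi_diff hzm
  have b4 := sum_aq_sq z m
  have b5 : κ * (1 + κ) * (Real.log (Pi m) - Real.log (Pi z)) ≤ κ * (1 + κ) * (∑ j ∈ Ico z m, aq j) :=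
    mul_le_mul_of_nonneg_left b3 (by positivity)
  have b6 : κ * (1 + κ) * (-C1) ≤ κ * (1 + κ) * (∑ j ∈ Ico z m, aq j * Real.cos (2 * (t * Real.log j))) :=
    mul_le_mul_of_nonneg_left h (by positivity)
  have b7 : 24 * κ * ∑ j ∈ Ico z m, aq j ^ 2 ≤ 24 * κ := by nlinarith
  have b8 : κ * (1 + κ) * C1 ≤ κ * (2 * C1) := by nlinarith [mul_nonneg h0 hC]
  rw [e, e', ]
  rw [e'] at b5
  linarith

/-! ### ballot argument -/

def bar (t b : ℝ) (m : ℕ) (s : Finset ℕ) : Prop := ∀ i ≤ m, ZZ i t s ≤ b * Pi i ^ 2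

lemma dep_bar (t b : ℝ) (m : ℕ) : Dep m (bar t b m) := by
  intro s
  unfold bar
  apply propext
  apply forall_congr'; intro i
  apply forall_congr'; intro hi
  rw [(dep_ZZ i t).mono hi s]

lemma bar_succ (t b : ℝ) (m : ℕ) (s : Finset ℕ) : bar t b (m + 1) s ↔ bar t b m s ∧ ZZ (m + 1) t s ≤ b * Pi (m + 1) ^ 2 := by
  unfold bar
  constructor
  · intro h
    exact ⟨fun i hi => h i (by omega), h _ le_rfl⟩
  · rintro ⟨h1, h2⟩ i hi
    rcases Nat.lt_or_ge i (m + 1) with h | h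
    · exact h1 i (by omega)
    · rw [show i = m + 1 by omega]; exact h2

lemma Ex_ZZ_ind (t b : ℝ) (m : ℕ) : Ex (m + 1) (fun s => ZZ (m + 1) t s / Pi (m + 1) * ind (bar t b m s)) =
    Ex m (fun s => ZZ m t s / Pi m * ind (bar t b m s)) := by
  have := Ex_step (N := m) (fun s x => ZZ m t s * rr t m x / Pi (m + 1) * ind (bar t b m s)) (by
    intro x
    exact (dep_ZZ m t).comp₂ (dep_bar t b m) (fun z q => z * rr t m x / Pi (m + 1) * ind q))
  simp only [ZZ_succ']
  rw [this]
  congr 1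
  funext s
  rw [Pi_succ]
  unfold rr
  have h1 := Pi_pos m
  have h2 : 0 < 1 + aq m := by have := aq_nonneg m; linarith
  field_simp
  ring

lemma Ex_MM_ind (κ t b : ℝ) (m : ℕ) : Ex (m + 1) (fun s => ZZ (m + 1) t s ^ (1 + κ) / CK κ t (m + 1) * ind (bar t b m s)) =
    Ex m (fun s => ZZ m t s ^ (1 + κ) / CK κ t m * ind (bar t b m s)) := by
  have := Ex_step (N := m) (fun s x => (ZZ m t s * rr t m x) ^ (1 + κ) / CK κ t (m + 1) * ind (bar t b m s)) (by
    intro x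
    exact (dep_ZZ m t).comp₂ (dep_bar t b m) (fun z q => (z * rr t m x) ^ (1 + κ) / CK κ t (m + 1) * ind q))
  simp only [ZZ_succ']
  rw [this]
  congr 1
  funext s
  rw [CK_succ, Real.mul_rpow (ZZ_nonneg _ _ _) (rr_pos t m (by simp)).le, Real.mul_rpow (ZZ_nonneg _ _ _) (rr_pos t m (by simp)).le]
  have h1 := CK_pos κ t m
  have h2 := cc_pos κ t m
  have h3 : rr t m 1 ^ (1 + κ) + rr t m (-1) ^ (1 + κ) = 2 * cc κ t m := by unfold cc; ring
  calc _ = ZZ m t s ^ (1 + κ) * (rr t m 1 ^ (1 + κ) + rr t m (-1) ^ (1 + κ)) / (CK κ t m * cc κ t m) * ind (bar t b m s) / 2 := by ring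
    _ = _ := by rw [h3]; field_simp

lemma MM_le {κ t b K : ℝ} (h0 : 0 ≤ κ) {i : ℕ} (hK : (4 * b * Pi i ^ 2) ^ κ * Pi i ≤ K * CK κ t i) (s : Finset ℕ)
    (hZ : ZZ i t s ≤ 4 * b * Pi i ^ 2) : ZZ i t s ^ (1 + κ) / CK κ t i ≤ K * (ZZ i t s / Pi i) := by
  have h1 := Pi_pos i
  have h2 := CK_pos κ t i
  have h3 := ZZ_pos i t s
  rw [Real.rpow_add h3, Real.rpow_one, div_le_iff₀ h2]
  have h4 : ZZ i t s ^ κ ≤ (4 * b * Pi i ^ 2) ^ κ := Real.rpow_le_rpow h3.le hZ h0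
  have h5 : ZZ i t s ^ κ * Pi i ≤ K * CK κ t i := (mul_le_mul_of_nonneg_right h4 h1.le).trans hK
  have h6 : ZZ i t s ^ κ ≤ K * CK κ t i / Pi i := (le_div_iff₀ h1).2 h5
  calc ZZ i t s * ZZ i t s ^ κ ≤ ZZ i t s * (K * CK κ t i / Pi i) := mul_le_mul_of_nonneg_left h6 h3.le
    _ = _ := by ring

lemma ballot_ind {κ t b K : ℝ} (h0 : 0 ≤ κ) (hb : 1 ≤ b) {Y : ℕ}
    (hK : ∀ i ≤ Y, (4 * b * Pi i ^ 2) ^ κ * Pi i ≤ K * CK κ t i) (m : ℕ) (hm : m ≤ Y) :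
    1 ≤ K * (1 - Ex m (fun s => ZZ m t s / Pi m * ind (bar t b m s))) +
      Ex m (fun s => ZZ m t s ^ (1 + κ) / CK κ t m * ind (bar t b m s)) := by
  induction m with
  | zero =>
    have : bar t b 0 ∅ := by
      intro i hi
      obtain rfl : i = 0 := by omega
      simpa [ZZ, Pi] using hb
    simp [Ex, ZZ, Pi, CK, ind_true this]
  | succ m ih =>
    have ih := ih (by omega)
    rw [← Ex_ZZ_ind, ← Ex_MM_ind] at ih
    have key : Ex (m + 1) (fun s => ZZ (m + 1) t s ^ (1 + κ) / CK κ t (m + 1) * ind (bar t b m s)) ≤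
        Ex (m + 1) (fun s => ZZ (m + 1) t s ^ (1 + κ) / CK κ t (m + 1) * ind (bar t b (m + 1) s) +
          K * (ZZ (m + 1) t s / Pi (m + 1) * ind (bar t b m s) - ZZ (m + 1) t s / Pi (m + 1) * ind (bar t b (m + 1) s))) := by
      apply Ex_mono'
      intro s
      by_cases h1 : bar t b m s
      · by_cases h2 : bar t b (m + 1) s
        · rw [ind_true h1, ind_true h2]; linarith
        · rw [ind_true h1, ind_false h2]
          have hz : ZZ (m + 1) t s ≤ 4 * b * Pi (m + 1) ^ 2 := by
            rw [ZZ_succ']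
            have a1 := h1 m le_rfl
            have a2 := rr_le t m (abs_sg s m)
            have a3 := rr_pos t m (abs_sg s m)
            have a4 : Pi m ^ 2 ≤ Pi (m + 1) ^ 2 := pow_le_pow_left₀ (Pi_pos m).le (Pi_mono (by omega)) 2
            calc _ ≤ (b * Pi m ^ 2) * 4 := mul_le_mul a1 a2 a3.le (by positivity)
              _ ≤ (b * Pi (m + 1) ^ 2) * 4 := by gcongr
              _ = _ := by ring
          have := MM_le h0 (hK (m + 1) hm) s hz
          linarith
      · have h2 : ¬ bar t b (m + 1) s := fun h => h1 ((bar_succ _ _ _ _).1 h).1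
        rw [ind_false h1, ind_false h2]; linarith
    rw [Ex_add, Ex_mul_left, Ex_sub] at key
    linarith

theorem ballot {κ t B C1 : ℝ} (h0 : 0 < κ) (h1 : κ ≤ 1) (hB : 0 ≤ B) (hC : 0 ≤ C1) {z Y : ℕ} (hzY : z ≤ Y)
    (h : ∀ m, z ≤ m → m ≤ Y → -C1 ≤ ∑ j ∈ Ico z m, aq j * Real.cos (2 * (t * Real.log j))) :
    Ex Y (fun s => ZZ Y t s / Pi Y * ind (bar t (Real.exp (2 * B)) Y s)) ≤
      κ * (2 * B + Real.log (Pi z) + 2 * C1 + 26) + Real.exp (-(κ ^ 2 * (Real.log (Pi Y) - Real.log (Pi z)))) := by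
  set b := Real.exp (2 * B) with hbdef
  have hb : 1 ≤ b := Real.one_le_exp (by linarith)
  set L := κ * (2 * B + Real.log (Pi z) + 2 * C1 + 26) with hL
  have hlog4 : Real.log 4 ≤ 2 := by
    rw [show (4:ℝ) = 2 ^ 2 by norm_num, Real.log_pow]
    have := Real.log_two_lt_d9; push_cast; linarith
  have hPz : 0 ≤ Real.log (Pi z) := Real.log_nonneg (one_le_Pi z)
  have hlogK : ∀ i, Real.log ((4 * b * Pi i ^ 2) ^ κ * Pi i) = κ * (Real.log 4 + 2 * B + 2 * Real.log (Pi i)) + Real.log (Pi i) := by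
    intro i
    have hp := Pi_pos i
    rw [Real.log_mul (by positivity) hp.ne', Real.log_rpow (by positivity), Real.log_mul (by positivity) (by positivity),
      Real.log_mul (by norm_num) (by positivity), Real.log_pow, hbdef, Real.log_exp]
    push_cast; ring
  have hgen : ∀ i (x : ℝ), κ * (Real.log 4 + 2 * B + 2 * Real.log (Pi i)) + Real.log (Pi i) ≤ x + Real.log (CK κ t i) →
      (4 * b * Pi i ^ 2) ^ κ * Pi i ≤ Real.exp x * CK κ t i := by
    intro i x hx
    have hp := Pi_pos i
    have hc := CK_pos κ t i
    rw [← hlogK, ← Real.log_exp x, ← Real.log_mul (Real.exp_pos _).ne' hc.ne'] at hx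
    exact (Real.log_le_log_iff (by positivity) (by positivity)).1 hx
  have hmain : ∀ i, z ≤ i → i ≤ Y → κ * (Real.log 4 + 2 * B + 2 * Real.log (Pi i)) + Real.log (Pi i) ≤
      (L - κ ^ 2 * (Real.log (Pi i) - Real.log (Pi z))) + Real.log (CK κ t i) := by
    intro i h2 h3
    have := log_CK_ge t h2 h0.le h1 hC (h i h2 h3)
    rw [hL]
    nlinarith
  have hK : ∀ i ≤ Y, (4 * b * Pi i ^ 2) ^ κ * Pi i ≤ Real.exp L * CK κ t i := by
    intro i hi
    apply hgen
    rcases Nat.lt_or_ge i z with h2 | h2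
    · have e1 := log_CK_ge0 t i h0.le h1
      have e2 : Real.log (Pi i) ≤ Real.log (Pi z) := Real.log_le_log (Pi_pos i) (Pi_mono h2.le)
      rw [hL]
      nlinarith
    · have e1 := hmain i h2 hi
      have e2 : Real.log (Pi z) ≤ Real.log (Pi i) := Real.log_le_log (Pi_pos z) (Pi_mono h2)
      nlinarith [mul_nonneg (sq_nonneg κ) (sub_nonneg.2 e2)]
  have hI := ballot_ind h0.le hb hK Y le_rfl
  have hK' := hgen Y _ (hmain Y hzY le_rfl)
  set D := κ ^ 2 * (Real.log (Pi Y) - Real.log (Pi z)) with hD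
  set q := Ex Y (fun s => ZZ Y t s / Pi Y * ind (bar t b Y s)) with hq
  have hq1 : q ≤ 1 := by
    have : q ≤ Ex Y (fun s => ZZ Y t s / Pi Y) := by
      apply Ex_mono'
      intro s
      have := ind_le_one (bar t b Y s)
      have h3 : 0 ≤ ZZ Y t s / Pi Y := div_nonneg (ZZ_nonneg _ _ _) (Pi_pos _).le
      nlinarith
    refine this.trans (le_of_eq ?_)
    simp only [div_eq_mul_inv]
    rw [Ex_mul_right, Ex_ZZ, mul_inv_cancel₀ (Pi_pos Y).ne']
  have hP : Ex Y (fun s => ZZ Y t s ^ (1 + κ) / CK κ t Y * ind (bar t b Y s)) ≤ Real.exp (L - D) * q := by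
    rw [hq, ← Ex_mul_left]
    apply Ex_mono'
    intro s
    by_cases h2 : bar t b Y s
    · rw [ind_true h2, mul_one, mul_one]
      apply MM_le h0.le hK'
      have := h2 Y le_rfl
      have h3 : 0 ≤ b * Pi Y ^ 2 := by positivity
      nlinarith
    · rw [ind_false h2]; simp
  have hP2 : Real.exp (L - D) * q ≤ Real.exp (L - D) := by
    have := Real.exp_pos (L - D); nlinarith
  have hfin : 1 ≤ Real.exp L * (1 - q) + Real.exp L * Real.exp (-D) := by
    rw [← Real.exp_add, ← sub_eq_add_neg]; linarith
  have hL1 := Real.add_one_le_exp (-L)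
  have hLL : Real.exp L * Real.exp (-L) = 1 := by rw [← Real.exp_add]; simp
  have hpos := Real.exp_pos L
  have : Real.exp L * Real.exp (-L) ≤ Real.exp L * (1 - q + Real.exp (-D)) := by rw [hLL]; linarith
  have := le_of_mul_le_mul_left this hpos
  linarith

end RMF

namespace RMF
open Finset

def yy (k : ℕ) : ℕ := 2 ^ (2 ^ k)

lemma yy_two_le (k : ℕ) : 2 ≤ yy k := by
  unfold yy
  calc 2 = 2 ^ 1 := by norm_num
    _ ≤ _ := Nat.pow_le_pow_right (by norm_num) Nat.one_le_two_pow

lemma yy_mono {k l : ℕ} (h : k ≤ l) : yy k ≤ yy l :=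
  Nat.pow_le_pow_right (by norm_num) (Nat.pow_le_pow_right (by norm_num) h)

lemma log_yy (k : ℕ) : Real.log (yy k) = 2 ^ k * Real.log 2 := by
  unfold yy; push_cast; rw [Real.log_pow]; push_cast; rfl

lemma loglog_yy (k : ℕ) : Real.log (Real.log (yy k)) = k * Real.log 2 + Real.log (Real.log 2) := by
  have := Real.log_pos (show (1:ℝ) < 2 by norm_num)
  rw [log_yy, Real.log_mul (by positivity) this.ne', Real.log_pow]

lemma loglog2_neg : Real.log (Real.log 2) ≤ 0 :=
  Real.log_nonpos (Real.log_nonneg (by norm_num)) (by have := Real.log_two_lt_d9; linarith)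

lemma logPi_yy_le (k : ℕ) : Real.log (Pi (yy k)) ≤ 4 + k * Real.log 2 + Real.log (Real.log 2) := by
  have h2 : (1:ℝ) < yy k := by exact_mod_cast yy_two_le k
  have hl := Real.log_pos h2
  have := Real.log_le_log (Pi_pos _) (Pi_le (yy k) (yy_two_le k))
  rw [Real.log_mul (Real.exp_pos _).ne' hl.ne', Real.log_exp, loglog_yy] at this
  linarith

lemma logPi_yy_ge (k : ℕ) : k * Real.log 2 + Real.log (Real.log 2) - Real.log 2 ≤ Real.log (Pi (yy k)) := by
  have h2 : (1:ℝ) < yy k := by exact_mod_cast yy_two_le k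
  have hl := Real.log_pos h2
  have := Real.log_le_log hl (Pi_ge (yy k) (by have := yy_two_le k; omega))
  rw [Real.log_mul (by norm_num) (Pi_pos _).ne', loglog_yy] at this
  linarith

lemma aq_le_two_log (j : ℕ) : aq j ≤ 2 * Real.log (1 + aq j) := by
  have h1 := aq_nonneg j
  have h2 := aq_le_half j
  have := log_one_add_ge h1
  nlinarith

lemma sum_aq_block (k : ℕ) : ∑ j ∈ Ico (yy k) (yy (k + 1)), aq j ≤ 12 := by
  have h1 : ∑ j ∈ Ico (yy k) (yy (k + 1)), aq j ≤ 2 * (Real.log (Pi (yy (k+1))) - Real.log (Pi (yy k))) := by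
    rw [log_Pi, log_Pi, ← Finset.sum_Ico_eq_sub _ (yy_mono (Nat.le_succ k)), Finset.mul_sum]
    exact Finset.sum_le_sum fun j _ => aq_le_two_log j
  have h2 := logPi_yy_le (k + 1)
  have h3 := logPi_yy_ge k
  have := Real.log_two_lt_d9
  push_cast at h2
  nlinarith

/-- the trigonometric sums at checkpoints -/
def DDk (z m : ℕ) (t : ℝ) : ℝ := ∑ j ∈ Ico z m, aq j * Real.cos (2 * (t * Real.log j))

lemma DDk_cont (z m : ℕ) : Continuous (DDk z m) := by unfold DDk; fun_prop

lemma DDk_bound (z m : ℕ) (t : ℝ) : |DDk z m t| ≤ ∑ j ∈ Ico z m, aq j := by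
  unfold DDk
  refine (Finset.abs_sum_le_sum_abs _ _).trans (Finset.sum_le_sum fun j _ => ?_)
  rw [abs_mul, abs_of_nonneg (aq_nonneg j)]
  exact mul_le_of_le_one_right (aq_nonneg j) (Real.abs_cos_le_one _)

lemma DDk_sq_int (z m : ℕ) : Integrable (fun t => DDk z m t ^ 2) nu := by
  apply Integrable.of_bound (C := (∑ j ∈ Ico z m, aq j) ^ 2) ((DDk_cont z m).pow 2).aestronglyMeasurable
  filter_upwards with t
  rw [Real.norm_eq_abs, Pi.pow_apply, abs_pow]
  exact pow_le_pow_left₀ (abs_nonneg _) (DDk_bound z m t) 2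

lemma DDk_cond {k0 n : ℕ} {t : ℝ} (h : ∀ k, k0 ≤ k → k ≤ n → |DDk (yy k0) (yy k) t| ≤ 1) (m : ℕ)
    (h1 : yy k0 ≤ m) (h2 : m ≤ yy n) : -13 ≤ DDk (yy k0) m t := by
  have hk : k0 ≤ n := by
    by_contra hc
    have : yy n < yy k0 := Nat.pow_lt_pow_right (by norm_num) (Nat.pow_lt_pow_right (by norm_num) (by omega))
    omega
  -- find block
  have : ∃ k, k0 ≤ k ∧ k ≤ n ∧ yy k ≤ m ∧ m ≤ yy (k + 1) := by
    induction n, hk using Nat.le_induction with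
    | base => exact ⟨k0, le_rfl, le_rfl, h1, h2.trans (yy_mono (Nat.le_succ _))⟩
    | succ n hn ih =>
      rcases Nat.lt_or_ge m (yy n) with hm | hm
      · obtain ⟨k, a, b, c⟩ := ih (fun k a b => h k a (by omega)) hm.le
        exact ⟨k, a, by omega, c⟩
      · exact ⟨n, hn, by omega, hm, h2⟩
  obtain ⟨k, a, b, c, d⟩ := this
  have e : DDk (yy k0) m t = DDk (yy k0) (yy k) t + DDk (yy k) m t := by
    unfold DDk
    rw [Finset.sum_Ico_consecutive _ (yy_mono a) c]
  have e1 := (abs_le.1 (h k a b)).1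
  have e2 := (abs_le.1 (DDk_bound (yy k) m t)).1
  have e3 : ∑ j ∈ Ico (yy k) m, aq j ≤ 12 := by
    refine le_trans ?_ (sum_aq_block k)
    apply Finset.sum_le_sum_of_subset_of_nonneg (Finset.Ico_subset_Ico le_rfl d)
    intros; exact aq_nonneg _
  rw [e]; linarith

lemma cos_cos_int (q q' : ℕ) (hq : 1 ≤ q) (hq' : 1 ≤ q') (h : q' ≤ q) :
    ∫ t, Real.cos (2 * (t * Real.log q)) * Real.cos (2 * (t * Real.log q')) ∂nu ≤ (q':ℝ) / q := by
  have a1 : (1:ℝ) ≤ q := by exact_mod_cast hq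
  have a2 : (1:ℝ) ≤ q' := by exact_mod_cast hq'
  have e : ∀ t : ℝ, Real.cos (2 * (t * Real.log q)) * Real.cos (2 * (t * Real.log q')) =
      (Real.cos ((2 * (Real.log q - Real.log q')) * t) + Real.cos ((2 * (Real.log q + Real.log q')) * t)) / 2 := by
    intro t
    rw [show (2 * (Real.log q - Real.log q')) * t = 2 * (t * Real.log q) - 2 * (t * Real.log q') by ring,
      show (2 * (Real.log q + Real.log q')) * t = 2 * (t * Real.log q) + 2 * (t * Real.log q') by ring, Real.cos_sub, Real.cos_add]
    ring
  have hintg : ∀ v : ℝ, Integrable (fun t => Real.cos (v * t)) nu := by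
    intro v
    apply Integrable.of_bound (C := 1) (by fun_prop)
    filter_upwards with t
    exact Real.abs_cos_le_one _
  simp_rw [e]
  rw [integral_div, integral_add (hintg _) (hintg _), nu_cos, nu_cos]
  have l1 : 0 ≤ Real.log q' := Real.log_nonneg a2
  have l2 : Real.log q' ≤ Real.log q := Real.log_le_log (by linarith) (by exact_mod_cast h)
  rw [abs_of_nonneg (by linarith), abs_of_nonneg (by linarith)]
  have f1 : Real.exp (-(2 * (Real.log q - Real.log q') / 2)) = (q':ℝ) / q := by
    rw [show -(2 * (Real.log q - Real.log q') / 2) = Real.log q' - Real.log q by ring, Real.exp_sub,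
      Real.exp_log (by linarith), Real.exp_log (by linarith)]
  have f2 : Real.exp (-(2 * (Real.log q + Real.log q') / 2)) ≤ Real.exp (-(2 * (Real.log q - Real.log q') / 2)) :=
    Real.exp_le_exp.2 (by linarith)
  linarith

lemma sum_primes_le (q : ℕ) (hq : 2 ≤ q) : ∑ q' ∈ range (q + 1), aq q' * q' ≤ 20 * q / Real.log q := by
  refine le_trans (le_of_eq ?_) (brun_titchmarsh 0 q hq)
  rw [show ∑ q' ∈ range (q + 1), aq q' * q' = ∑ q' ∈ range (q+1), if q'.Prime then (1:ℝ) else 0 from ?_]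
  · rw [Finset.sum_boole]
    congr 2
    ext p
    simp only [mem_filter, mem_range, mem_Ioc, zero_add]
    constructor
    · rintro ⟨h1, h2⟩; exact ⟨⟨h2.pos, by omega⟩, h2⟩
    · rintro ⟨⟨h1, h3⟩, h2⟩; exact ⟨by omega, h2⟩
  · apply Finset.sum_congr rfl
    intro p _
    unfold aq
    split_ifs with h
    · have : (p:ℝ) ≠ 0 := by exact_mod_cast h.pos.ne'
      field_simp
    · simp

lemma DDk_sq_integral {z m : ℕ} (hz : 2 ≤ z) :
    ∫ t, DDk z m t ^ 2 ∂nu ≤ 40 / Real.log z * ∑ q ∈ Ico z m, aq q := by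
  have hintg : ∀ v w : ℝ, Integrable (fun t => Real.cos (2 * (t * v)) * Real.cos (2 * (t * w))) nu := by
    intro v w
    apply Integrable.of_bound (C := 1) (by fun_prop)
    filter_upwards with t
    rw [Real.norm_eq_abs, abs_mul]
    exact mul_le_one₀ (Real.abs_cos_le_one _) (abs_nonneg _) (Real.abs_cos_le_one _)
  set I : ℕ → ℕ → ℝ := fun q q' => ∫ t, Real.cos (2 * (t * Real.log q)) * Real.cos (2 * (t * Real.log q')) ∂nu with hI
  have e1 : ∫ t, DDk z m t ^ 2 ∂nu = ∑ q ∈ Ico z m, ∑ q' ∈ Ico z m, aq q * aq q' * I q q' := by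
    have : ∀ t, DDk z m t ^ 2 = ∑ q ∈ Ico z m, ∑ q' ∈ Ico z m, aq q * aq q' * (Real.cos (2 * (t * Real.log q)) * Real.cos (2 * (t * Real.log q'))) := by
      intro t
      unfold DDk
      rw [pow_two, Finset.sum_mul_sum]
      refine Finset.sum_congr rfl fun q _ => Finset.sum_congr rfl fun q' _ => by ring
    simp_rw [this]
    rw [integral_finset_sum _ fun q _ => integrable_finset_sum _ fun q' _ => (hintg _ _).const_mul _]
    refine Finset.sum_congr rfl fun q _ => ?_
    rw [integral_finset_sum _ fun q' _ => (hintg _ _).const_mul _]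
    refine Finset.sum_congr rfl fun q' _ => ?_
    rw [integral_const_mul]
  have hsymm : ∀ q q', I q q' = I q' q := by
    intro q q'; simp only [hI]; congr 1; funext t; ring
  -- bound by symmetric sum
  have e2 : ∀ q ∈ Ico z m, ∀ q' ∈ Ico z m, aq q * aq q' * I q q' ≤
      (if q' ≤ q then aq q * aq q' * ((q':ℝ) / q) else 0) + (if q ≤ q' then aq q' * aq q * ((q:ℝ) / q') else 0) := by
    intro q hq q' hq'
    have hq := (mem_Ico.1 hq).1
    have hq' := (mem_Ico.1 hq').1
    have n1 := mul_nonneg (aq_nonneg q) (aq_nonneg q')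
    have n2 := mul_nonneg (aq_nonneg q') (aq_nonneg q)
    rcases le_total q' q with h | h
    · rw [if_pos h]
      have := mul_le_mul_of_nonneg_left (cos_cos_int q q' (by omega) (by omega) h) n1
      have h3 : (0:ℝ) ≤ if q ≤ q' then aq q' * aq q * ((q:ℝ) / q') else 0 := by split_ifs <;> positivity
      simp only [hI]; linarith
    · rw [if_pos h, hsymm, mul_comm (aq q)]
      have := mul_le_mul_of_nonneg_left (cos_cos_int q' q (by omega) (by omega) h) n2
      have h3 : (0:ℝ) ≤ if q' ≤ q then aq q' * aq q * ((q':ℝ) / q) else 0 := by split_ifs <;> positivity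
      simp only [hI]; linarith
  rw [e1]
  refine (Finset.sum_le_sum fun q hq => Finset.sum_le_sum fun q' hq' => e2 q hq q' hq').trans ?_
  simp only [Finset.sum_add_distrib]
  rw [Finset.sum_comm (f := fun q q' => if q ≤ q' then aq q' * aq q * ((q:ℝ) / q') else 0), ← two_mul]
  have e3 : ∀ q ∈ Ico z m, ∑ q' ∈ Ico z m, (if q' ≤ q then aq q * aq q' * ((q':ℝ) / q) else 0) ≤ 20 / Real.log z * aq q := by
    intro q hq
    have hq := (mem_Ico.1 hq).1
    have hq0 : (0:ℝ) < q := by exact_mod_cast (show 0 < q by omega)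
    have hz1 : (1:ℝ) < z := by exact_mod_cast hz
    have hlz := Real.log_pos hz1
    have hlq : Real.log z ≤ Real.log q := Real.log_le_log (by linarith) (by exact_mod_cast hq)
    calc _ = ∑ q' ∈ (Ico z m).filter (· ≤ q), aq q / q * (aq q' * q') := by
          rw [Finset.sum_filter]
          refine Finset.sum_congr rfl fun q' _ => ?_
          split_ifs
          · ring
          · rfl
      _ ≤ ∑ q' ∈ range (q + 1), aq q / q * (aq q' * q') := by
          apply Finset.sum_le_sum_of_subset_of_nonneg
          · intro x hx; simp at hx ⊢; omega
          · intro x _ _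
            have := aq_nonneg q
            have := aq_nonneg x
            positivity
      _ ≤ aq q / q * (20 * q / Real.log q) := by
          rw [← Finset.mul_sum]
          exact mul_le_mul_of_nonneg_left (sum_primes_le q (by omega)) (div_nonneg (aq_nonneg q) hq0.le)
      _ = aq q * (20 / Real.log q) := by field_simp
      _ ≤ aq q * (20 / Real.log z) := by
          apply mul_le_mul_of_nonneg_left _ (aq_nonneg q)
          exact div_le_div_of_nonneg_left (by norm_num) hlz hlq
      _ = _ := by ring
  have := Finset.sum_le_sum e3
  rw [← Finset.mul_sum] at this
  calc _ ≤ 2 * (20 / Real.log z * ∑ q ∈ Ico z m, aq q) := by linarith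
    _ = _ := by ring

lemma DDk_sq_yy (k0 k n : ℕ) (hk : k ≤ n) : ∫ t, DDk (yy k0) (yy k) t ^ 2 ∂nu ≤ 60 * (n + 4) / 2 ^ k0 := by
  refine (DDk_sq_integral (yy_two_le k0)).trans ?_
  have h1 : ∑ q ∈ Ico (yy k0) (yy k), aq q ≤ n + 4 := by
    have : ∑ q ∈ Ico (yy k0) (yy k), aq q ≤ ∑ q ∈ range (yy n + 1), aq q := by
      apply Finset.sum_le_sum_of_subset_of_nonneg
      · intro x hx
        have := yy_mono hk
        simp at hx ⊢; omega
      · intros; exact aq_nonneg _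
    have h2 := mertens2 (yy n) (yy_two_le n)
    rw [loglog_yy] at h2
    have := loglog2_neg
    have := Real.log_two_lt_d9
    have hn : (0:ℝ) ≤ n := Nat.cast_nonneg n
    nlinarith
  have hl2 := Real.log_two_gt_d9
  rw [log_yy]
  have h3 : (0:ℝ) < 2 ^ k0 := by positivity
  have h4 : 40 / (2 ^ k0 * Real.log 2) ≤ 60 / 2 ^ k0 := by
    rw [div_le_div_iff₀ (by positivity) h3]
    nlinarith
  calc _ ≤ 60 / 2 ^ k0 * ((n:ℝ) + 4) := mul_le_mul h4 h1 (Finset.sum_nonneg fun _ _ => aq_nonneg _) (by positivity)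
    _ = _ := by ring

def GG (T b : ℝ) (m : ℕ) (s : Finset ℕ) : Prop := ∀ t, |t| ≤ T → bar t b m s

lemma dep_GG (T b : ℝ) (m : ℕ) : Dep m (GG T b m) := by
  intro s
  unfold GG
  simp only [dep_bar _ b m s]

theorem avg_bound {n k0 : ℕ} (hk : k0 ≤ n) {κ B T : ℝ} (h0 : 0 < κ) (h1 : κ ≤ 1) (hB : 0 ≤ B) (hT : 0 < T) :
    Ex (yy n) (fun s => RR (yy n) s * ind (GG T (Real.exp (2 * B)) (yy n) s)) ≤
      κ * (2 * B + k0 + 56) + Real.exp (-(κ ^ 2 * (((n:ℝ) - k0) * Real.log 2 - 5))) + 2 / T +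
        60 * (n + 1) * (n + 4) / 2 ^ k0 := by
  set Y := yy n with hY
  set G := GG T (Real.exp (2 * B)) Y with hG
  set Φ : ℝ → ℝ := fun t => Ex Y (fun s => ZZ Y t s / Pi Y * ind (G s)) with hΦ
  have hsw : Ex Y (fun s => RR Y s * ind (G s)) = ∫ t, Φ t ∂nu := by
    simp only [hΦ, Ex, RR, II]
    rw [integral_div, integral_finset_sum]
    · congr 1
      refine Finset.sum_congr rfl fun s _ => ?_
      rw [integral_mul_const, integral_div]
    · intro s _
      exact ((ZZ_integrable Y s).div_const _).mul_const _
  have hΦint : Integrable Φ nu := by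
    simp only [hΦ, Ex]
    apply Integrable.div_const
    apply integrable_finset_sum
    intro s _
    exact ((ZZ_integrable Y s).div_const _).mul_const _
  set Q := κ * (2 * B + k0 + 56) + Real.exp (-(κ ^ 2 * (((n:ℝ) - k0) * Real.log 2 - 5))) with hQ
  have hQ0 : 0 ≤ Q := by positivity
  have hΦ1 : ∀ t, Φ t ≤ 1 := by
    intro t
    have : Φ t ≤ Ex Y (fun s => ZZ Y t s / Pi Y) := by
      apply Ex_mono'
      intro s
      have := ind_le_one (G s)
      have h3 : 0 ≤ ZZ Y t s / Pi Y := div_nonneg (ZZ_nonneg _ _ _) (Pi_pos _).le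
      nlinarith
    refine this.trans (le_of_eq ?_)
    simp only [div_eq_mul_inv]
    rw [Ex_mul_right, Ex_ZZ, mul_inv_cancel₀ (Pi_pos Y).ne']
  set S : Set ℝ := {x | T < |x|} with hS
  have hSm : MeasurableSet S := measurableSet_lt measurable_const (by fun_prop)
  set Dk : ℝ → ℝ := fun t => ∑ k ∈ Icc k0 n, DDk (yy k0) (yy k) t ^ 2 with hDk
  have hDk0 : ∀ t, 0 ≤ Dk t := fun t => Finset.sum_nonneg fun _ _ => sq_nonneg _
  have hpt : ∀ t, Φ t ≤ Q + S.indicator (fun _ => 1) t + Dk t := by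
    intro t
    by_cases ht : t ∈ S
    · rw [Set.indicator_of_mem ht]
      have := hΦ1 t; have := hDk0 t; linarith
    rw [Set.indicator_of_notMem ht]
    by_cases hc : ∀ k, k0 ≤ k → k ≤ n → |DDk (yy k0) (yy k) t| ≤ 1
    · have hcond := DDk_cond hc
      have hb := ballot h0 h1 hB (show (0:ℝ) ≤ 13 by norm_num) (yy_mono hk) (t := t) hcond
      have hmono : Φ t ≤ Ex Y (fun s => ZZ Y t s / Pi Y * ind (bar t (Real.exp (2 * B)) Y s)) := by
        apply Ex_mono'
        intro s
        apply mul_le_mul_of_nonneg_left _ (div_nonneg (ZZ_nonneg _ _ _) (Pi_pos _).le)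
        apply ind_mono
        intro h
        exact h t (not_lt.1 ht)
      have l1 := logPi_yy_le k0
      have l2 := logPi_yy_ge n
      have l3 := Real.log_two_lt_d9
      have l4 := loglog2_neg
      have hk0 : (0:ℝ) ≤ k0 := Nat.cast_nonneg _
      have l5 : k0 * Real.log 2 ≤ k0 := by nlinarith
      have b1 : κ * (2 * B + Real.log (Pi (yy k0)) + 2 * 13 + 26) ≤ κ * (2 * B + k0 + 56) :=
        mul_le_mul_of_nonneg_left (by linarith) h0.le
      have b2 : Real.exp (-(κ ^ 2 * (Real.log (Pi Y) - Real.log (Pi (yy k0))))) ≤ Real.exp (-(κ ^ 2 * (((n:ℝ) - k0) * Real.log 2 - 5))) := by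
        apply Real.exp_le_exp.2
        apply neg_le_neg
        apply mul_le_mul_of_nonneg_left _ (sq_nonneg κ)
        rw [hY]; linarith
      have := hDk0 t
      linarith
    · push Not at hc
      obtain ⟨k, a, b, c⟩ := hc
      have : 1 ≤ Dk t := by
        calc (1:ℝ) ≤ DDk (yy k0) (yy k) t ^ 2 := by
              rw [← sq_abs]; nlinarith
          _ ≤ _ := Finset.single_le_sum (f := fun k => DDk (yy k0) (yy k) t ^ 2) (fun _ _ => sq_nonneg _) (mem_Icc.2 ⟨a, b⟩)
      have := hΦ1 t
      linarith
  have hDint : Integrable Dk nu := integrable_finset_sum _ fun k _ => DDk_sq_int _ _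
  have hSint : Integrable (S.indicator (fun _ => (1:ℝ))) nu := (integrable_const 1).indicator hSm
  have hm := integral_mono hΦint (((integrable_const Q).add hSint).add hDint) hpt
  rw [hsw]
  refine hm.trans ?_
  simp only [Pi.add_apply]
  rw [integral_add (by exact (integrable_const Q).add hSint) hDint, integral_add (integrable_const Q) hSint, integral_const,
    integral_indicator_const _ hSm]
  have h3 := nu_tail hT
  have h4 : ∫ t, Dk t ∂nu ≤ 60 * (n + 1) * (n + 4) / 2 ^ k0 := by
    rw [hDk, integral_finset_sum _ fun k _ => DDk_sq_int _ _]
    calc _ ≤ ∑ k ∈ Icc k0 n, 60 * ((n:ℝ) + 4) / 2 ^ k0 := Finset.sum_le_sum fun k hk => DDk_sq_yy k0 k n (mem_Icc.1 hk).2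
      _ = (n + 1 - k0 : ℕ) * (60 * ((n:ℝ) + 4) / 2 ^ k0) := by rw [Finset.sum_const, Nat.card_Icc, nsmul_eq_mul]
      _ ≤ (n + 1) * (60 * ((n:ℝ) + 4) / 2 ^ k0) := by
        apply mul_le_mul_of_nonneg_right _ (by positivity)
        have : ((n + 1 - k0 : ℕ) : ℝ) ≤ ((n + 1 : ℕ) : ℝ) := by exact_mod_cast Nat.sub_le _ _
        push_cast at this; exact this
      _ = _ := by ring
  simp only [probReal_univ, smul_eq_mul, one_mul, mul_one]
  linarith

end RMF

namespace RMF
open Finset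

def dC (M : ℕ) (t : ℝ) (s : Finset ℕ) : ℝ := walsh M (fun u => aU u * (-lamU u * Real.sin (t * lamU u))) s
def dD (M : ℕ) (t : ℝ) (s : Finset ℕ) : ℝ := walsh M (fun u => aU u * (lamU u * Real.cos (t * lamU u))) s

lemma CC_deriv (M : ℕ) (s : Finset ℕ) (t : ℝ) : HasDerivAt (fun t => CC M t s) (dC M t s) t := by
  unfold CC dC walsh
  apply HasDerivAt.fun_sum
  intro u _
  apply HasDerivAt.mul_const
  apply HasDerivAt.const_mul
  have := ((hasDerivAt_id t).mul_const (lamU u)).cos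
  simpa [mul_comm] using this

lemma DD_deriv (M : ℕ) (s : Finset ℕ) (t : ℝ) : HasDerivAt (fun t => DD M t s) (dD M t s) t := by
  unfold DD dD walsh
  apply HasDerivAt.fun_sum
  intro u _
  apply HasDerivAt.mul_const
  apply HasDerivAt.const_mul
  have := ((hasDerivAt_id t).mul_const (lamU u)).sin
  simpa [mul_comm] using this

lemma CC_cont (M : ℕ) (s : Finset ℕ) : Continuous (fun t => CC M t s) := by unfold CC walsh; fun_prop
lemma DD_cont (M : ℕ) (s : Finset ℕ) : Continuous (fun t => DD M t s) := by unfold DD walsh; fun_prop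
lemma dC_cont (M : ℕ) (s : Finset ℕ) : Continuous (fun t => dC M t s) := by unfold dC walsh; fun_prop
lemma dD_cont (M : ℕ) (s : Finset ℕ) : Continuous (fun t => dD M t s) := by unfold dD walsh; fun_prop

/-- integrand of the Sobolev functional -/
def sob (L : ℝ) (M : ℕ) (t : ℝ) (s : Finset ℕ) : ℝ :=
  (1 + L) * (CC M t s ^ 2 + DD M t s ^ 2) + L⁻¹ * (dC M t s ^ 2 + dD M t s ^ 2)

lemma sob_cont (L : ℝ) (M : ℕ) (s : Finset ℕ) : Continuous (fun t => sob L M t s) := by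
  have := CC_cont M s; have := DD_cont M s; have := dC_cont M s; have := dD_cont M s
  unfold sob; fun_prop

lemma sob_nonneg {L : ℝ} (hL : 0 < L) (M : ℕ) (t : ℝ) (s : Finset ℕ) : 0 ≤ sob L M t s := by
  unfold sob; positivity

lemma sobolev_pt {L : ℝ} (hL : 0 < L) (M : ℕ) (t : ℝ) (s : Finset ℕ) :
    ZZ M t s ≤ ∫ u in t..(t + 1), sob L M u s := by
  set c : ℝ → ℝ := fun u => CC M u s with hc
  set d : ℝ → ℝ := fun u => DD M u s with hd
  set c' : ℝ → ℝ := fun u => dC M u s with hc'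
  set d' : ℝ → ℝ := fun u => dD M u s with hd'
  have k1 : Continuous c := CC_cont M s
  have k2 : Continuous d := DD_cont M s
  have k3 : Continuous c' := dC_cont M s
  have k4 : Continuous d' := dD_cont M s
  have hF : ∀ u, HasDerivAt (fun u => (u - (t + 1)) * (c u ^ 2 + d u ^ 2))
      (1 * (c u ^ 2 + d u ^ 2) + (u - (t + 1)) * ((2:ℕ) * c u ^ (2 - 1) * c' u + (2:ℕ) * d u ^ (2 - 1) * d' u)) u := by
    intro u
    exact ((hasDerivAt_id u).sub_const (t + 1)).mul (((CC_deriv M s u).pow 2).add ((DD_deriv M s u).pow 2))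
  have hintg : IntervalIntegrable (fun u => (1 * (c u ^ 2 + d u ^ 2) + (u - (t + 1)) * ((2:ℕ) * c u ^ (2 - 1) * c' u + (2:ℕ) * d u ^ (2 - 1) * d' u))) volume t (t + 1) := by
    apply Continuous.intervalIntegrable
    fun_prop
  have hftc := intervalIntegral.integral_eq_sub_of_hasDerivAt (fun u _ => hF u) hintg
  have e : ZZ M t s = ∫ u in t..(t + 1), (1 * (c u ^ 2 + d u ^ 2) + (u - (t + 1)) * ((2:ℕ) * c u ^ (2 - 1) * c' u + (2:ℕ) * d u ^ (2 - 1) * d' u)) := by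
    rw [hftc, ZZ_eq]; simp only [hc, hd]; ring
  rw [e]
  apply intervalIntegral.integral_mono_on (by linarith) hintg ((sob_cont L M s).intervalIntegrable _ _)
  intro u hu
  have amgm : ∀ x y w : ℝ, -1 ≤ w → w ≤ 0 → w * (2 * x * y) ≤ L * x ^ 2 + L⁻¹ * y ^ 2 := by
    intro x y w h1 h2
    have i1 : 0 ≤ L * x ^ 2 + L⁻¹ * y ^ 2 + 2 * x * y := by
      have : L * x ^ 2 + L⁻¹ * y ^ 2 + 2 * x * y = L⁻¹ * (L * x + y) ^ 2 := by field_simp; ring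
      rw [this]; positivity
    have i2 : 0 ≤ L * x ^ 2 + L⁻¹ * y ^ 2 := by positivity
    nlinarith
  have w1 : -1 ≤ u - (t + 1) := by linarith [hu.1]
  have w2 : u - (t + 1) ≤ 0 := by linarith [hu.2]
  have a1 := amgm (c u) (c' u) _ w1 w2
  have a2 := amgm (d u) (d' u) _ w1 w2
  show _ ≤ (1 + L) * (c u ^ 2 + d u ^ 2) + L⁻¹ * (c' u ^ 2 + d' u ^ 2)
  simp only [Nat.cast_ofNat, Nat.add_one_sub_one, pow_one]
  linarith

def SB (T L : ℝ) (M : ℕ) (s : Finset ℕ) : ℝ := ∫ u in (-T)..(T + 1), sob L M u s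

lemma sobolev {T L : ℝ} (hL : 0 < L) (M : ℕ) (t : ℝ) (ht : |t| ≤ T) (s : Finset ℕ) : ZZ M t s ≤ SB T L M s := by
  refine (sobolev_pt hL M t s).trans ?_
  have := abs_le.1 ht
  apply intervalIntegral.integral_mono_interval (by linarith) (by linarith) (by linarith)
  · filter_upwards with u
    exact sob_nonneg hL M u s
  · exact (sob_cont L M s).intervalIntegrable _ _

lemma SB_nonneg {T L : ℝ} (hT : 0 ≤ T) (hL : 0 < L) (M : ℕ) (s : Finset ℕ) : 0 ≤ SB T L M s :=
  intervalIntegral.integral_nonneg (by linarith) fun u _ => sob_nonneg hL M u s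

lemma dep_SB (T L : ℝ) (M : ℕ) : Dep M (SB T L M) := by
  intro s
  unfold SB sob CC DD dC dD
  simp only [dep_walsh M _ s]

lemma walsh_sub (M : ℕ) (c : Finset ℕ → ℝ) (s : Finset ℕ) (hs : s ∈ (range M).powerset) :
    walsh M c s ^ 2 ≤ (walsh (M + 1) c s ^ 2 + walsh (M + 1) c (insert M s) ^ 2) / 2 := by
  rw [walsh_succ, walsh_succ, (dep_walsh M c).ins le_rfl, (dep_walsh M _).ins le_rfl, sg_insert_self, sg_of_not_mem (not_mem_powerset hs)]
  nlinarith [sq_nonneg (walsh M (fun u => c (insert M u)) s)]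

lemma SB_sub {T L : ℝ} (hT : 0 ≤ T) (hL : 0 < L) (M : ℕ) (s : Finset ℕ) (hs : s ∈ (range M).powerset) :
    SB T L M s ≤ (SB T L (M + 1) s + SB T L (M + 1) (insert M s)) / 2 := by
  unfold SB
  have i := fun M s => (sob_cont L M s).intervalIntegrable (μ := volume) (-T) (T + 1)
  rw [← intervalIntegral.integral_add (i _ _) (i _ _), ← intervalIntegral.integral_div]
  apply intervalIntegral.integral_mono_on (by linarith) (i _ _) (((i _ _).add (i _ _)).div_const 2)
  intro u _
  unfold sob
  have h1 := walsh_sub M (fun v => aU v * Real.cos (u * lamU v)) s hs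
  have h2 := walsh_sub M (fun v => aU v * Real.sin (u * lamU v)) s hs
  have h3 := walsh_sub M (fun v => aU v * (-lamU v * Real.sin (u * lamU v))) s hs
  have h4 := walsh_sub M (fun v => aU v * (lamU v * Real.cos (u * lamU v))) s hs
  have hL' : 0 ≤ L⁻¹ := by positivity
  have k1 := mul_le_mul_of_nonneg_left (add_le_add h1 h2) (show 0 ≤ 1 + L by linarith)
  have k2 := mul_le_mul_of_nonneg_left (add_le_add h3 h4) hL'
  unfold CC DD dC dD
  linarith

lemma Ex_SB (T L : ℝ) (M : ℕ) : Ex M (SB T L M) = (2 * T + 1) *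
    ((1 + L) * Pi M + L⁻¹ * ∑ u ∈ (range M).powerset, aU u ^ 2 * lamU u ^ 2) := by
  have e1 : Ex M (SB T L M) = ∫ u in (-T)..(T + 1), Ex M (fun s => sob L M u s) := by
    unfold Ex SB
    rw [intervalIntegral.integral_div, intervalIntegral.integral_finset_sum]
    intro s _
    exact (sob_cont L M s).intervalIntegrable _ _
  have e2 : ∀ u, Ex M (fun s => sob L M u s) = (1 + L) * Pi M + L⁻¹ * ∑ u ∈ (range M).powerset, aU u ^ 2 * lamU u ^ 2 := by
    intro u
    have h1 : Ex M (fun s => CC M u s ^ 2 + DD M u s ^ 2) = Pi M := by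
      rw [← Ex_ZZ M u]; congr 1; funext s; rw [ZZ_eq]
    have h2 : Ex M (fun s => dC M u s ^ 2 + dD M u s ^ 2) = ∑ u ∈ (range M).powerset, aU u ^ 2 * lamU u ^ 2 := by
      rw [Ex_add]
      unfold dC dD
      rw [walsh_sq, walsh_sq, ← Finset.sum_add_distrib]
      refine Finset.sum_congr rfl fun v _ => ?_
      have := Real.sin_sq_add_cos_sq (u * lamU v)
      calc _ = aU v ^ 2 * lamU v ^ 2 * (Real.sin (u * lamU v) ^ 2 + Real.cos (u * lamU v) ^ 2) := by ring
        _ = _ := by rw [this, mul_one]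
    unfold sob
    rw [Ex_add, Ex_mul_left, Ex_mul_left, h1, h2]
  rw [e1]
  simp_rw [e2]
  rw [intervalIntegral.integral_const, smul_eq_mul]
  ring

lemma sum_lam_sq (M : ℕ) (hM : 2 ≤ M) : ∑ u ∈ (range M).powerset, aU u ^ 2 * lamU u ^ 2 ≤
    2 * Real.exp 6 * Real.log M ^ 2 * Pi M := by
  have hM' : (2:ℝ) ≤ M := by exact_mod_cast hM
  set L := Real.log M with hL
  have hL0 : 0 < L := Real.log_pos (by linarith)
  have hlam0 : ∀ u : Finset ℕ, 0 ≤ lamU u := fun u => Finset.sum_nonneg fun j _ => Real.log_natCast_nonneg j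
  have h1 : ∀ u ∈ (range M).powerset, aU u ^ 2 * lamU u ^ 2 ≤ 2 * L ^ 2 * ∏ j ∈ u, (aq j * Real.exp (Real.log j / L)) := by
    intro u _
    have e1 : ∏ j ∈ u, (aq j * Real.exp (Real.log j / L)) = aU u ^ 2 * Real.exp (lamU u / L) := by
      rw [Finset.prod_mul_distrib, ← Real.exp_sum, ← Finset.sum_div]
      congr 1
      unfold aU
      rw [← Finset.prod_pow]
      exact Finset.prod_congr rfl fun j _ => (aa_sq j).symm
    rw [e1]
    have h2 := Real.quadratic_le_exp_of_nonneg (div_nonneg (hlam0 u) hL0.le)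
    have h3 : lamU u ^ 2 ≤ 2 * L ^ 2 * Real.exp (lamU u / L) := by
      have h4 : (lamU u / L) ^ 2 ≤ 2 * Real.exp (lamU u / L) := by
        have := div_nonneg (hlam0 u) hL0.le
        linarith
      rw [div_pow, div_le_iff₀ (by positivity)] at h4
      linarith
    calc _ ≤ aU u ^ 2 * (2 * L ^ 2 * Real.exp (lamU u / L)) := mul_le_mul_of_nonneg_left h3 (sq_nonneg _)
      _ = _ := by ring
  refine (Finset.sum_le_sum h1).trans ?_
  rw [← Finset.mul_sum, ← Finset.prod_one_add]
  have h2 : ∏ j ∈ range M, (1 + aq j * Real.exp (Real.log j / L)) ≤ ∏ j ∈ range M, ((1 + aq j) * Real.exp (2 / L * (aq j * Real.log j))) := by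
    apply Finset.prod_le_prod
    · intro j _
      have := aq_nonneg j
      positivity
    · intro j hj
      have hj : j < M := mem_range.1 hj
      have a0 := aq_nonneg j
      have l0 : 0 ≤ Real.log j := Real.log_natCast_nonneg j
      set x := Real.log j / L with hx
      have x0 : 0 ≤ x := by positivity
      have x1 : x ≤ 1 := by
        rw [hx, div_le_one hL0]
        rcases Nat.eq_zero_or_pos j with h | h
        · rw [h]; simpa using hL0.le
        · exact Real.log_le_log (by exact_mod_cast h) (by exact_mod_cast hj.le)
      have hexp : Real.exp x ≤ 1 + 2 * x := by
        have := (abs_le.1 (Real.abs_exp_sub_one_sub_id_le (x := x) (by rw [abs_of_nonneg x0]; exact x1))).2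
        nlinarith
      have e2 : 2 / L * (aq j * Real.log j) = 2 * (aq j * x) := by rw [hx]; ring
      rw [e2]
      have h5 := Real.add_one_le_exp (2 * (aq j * x))
      have h6 : 0 ≤ aq j * x := by positivity
      calc 1 + aq j * Real.exp x ≤ 1 + aq j * (1 + 2 * x) := by gcongr
        _ ≤ (1 + aq j) * (2 * (aq j * x) + 1) := by nlinarith [mul_nonneg a0 h6]
        _ ≤ _ := by gcongr
  have h3 : ∏ j ∈ range M, ((1 + aq j) * Real.exp (2 / L * (aq j * Real.log j))) ≤ Pi M * Real.exp 6 := by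
    rw [Finset.prod_mul_distrib, ← Real.exp_sum, ← Finset.mul_sum]
    apply mul_le_mul_of_nonneg_left _ (Pi_pos M).le
    apply Real.exp_le_exp.2
    have m1 := mertens1 M (by omega)
    rw [Finset.sum_range_succ] at m1
    have : 0 ≤ aq M * Real.log M := mul_nonneg (aq_nonneg M) hL0.le
    have l4 : Real.log 4 ≤ 2 * L := by
      rw [show (4:ℝ) = 2 ^ 2 by norm_num, Real.log_pow]
      push_cast
      have := Real.log_le_log (by norm_num) hM'
      linarith
    rw [div_mul_eq_mul_div, div_le_iff₀ hL0]
    linarith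
  calc _ ≤ 2 * L ^ 2 * (Pi M * Real.exp 6) := mul_le_mul_of_nonneg_left (h2.trans h3) (by positivity)
    _ = _ := by ring

def CS : ℝ := 18 * Real.exp 4 * (2 + 8 * Real.exp 6)

lemma block_prob {T b : ℝ} (hT : 0 ≤ T) (hb : 0 < b) (k : ℕ) :
    Pr (yy (k + 1)) (fun s => ∃ m, yy k ≤ m ∧ m ≤ yy (k + 1) ∧ b * Pi (yy k) ^ 2 ≤ SB T (2 ^ k) m s) ≤ CS * (2 * T + 1) / b := by
  set L : ℝ := 2 ^ k with hL
  have hL1 : 1 ≤ L := one_le_pow₀ (by norm_num)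
  have hL0 : 0 < L := by linarith
  have hd := doob (yy_mono (Nat.le_succ k)) (SB T L) (fun _ => True) (lam := b * Pi (yy k) ^ 2)
    (fun m _ _ => dep_SB T L m) (dep_const _) (fun m _ _ s hs => SB_sub hT hL0 m s hs) (fun m s => SB_nonneg hT hL0 m s)
  simp only [true_and, ind_true trivial, one_mul] at hd
  have hPa := Pi_pos (yy k)
  have l2 := Real.log_two_gt_d9
  have l2' := Real.log_two_lt_d9
  have hPa2 : L / 3 ≤ Pi (yy k) := by
    have := Pi_ge (yy k) (by have := yy_two_le k; omega)
    rw [log_yy] at this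
    nlinarith
  have hPa3 : L ^ 2 / 9 ≤ Pi (yy k) ^ 2 := by
    calc _ = (L / 3) ^ 2 := by ring
      _ ≤ _ := pow_le_pow_left₀ (by positivity) hPa2 2
  have hlogb : Real.log (yy (k+1)) ≤ 2 * L := by
    rw [log_yy, pow_succ]; nlinarith
  have hlogb0 : 0 ≤ Real.log (yy (k+1)) := Real.log_natCast_nonneg _
  have hPb : Pi (yy (k+1)) ≤ Real.exp 4 * (2 * L) :=
    (Pi_le _ (yy_two_le _)).trans (mul_le_mul_of_nonneg_left hlogb (Real.exp_pos _).le)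
  have hEx : Ex (yy (k+1)) (SB T L (yy (k+1))) ≤ (2 * T + 1) * (L ^ 2 * (2 * Real.exp 4 * (2 + 8 * Real.exp 6))) := by
    rw [Ex_SB]
    apply mul_le_mul_of_nonneg_left _ (by linarith)
    have h1 := sum_lam_sq (yy (k+1)) (yy_two_le _)
    have h2 : Real.log (yy (k+1)) ^ 2 ≤ 4 * L ^ 2 := by
      calc _ ≤ (2 * L) ^ 2 := pow_le_pow_left₀ hlogb0 hlogb 2
        _ = _ := by ring
    have hP0 := Pi_pos (yy (k+1))
    calc _ ≤ (2 * L) * Pi (yy (k+1)) + L⁻¹ * (2 * Real.exp 6 * (4 * L ^ 2) * Pi (yy (k+1))) := by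
          gcongr
          · linarith
          · exact h1.trans (by gcongr)
      _ = L * (2 + 8 * Real.exp 6) * Pi (yy (k+1)) := by field_simp; ring
      _ ≤ L * (2 + 8 * Real.exp 6) * (Real.exp 4 * (2 * L)) := by gcongr
      _ = _ := by ring
  rw [← le_div_iff₀' (by positivity)] at hd
  refine hd.trans ((div_le_div_of_nonneg_right hEx (by positivity)).trans ?_)
  rw [div_le_div_iff₀ (by positivity) hb]
  unfold CS
  calc _ = b * ((2 * T + 1) * (18 * Real.exp 4 * (2 + 8 * Real.exp 6))) * (L ^ 2 / 9) := by ring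
    _ ≤ b * ((2 * T + 1) * (18 * Real.exp 4 * (2 + 8 * Real.exp 6))) * Pi (yy k) ^ 2 := by gcongr
    _ = _ := by ring

theorem GG_prob {T b : ℝ} (hT : 0 ≤ T) (hb : 1 ≤ b) (n : ℕ) :
    Pr (yy n) (fun s => ¬ GG T b (yy n) s) ≤ n * (CS * (2 * T + 1) / b) := by
  have hsub : ∀ s, ¬ GG T b (yy n) s → ∃ k ∈ range n, ∃ m, yy k ≤ m ∧ m ≤ yy (k + 1) ∧ b * Pi (yy k) ^ 2 ≤ SB T (2 ^ k) m s := by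
    intro s hs
    unfold GG bar at hs
    push Not at hs
    obtain ⟨t, ht, m, hm, hlt⟩ := hs
    have hm2 : 2 < m := by
      by_contra hc
      have : ZZ m t s = 1 := by
        unfold ZZ
        apply Finset.prod_eq_one
        intro j hj
        have : aq j = 0 := by
          unfold aq
          rw [if_neg]
          intro hp
          have := hp.two_le
          have := mem_range.1 hj
          omega
        have h2 : aa j = 0 := by unfold aa; rw [this, Real.sqrt_zero]
        rw [this, h2]; ring
      rw [this] at hlt
      have := one_le_Pi m
      nlinarith
    have hblock : ∃ k < n, yy k ≤ m ∧ m ≤ yy (k + 1) := by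
      clear hlt
      induction n with
      | zero => simp [yy] at hm; omega
      | succ n ih =>
        rcases Nat.lt_or_ge m (yy n) with h | h
        · obtain ⟨k, a, c⟩ := ih h.le
          exact ⟨k, by omega, c⟩
        · exact ⟨n, by omega, h, hm⟩
    obtain ⟨k, hk, h1, h2⟩ := hblock
    refine ⟨k, mem_range.2 hk, m, h1, h2, ?_⟩
    have h3 := sobolev (L := 2 ^ k) (by positivity) m t ht s
    have h4 : Pi (yy k) ^ 2 ≤ Pi m ^ 2 := pow_le_pow_left₀ (Pi_pos _).le (Pi_mono h1) 2
    have : b * Pi (yy k) ^ 2 ≤ b * Pi m ^ 2 := mul_le_mul_of_nonneg_left h4 (by linarith)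
    linarith
  refine (Pr_mono hsub).trans ((Pr_exists _).trans ?_)
  calc _ ≤ ∑ k ∈ range n, (CS * (2 * T + 1) / b) := by
        apply Finset.sum_le_sum
        intro k hk
        have hk := mem_range.1 hk
        rw [Pr_dep (N := yy (k + 1)) _ (yy_mono hk)]
        · exact block_prob hT (by linarith) k
        · intro s
          apply propext
          apply exists_congr; intro m
          constructor
          · rintro ⟨h1, h2, h3⟩
            refine ⟨h1, h2, ?_⟩
            rwa [(dep_SB T _ m).mono h2 s] at h3
          · rintro ⟨h1, h2, h3⟩
            refine ⟨h1, h2, ?_⟩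
            rwa [(dep_SB T _ m).mono h2 s]
    _ = _ := by rw [Finset.sum_const, card_range, nsmul_eq_mul]

end RMF

namespace RMF
open Finset

lemma Ex_RR_ind {a b : ℕ} (hab : a ≤ b) {G : Finset ℕ → Prop} (hG : Dep a G) :
    Ex b (fun s => ind (G s) * RR b s) = Ex a (fun s => ind (G s) * RR a s) := by
  induction b, hab using Nat.le_induction with
  | base => rfl
  | succ b hab ih =>
    rw [← ih, Ex_succ, ← Ex_add]
    simp only [Ex]
    rw [div_right_comm, Finset.sum_div]
    congr 1
    refine Finset.sum_congr rfl fun s hs => ?_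
    rw [hG.ins hab, ← RR_avg b s hs]
    ring

lemma log_le_rpow_eventually {δ c : ℝ} (hδ : 0 < δ) (hc : 0 < c) : ∀ᶠ n : ℕ in atTop, Real.log n ≤ c * (n:ℝ) ^ δ := by
  have h := (isLittleO_log_rpow_atTop hδ).comp_tendsto tendsto_natCast_atTop_atTop
  have := h.bound hc
  filter_upwards [this, eventually_ge_atTop 1] with n hn h1
  have h1' : (1:ℝ) ≤ n := by exact_mod_cast h1
  simp only [Function.comp] at hn
  rw [Real.norm_of_nonneg (Real.log_nonneg h1'), Real.norm_of_nonneg (by positivity)] at hn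
  exact hn

lemma const_le_rpow_eventually {δ : ℝ} (hδ : 0 < δ) (c : ℝ) : ∀ᶠ n : ℕ in atTop, c ≤ (n:ℝ) ^ δ :=
  ((tendsto_rpow_atTop hδ).comp tendsto_natCast_atTop_atTop).eventually_ge_atTop c

lemma CS_pos : 0 < CS := by unfold CS; positivity

theorem RR_prob {δ : ℝ} (hδ : 0 < δ) (hδ1 : δ ≤ 1 / 8) : ∀ᶠ n : ℕ in atTop, ∀ n' ≥ n,
    Pr (yy n') (fun s => ∃ m, yy n ≤ m ∧ m ≤ yy n' ∧ (n:ℝ) ^ (-(1/2) + 3 * δ) ≤ RR m s) ≤ 8 * (n:ℝ) ^ (-δ) := by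
  filter_upwards [log_le_rpow_eventually hδ (show (0:ℝ) < 1 / 12 by norm_num), const_le_rpow_eventually hδ 114,
    const_le_rpow_eventually hδ (Real.log (3 * CS)), log_le_rpow_eventually (δ := 1) (by norm_num) (show (0:ℝ) < 1 / 100 by norm_num),
    const_le_rpow_eventually (show (0:ℝ) < 1 / 2 by norm_num) 602, eventually_ge_atTop 1000] with n e1 e2 e3 e4 e5 e6 n' hn'
  have hn : (1000:ℝ) ≤ n := by exact_mod_cast e6
  have hn0 : (0:ℝ) < n := by linarith
  rw [Real.rpow_one] at e4
  set l := Real.log n with hl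
  have hl0 : 0 ≤ l := Real.log_nonneg (by linarith)
  set B := (n:ℝ) ^ δ with hB
  have hB0 : 0 ≤ B := by positivity
  set κ := (n:ℝ) ^ (-(1/2) + δ) with hκ
  have hκ0 : 0 < κ := by positivity
  have hκ1 : κ ≤ 1 := Real.rpow_le_one_of_one_le_of_nonpos (by linarith) (by linarith)
  -- k0
  set k0 := Nat.clog 2 (n ^ 3) with hk0
  have hk1 : (n:ℝ) ^ 3 ≤ 2 ^ k0 := by
    have := Nat.le_pow_clog (b := 2) (by norm_num) (n ^ 3)
    exact_mod_cast this
  have hk2 : (k0:ℝ) ≤ 1 + 6 * l := by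
    have h1 : 1 < n ^ 3 := Nat.one_lt_pow (by norm_num) (by omega)
    have := Nat.pow_pred_clog_lt_self (b := 2) (by norm_num) h1
    rw [← hk0] at this
    have h2 : (2:ℝ) ^ (k0.pred) ≤ (n:ℝ) ^ 3 := by exact_mod_cast this.le
    have h3 := Real.log_le_log (by positivity) h2
    rw [Real.log_pow, Real.log_pow, ← hl] at h3
    have h4 : (k0:ℝ) ≤ k0.pred + 1 := by
      have : k0 ≤ k0.pred + 1 := by simp only [Nat.pred_eq_sub_one]; omega
      exact_mod_cast this
    have l2 := Real.log_two_gt_d9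
    have h5 : (0:ℝ) ≤ k0.pred := Nat.cast_nonneg _
    push_cast at h3
    nlinarith
  have hk3 : k0 ≤ n := by
    have : (k0:ℝ) ≤ n := by linarith
    exact_mod_cast this
  have hA := avg_bound hk3 hκ0 hκ1 hB0 hn0
  have hPG := GG_prob hn0.le (Real.one_le_exp (show 0 ≤ 2 * B by positivity)) n
  -- simplification of the four terms
  set X := (n:ℝ) ^ (-(1/2) + 2 * δ) with hX
  have t1 : κ * (2 * B + k0 + 56) ≤ 4 * X := by
    have : κ * B = X := by rw [hκ, hB, hX, ← Real.rpow_add hn0]; congr 1; ring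
    have : κ * (2 * B + k0 + 56) ≤ κ * (4 * B) := mul_le_mul_of_nonneg_left (by linarith) hκ0.le
    linarith
  have t2 : Real.exp (-(κ ^ 2 * (((n:ℝ) - k0) * Real.log 2 - 5))) ≤ X := by
    have a1 : (n:ℝ) / 2 ≤ ((n:ℝ) - k0) * Real.log 2 - 5 := by
      have l2 := Real.log_two_gt_d9
      have : (9:ℝ)/10 * n ≤ n - k0 := by linarith
      nlinarith
    have a2 : κ ^ 2 * n = B ^ 2 := by
      rw [hκ, hB, ← Real.rpow_natCast, ← Real.rpow_natCast, ← Real.rpow_mul hn0.le, ← Real.rpow_mul hn0.le]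
      nth_rw 2 [← Real.rpow_one (n:ℝ)]
      rw [← Real.rpow_add hn0]
      congr 1
      push_cast; ring
    have a3 : l ≤ B ^ 2 := by nlinarith
    have a4 : l / 2 ≤ κ ^ 2 * (((n:ℝ) - k0) * Real.log 2 - 5) := by
      have := mul_le_mul_of_nonneg_left a1 (sq_nonneg κ)
      linarith
    calc _ ≤ Real.exp (l * (-(1/2))) := Real.exp_le_exp.2 (by linarith)
      _ = (n:ℝ) ^ (-(1/2) : ℝ) := by rw [Real.rpow_def_of_pos hn0]
      _ ≤ X := Real.rpow_le_rpow_of_exponent_le (by linarith) (by linarith)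
  have t34 : 2 / (n:ℝ) + 60 * ((n:ℝ) + 1) * (n + 4) / 2 ^ k0 ≤ X := by
    have a1 : 60 * ((n:ℝ) + 1) * (n + 4) / 2 ^ k0 ≤ 600 / n := by
      calc _ ≤ 60 * ((n:ℝ) + 1) * (n + 4) / n ^ 3 := div_le_div_of_nonneg_left (by positivity) (by positivity) hk1
        _ ≤ 60 * (2 * (n:ℝ)) * (5 * n) / n ^ 3 := by gcongr <;> linarith
        _ = _ := by field_simp; ring
    have a2 : 602 / (n:ℝ) ≤ (n:ℝ) ^ (-(1/2) : ℝ) := by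
      rw [div_le_iff₀ hn0]
      nth_rw 2 [← Real.rpow_one (n:ℝ)]
      rw [← Real.rpow_add hn0]
      norm_num at e5 ⊢
      linarith
    have a3 : (n:ℝ) ^ (-(1/2) : ℝ) ≤ X := Real.rpow_le_rpow_of_exponent_le (by linarith) (by linarith)
    have a4 : 2 / (n:ℝ) + 600 / n = 602 / n := by ring
    linarith
  have hA2 : Ex (yy n) (fun s => RR (yy n) s * ind (GG n (Real.exp (2 * B)) (yy n) s)) ≤ 7 * X := by
    have : 0 ≤ X := by positivity
    linarith
  have hPG2 : Pr (yy n) (fun s => ¬ GG n (Real.exp (2 * B)) (yy n) s) ≤ (n:ℝ) ^ (-δ) := by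
    refine hPG.trans ?_
    have hCS := CS_pos
    have a1 : (n:ℝ) * (CS * (2 * n + 1) / Real.exp (2 * B)) ≤ 3 * CS * (n:ℝ) ^ 2 / Real.exp (2 * B) := by
      rw [← mul_div_assoc]
      apply div_le_div_of_nonneg_right _ (Real.exp_pos _).le
      have : CS * n * (2 * n + 1) ≤ CS * n * (3 * n) := mul_le_mul_of_nonneg_left (by linarith) (by positivity)
      nlinarith
    refine a1.trans ?_
    rw [div_le_iff₀ (Real.exp_pos _), ← Real.log_le_log_iff (by positivity) (by positivity),
      Real.log_mul (by positivity) (by positivity), Real.log_mul (by positivity) (Real.exp_pos _).ne', Real.log_exp,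
      Real.log_rpow hn0, Real.log_pow, ← hl]
    push_cast
    have : δ * l ≤ l := by nlinarith
    linarith
  -- Doob
  have hab : yy n ≤ yy n' := yy_mono hn'
  set lam := (n:ℝ) ^ (-(1/2) + 3 * δ) with hlam
  have hlam0 : 0 < lam := by positivity
  have hd := doob hab RR (GG n (Real.exp (2 * B)) (yy n)) (lam := lam) (fun m _ _ => dep_RR m) (dep_GG _ _ _)
    (fun m _ _ s hs => (RR_avg m s hs).ge) RR_nonneg
  rw [Ex_RR_ind hab (dep_GG _ _ _)] at hd
  have hd2 : Pr (yy n') (fun s => GG n (Real.exp (2 * B)) (yy n) s ∧ ∃ m, yy n ≤ m ∧ m ≤ yy n' ∧ lam ≤ RR m s) ≤ 7 * (n:ℝ) ^ (-δ) := by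
    have h1 : lam * (n:ℝ) ^ (-δ) = X := by rw [hlam, hX, ← Real.rpow_add hn0]; congr 1; ring
    have h2 : Ex (yy n) (fun s => ind (GG n (Real.exp (2 * B)) (yy n) s) * RR (yy n) s) ≤ 7 * X := by
      simpa only [mul_comm] using hA2
    refine le_of_mul_le_mul_left (hd.trans (h2.trans (le_of_eq ?_))) hlam0
    rw [← h1]; ring
  have hfin : Pr (yy n') (fun s => ∃ m, yy n ≤ m ∧ m ≤ yy n' ∧ lam ≤ RR m s) ≤
      Pr (yy n') (fun s => (¬ GG n (Real.exp (2 * B)) (yy n) s) ∨ (GG n (Real.exp (2 * B)) (yy n) s ∧ ∃ m, yy n ≤ m ∧ m ≤ yy n' ∧ lam ≤ RR m s)) :=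
    Pr_mono fun s h => by
      by_cases hg : GG n (Real.exp (2 * B)) (yy n) s
      · exact Or.inr ⟨hg, h⟩
      · exact Or.inl hg
  refine hfin.trans (Pr_or.trans ?_)
  rw [Pr_dep ((dep_GG _ _ _).comp Not) hab]
  linarith

end RMF

namespace RMF
open Finset

/-- Walsh coefficients of a linear combination of `fs`. -/
def lc (M J : ℕ) (c : ℕ → ℝ) (u : Finset ℕ) : ℝ := by
  classical exact if u ⊆ PP M ∧ nn u ≤ J then c (nn u) else 0

lemma sum_lc {M J : ℕ} (hJ : J < M) (c : ℕ → ℝ) (G : Finset ℕ → ℝ → ℝ) (hG : ∀ u, G u 0 = 0) :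
    ∑ u ∈ (range M).powerset, G u (lc M J c u) =
      ∑ m ∈ Icc 1 J, if Squarefree m then G m.primeFactors (c m) else 0 := by
  classical
  have h1 := sum_sqfree_bij hJ (fun u => G u (c (nn u)))
  have h2 : ∑ m ∈ Icc 1 J, (if Squarefree m then G m.primeFactors (c m) else 0) =
      ∑ m ∈ Icc 1 J, (if Squarefree m then (fun u => G u (c (nn u))) m.primeFactors else 0) := by
    apply Finset.sum_congr rfl
    intro m _
    split_ifs with h
    · simp only [nn_primeFactors h]
    · rfl
  rw [h2, ← h1]
  have hsub : (PP M).powerset.filter (fun u => nn u ≤ J) ⊆ (range M).powerset := by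
    intro u hu
    rw [mem_filter, mem_powerset] at hu
    exact mem_powerset.2 (hu.1.trans (filter_subset _ _))
  rw [← Finset.sum_subset hsub]
  · apply Finset.sum_congr rfl
    intro u hu
    rw [mem_filter, mem_powerset] at hu
    simp [lc, hu.1, hu.2]
  · intro u _ hu
    rw [mem_filter, mem_powerset] at hu
    have : lc M J c u = 0 := by
      unfold lc
      rw [if_neg hu]
    rw [this, hG]

lemma lin_walsh {M J : ℕ} (hJ : J < M) (c : ℕ → ℝ) (s : Finset ℕ) :
    ∑ m ∈ Icc 1 J, c m * fs s m = walsh M (lc M J c) s := by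
  unfold walsh
  rw [sum_lc hJ c (fun u x => x * chi u s) (by simp)]
  apply Finset.sum_congr rfl
  intro m _
  unfold fs
  split_ifs <;> simp

lemma Ex_lin_sq {M J : ℕ} (hJ : J < M) (c : ℕ → ℝ) :
    Ex M (fun s => (∑ m ∈ Icc 1 J, c m * fs s m) ^ 2) ≤ ∑ m ∈ Icc 1 J, c m ^ 2 := by
  simp_rw [lin_walsh hJ]
  rw [walsh_sq, sum_lc hJ c (fun u x => x ^ 2) (by simp)]
  apply Finset.sum_le_sum
  intro m _
  split_ifs
  · exact le_rfl
  · positivity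

lemma Ex_lin_four {M J : ℕ} (hJ : J < M) (c : ℕ → ℝ) :
    Ex M (fun s => (∑ m ∈ Icc 1 J, c m * fs s m) ^ 4) ≤
      (∑ m ∈ Icc 1 J, if Squarefree m then c m ^ 2 * 3 ^ m.primeFactors.card else 0) ^ 2 := by
  simp_rw [lin_walsh hJ]
  refine (bonami M _).trans ?_
  rw [sum_lc hJ c (fun u x => x ^ 2 * 3 ^ u.card) (by simp)]

lemma SS_sub {a b : ℕ} (h : b ≤ a) (s : Finset ℕ) :
    SS s a - SS s b = ∑ m ∈ Icc 1 a, (if b < m then (1:ℝ) else 0) * fs s m := by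
  unfold SS
  rw [sub_eq_iff_eq_add]
  have : Icc 1 b = (Icc 1 a).filter (fun m => ¬ b < m) := by
    ext m; simp only [mem_Icc, mem_filter]; omega
  rw [this, Finset.sum_filter, ← Finset.sum_add_distrib]
  apply Finset.sum_congr rfl
  intro m _
  split_ifs <;> simp

lemma Ex_SS_sub {M a b : ℕ} (ha : a < M) (h : b ≤ a) :
    Ex M (fun s => (SS s a - SS s b) ^ 2) ≤ (a : ℝ) - b := by
  simp_rw [SS_sub h]
  refine (Ex_lin_sq ha _).trans (le_of_eq ?_)
  have : ∀ m ∈ Icc 1 a, (if b < m then (1:ℝ) else 0) ^ 2 = if b < m then 1 else 0 := by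
    intro m _; split_ifs <;> simp
  rw [Finset.sum_congr rfl this, ← Finset.sum_filter]
  have : (Icc 1 a).filter (fun m => b < m) = Ioc b a := by
    ext m; simp only [mem_Ioc, mem_filter, mem_Icc]; omega
  rw [this]; simp [Nat.cast_sub h]

def QQ (N : ℕ) : Finset ℕ := (Icc 1 N).filter (fun p => p.Prime ∧ N < p * p)
/-- conditional variance -/
def VV (N : ℕ) (s : Finset ℕ) : ℝ := ∑ p ∈ QQ N, SS s (N / p) ^ 2
/-- smoothing error -/
def WW (h N : ℕ) (s : Finset ℕ) : ℝ :=
  2 / h * ∑ i ∈ Icc 1 h, ∑ p ∈ Icc (N.sqrt + 1) N, (SS s (N / p) - SS s (N / (p + i))) ^ 2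

lemma Ex_WW {h N M : ℕ} (hh : 1 ≤ h) (hN : N < M) : Ex M (WW h N) ≤ 2 * h * Real.sqrt N := by
  have hh' : (1:ℝ) ≤ h := by exact_mod_cast hh
  unfold WW
  rw [Ex_mul_left, Ex_sum]
  have key : ∀ i ∈ Icc 1 h, Ex M (fun s => ∑ p ∈ Icc (N.sqrt + 1) N, (SS s (N / p) - SS s (N / (p + i))) ^ 2) ≤ h * Real.sqrt N := by
    intro i hi
    rw [mem_Icc] at hi
    rw [Ex_sum]
    have h1 : ∑ p ∈ Icc (N.sqrt + 1) N, Ex M (fun s => (SS s (N / p) - SS s (N / (p + i))) ^ 2) ≤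
        ∑ p ∈ Ico (N.sqrt + 1) (N + 1), (((N / p : ℕ) : ℝ) - (N / (p + i) : ℕ)) := by
      rw [show Icc (N.sqrt + 1) N = Ico (N.sqrt + 1) (N + 1) by ext; simp only [mem_Icc, mem_Ico]; omega]
      apply Finset.sum_le_sum
      intro p hp
      rw [mem_Ico] at hp
      apply Ex_SS_sub
      · exact (Nat.div_le_self _ _).trans_lt hN
      · exact Nat.div_le_div_left (by omega) (by omega)
    refine h1.trans ?_
    have h2 : ∀ p, (((N / p : ℕ) : ℝ) - (N / (p + i) : ℕ)) =
        ∑ l ∈ range i, (((N / (p + l) : ℕ) : ℝ) - (N / (p + (l+1)) : ℕ)) := by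
      intro p
      rw [Finset.sum_range_sub' (fun l => ((N / (p + l) : ℕ) : ℝ))]; simp
    simp_rw [h2]
    rw [Finset.sum_comm]
    have h3 : ∀ l ∈ range i, ∑ p ∈ Ico (N.sqrt + 1) (N + 1), (((N / (p + l) : ℕ) : ℝ) - (N / (p + (l+1)) : ℕ)) ≤ Real.sqrt N := by
      intro l _
      have hle : N.sqrt + 1 ≤ N + 1 := by have := Nat.sqrt_le_self N; omega
      have e := Finset.sum_Ico_sub (fun p => -((N / (p + l) : ℕ) : ℝ)) hle
      have : ∀ p, (((N / (p + l) : ℕ) : ℝ) - (N / (p + (l+1)) : ℕ)) = -((N / (p + 1 + l) : ℕ) : ℝ) - -((N / (p + l) : ℕ) : ℝ) := by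
        intro p; rw [show p + (l+1) = p + 1 + l by ring]; ring
      simp_rw [this]
      rw [e]
      have h4 : N / (N.sqrt + 1 + l) ≤ N.sqrt := by
        have : N / (N.sqrt + 1 + l) < N.sqrt + 1 := by
          rw [Nat.div_lt_iff_lt_mul (by omega)]
          have := Nat.lt_succ_sqrt N
          simp only [Nat.succ_eq_add_one] at this
          nlinarith
        omega
      have h5 : ((N / (N.sqrt + 1 + l) : ℕ) : ℝ) ≤ Real.sqrt N :=
        le_trans (by exact_mod_cast h4) Real.nat_sqrt_le_real_sqrt
      have h6 : (0:ℝ) ≤ ((N / (N + 1 + l) : ℕ) : ℝ) := by positivity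
      linarith
    refine (Finset.sum_le_sum h3).trans ?_
    simp only [sum_const, card_range, nsmul_eq_mul]
    have : (i:ℝ) ≤ h := by exact_mod_cast hi.2
    gcongr
  refine (mul_le_mul_of_nonneg_left (Finset.sum_le_sum key) (by positivity)).trans ?_
  simp only [sum_const, Nat.card_Icc, nsmul_eq_mul, Nat.add_sub_cancel]
  apply le_of_eq
  field_simp

lemma sum_SS_div (N : ℕ) (s : Finset ℕ) :
    ∑ t ∈ Icc (N.sqrt + 1) N, SS s (N / t) ^ 2 ≤ 2 * N * II N s := by
  rcases Nat.lt_or_ge N 2 with hN | hN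
  · interval_cases N
    · simp
    · have := II_nonneg 1 s
      have : Nat.sqrt 1 = 1 := by norm_num
      simp [this, II_nonneg]
  have hmap : ∀ t ∈ Icc (N.sqrt + 1) N, N / t ∈ Ico 1 N := by
    intro t ht
    rw [mem_Icc] at ht
    rw [mem_Ico]
    have h1 : 1 ≤ N / t := Nat.div_pos ht.2 (by omega)
    refine ⟨h1, Nat.div_lt_self (by omega) ?_⟩
    have : 1 ≤ N.sqrt := Nat.sqrt_pos.2 (by omega)
    omega
  rw [← Finset.sum_fiberwise_of_maps_to hmap]
  have key : ∀ j ∈ Ico 1 N, ∑ t ∈ (Icc (N.sqrt + 1) N).filter (fun t => N / t = j), SS s (N / t) ^ 2 ≤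
      2 * N * (SS s j ^ 2 / ((j : ℝ) * (j + 1))) := by
    intro j hj
    rw [mem_Ico] at hj
    have h1 : ∑ t ∈ (Icc (N.sqrt + 1) N).filter (fun t => N / t = j), SS s (N / t) ^ 2 =
        ((Icc (N.sqrt + 1) N).filter (fun t => N / t = j)).card * SS s j ^ 2 := by
      rw [Finset.sum_congr rfl (g := fun _ => SS s j ^ 2)]
      · simp
      · intro t ht
        rw [mem_filter] at ht
        rw [ht.2]
    rw [h1]
    have hj0 : (0:ℝ) < j := by exact_mod_cast hj.1
    have h2 : (((Icc (N.sqrt + 1) N).filter (fun t => N / t = j)).card : ℝ) ≤ 2 * N / ((j:ℝ) * (j+1)) := by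
      rcases Finset.eq_empty_or_nonempty ((Icc (N.sqrt + 1) N).filter (fun t => N / t = j)) with he | ⟨t, ht⟩
      · rw [he]; simp; positivity
      · rw [mem_filter, mem_Icc] at ht
        have hsub : (Icc (N.sqrt + 1) N).filter (fun t => N / t = j) ⊆ Ioc (N / (j+1)) (N / j) := by
          intro t ht
          rw [mem_filter, mem_Icc] at ht
          rw [mem_Ioc, Nat.div_lt_iff_lt_mul (by omega), Nat.le_div_iff_mul_le (by omega)]
          have ht0 : 0 < t := by omega
          have h3 := Nat.div_mul_le_self N t
          have h4 := Nat.lt_div_mul_add (a := N) ht0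
          rw [ht.2] at h3 h4
          constructor <;> nlinarith
        have hc := Finset.card_le_card hsub
        rw [Nat.card_Ioc] at hc
        have h5 : ((N / j : ℕ) : ℝ) ≤ N / j := Nat.cast_div_le
        have h6 : (N : ℝ) / (j+1) - 1 ≤ ((N / (j+1) : ℕ) : ℝ) := by
          have := Nat.lt_div_mul_add (a := N) (b := j+1) (by omega)
          have h7 : (N:ℝ) < ((N / (j+1) : ℕ) : ℝ) * (j+1) + (j+1) := by exact_mod_cast this
          rw [sub_le_iff_le_add, div_le_iff₀ (by positivity)]
          nlinarith
        have h8 : (1:ℝ) ≤ N / (j * (j+1)) := by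
          rw [le_div_iff₀ (by positivity), one_mul]
          have h3 := Nat.div_mul_le_self N t
          rw [ht.2] at h3
          have h9 : j < N.sqrt + 1 := by
            rw [← ht.2, Nat.div_lt_iff_lt_mul (by omega)]
            have := Nat.lt_succ_sqrt N
            simp only [Nat.succ_eq_add_one] at this
            nlinarith
          have : j * (j + 1) ≤ N := by nlinarith
          exact_mod_cast this
        have h10 : (((Icc (N.sqrt + 1) N).filter (fun t => N / t = j)).card : ℝ) ≤ ((N / j : ℕ) : ℝ) - ((N / (j+1) : ℕ) : ℝ) := by
          have h11 : N / (j+1) ≤ N / j := Nat.div_le_div_left (by omega) (by omega)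
          have : ((Icc (N.sqrt + 1) N).filter (fun t => N / t = j)).card + N / (j+1) ≤ N / j := by omega
          have : ((((Icc (N.sqrt + 1) N).filter (fun t => N / t = j)).card + N / (j+1) : ℕ) : ℝ) ≤ ((N / j : ℕ):ℝ) := by exact_mod_cast this
          rw [Nat.cast_add] at this
          linarith
        have h12 : (N:ℝ) / j - N / (j+1) = N / (j * (j+1)) := by field_simp; ring
        have h13 : 2 * (N:ℝ) / (j * (j+1)) = N / (j * (j+1)) + N / (j * (j+1)) := by ring
        rw [h13]
        linarith
    calc _ ≤ 2 * N / ((j:ℝ) * (j+1)) * SS s j ^ 2 := by gcongr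
      _ = _ := by ring
  refine (Finset.sum_le_sum key).trans ?_
  rw [← Finset.mul_sum]
  have := II_ge N s
  gcongr

lemma VV_le {h N : ℕ} (hh : 2 ≤ h) (s : Finset ℕ) :
    VV N s ≤ 80 / Real.log h * N * II N s + WW h N s := by
  have hh' : (2:ℝ) ≤ h := by exact_mod_cast hh
  have hlog : 0 < Real.log h := Real.log_pos (by linarith)
  have hQ : QQ N ⊆ Icc (N.sqrt + 1) N := by
    intro p hp
    simp only [QQ, mem_filter, mem_Icc] at hp ⊢
    refine ⟨?_, hp.1.2⟩
    have : N.sqrt < p := Nat.sqrt_lt.2 hp.2.2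
    omega
  have h1 : ∀ p ∈ QQ N, SS s (N / p) ^ 2 ≤ 2 / h * ∑ i ∈ Icc 1 h, SS s (N / (p + i)) ^ 2
      + 2 / h * ∑ i ∈ Icc 1 h, (SS s (N / p) - SS s (N / (p + i))) ^ 2 := by
    intro p hp
    have : ∑ i ∈ Icc 1 h, SS s (N / p) ^ 2 ≤ ∑ i ∈ Icc 1 h, (2 * SS s (N / (p + i)) ^ 2 + 2 * (SS s (N / p) - SS s (N / (p + i))) ^ 2) := by
      apply Finset.sum_le_sum
      intro i _
      nlinarith [sq_nonneg (SS s (N / p) - 2 * SS s (N / (p+i)))]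
    rw [Finset.sum_add_distrib, ← Finset.mul_sum, ← Finset.mul_sum] at this
    simp only [sum_const, Nat.card_Icc, nsmul_eq_mul, Nat.add_sub_cancel] at this
    rw [← mul_add]
    rw [div_mul_eq_mul_div, le_div_iff₀ (by positivity)]
    linarith
  have h2 := Finset.sum_le_sum h1
  rw [Finset.sum_add_distrib] at h2
  have h3 : ∑ p ∈ QQ N, (2 / h * ∑ i ∈ Icc 1 h, (SS s (N / p) - SS s (N / (p + i))) ^ 2) ≤ WW h N s := by
    unfold WW
    rw [← Finset.mul_sum, Finset.sum_comm]
    apply mul_le_mul_of_nonneg_left _ (by positivity)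
    apply Finset.sum_le_sum
    intro i _
    exact Finset.sum_le_sum_of_subset_of_nonneg hQ (fun _ _ _ => sq_nonneg _)
  have h4 : ∑ p ∈ QQ N, (2 / h * ∑ i ∈ Icc 1 h, SS s (N / (p + i)) ^ 2) ≤ 80 / Real.log h * N * II N s := by
    rw [← Finset.mul_sum]
    have e1 : ∀ p ∈ QQ N, ∑ i ∈ Icc 1 h, SS s (N / (p + i)) ^ 2 =
        ∑ t ∈ Icc (N.sqrt + 1) N, if p < t ∧ t ≤ p + h then SS s (N / t) ^ 2 else 0 := by
      intro p hp
      have hp' := hQ hp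
      rw [mem_Icc] at hp'
      rw [← Finset.sum_filter]
      have : ∑ i ∈ Icc 1 h, SS s (N / (p + i)) ^ 2 = ∑ t ∈ Ioc p (p + h), SS s (N / t) ^ 2 := by
        apply Finset.sum_nbij' (fun i => p + i) (fun t => t - p)
        · intro i hi; simp only [mem_Icc, mem_Ioc] at *; omega
        · intro i hi; simp only [mem_Icc, mem_Ioc] at *; omega
        · intro i hi; simp
        · intro i hi; simp only [mem_Ioc] at hi; omega
        · intro i hi; rfl
      rw [this]
      symm
      apply Finset.sum_subset
      · intro t ht
        simp only [mem_filter, mem_Icc, mem_Ioc] at *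
        omega
      · intro t ht ht'
        simp only [mem_filter, mem_Icc, mem_Ioc] at *
        have : N / t = 0 := Nat.div_eq_of_lt (by omega)
        rw [this]; simp [SS]
    rw [Finset.sum_congr rfl e1, Finset.sum_comm]
    have e2 : ∀ t ∈ Icc (N.sqrt + 1) N, ∑ p ∈ QQ N, (if p < t ∧ t ≤ p + h then SS s (N / t) ^ 2 else 0) ≤
        20 * h / Real.log h * SS s (N / t) ^ 2 := by
      intro t ht
      rw [← Finset.sum_filter]
      simp only [sum_const, nsmul_eq_mul]
      apply mul_le_mul_of_nonneg_right _ (sq_nonneg _)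
      refine le_trans ?_ (brun_titchmarsh (t - h - 1) h hh)
      have : (QQ N).filter (fun p => p < t ∧ t ≤ p + h) ⊆ ((Ioc (t - h - 1) (t - h - 1 + h)).filter Nat.Prime) := by
        intro p hp
        simp only [QQ, mem_filter, mem_Icc, mem_Ioc] at *
        refine ⟨?_, hp.1.2.1⟩
        omega
      exact_mod_cast Finset.card_le_card this
    refine (mul_le_mul_of_nonneg_left (Finset.sum_le_sum e2) (by positivity)).trans ?_
    rw [← Finset.mul_sum]
    have := sum_SS_div N s
    calc _ ≤ 2 / (h:ℝ) * (20 * h / Real.log h * (2 * N * II N s)) := by gcongr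
      _ = _ := by field_simp; ring
  unfold VV
  linarith

/-- the main variance estimate. -/
lemma VV_bound {k N : ℕ} (hk : 8 ≤ k) (hN1 : 2 ^ k ≤ N) (hN2 : N ≤ 2 ^ (k + 1)) (s : Finset ℕ) :
    VV N s ≤ 2000 * Real.exp 4 * N * RR N s + WW (2 ^ (k / 4)) N s := by
  have hh : 2 ≤ 2 ^ (k / 4) := by
    calc 2 = 2 ^ 1 := rfl
      _ ≤ 2 ^ (k/4) := Nat.pow_le_pow_right (by norm_num) (by omega)
  refine (VV_le hh s).trans ?_
  have hl2 : 0 < Real.log 2 := Real.log_pos (by norm_num)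
  have hN0 : 2 ≤ N := by
    have : 2 ^ 1 ≤ 2 ^ k := Nat.pow_le_pow_right (by norm_num) (by omega)
    omega
  have h1 : Real.log ((2 ^ (k/4) : ℕ) : ℝ) = (k / 4 : ℕ) * Real.log 2 := by
    push_cast; rw [Real.log_pow]
  have h2 : (k:ℝ) ≤ 8 * (k / 4 : ℕ) := by
    have : k ≤ 8 * (k/4) := by omega
    exact_mod_cast this
  have h3 : Real.log N ≤ (k+1) * Real.log 2 := by
    have : (N:ℝ) ≤ 2 ^ (k+1) := by exact_mod_cast hN2
    have := Real.log_le_log (by positivity) this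
    rw [Real.log_pow] at this
    exact_mod_cast this
  have h4 : II N s = RR N s * Pi N := by
    unfold RR; rw [div_mul_cancel₀ _ (Pi_pos N).ne']
  have h5 := Pi_le N hN0
  have h6 : 80 / Real.log ((2 ^ (k/4) : ℕ) : ℝ) * Pi N ≤ 2000 * Real.exp 4 := by
    rw [h1, div_mul_eq_mul_div, div_le_iff₀ (by
      have : 0 < k/4 := by omega
      positivity)]
    have hk' : (8:ℝ) ≤ k := by exact_mod_cast hk
    have he := Real.exp_pos 4
    calc 80 * Pi N ≤ 80 * (Real.exp 4 * ((k+1) * Real.log 2)) := by gcongr; exact h5.trans (by gcongr)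
      _ = (80 * (k+1)) * (Real.exp 4 * Real.log 2) := by ring
      _ ≤ (2000 * (k/4 : ℕ)) * (Real.exp 4 * Real.log 2) := by
          refine mul_le_mul_of_nonneg_right ?_ (by positivity)
          linarith
      _ = _ := by ring
  have h7 := RR_nonneg N s
  have : 80 / Real.log ((2 ^ (k/4) : ℕ) : ℝ) * N * II N s ≤ 2000 * Real.exp 4 * N * RR N s := by
    rw [h4]
    calc _ = (80 / Real.log ((2 ^ (k/4) : ℕ) : ℝ) * Pi N) * (N * RR N s) := by ring
      _ ≤ 2000 * Real.exp 4 * (N * RR N s) := by gcongr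
      _ = _ := by ring
  linarith
end RMF

namespace RMF
open Finset

lemma Pfac_mem {n : ℕ} (hn : 2 ≤ n) : Pfac n ∈ n.primeFactors := by
  unfold Pfac
  rw [if_neg (by omega)]
  have hne : n.primeFactors.Nonempty := Nat.nonempty_primeFactors.2 (by omega)
  obtain ⟨q, hq, h⟩ := Finset.exists_mem_eq_sup n.primeFactors hne id
  rw [h]; exact hq

lemma le_Pfac {n q : ℕ} (hq : q ∈ n.primeFactors) : q ≤ Pfac n := by
  unfold Pfac
  have h1 : 2 ≤ q := (Nat.prime_of_mem_primeFactors hq).two_le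
  have h2 : q ≤ n := Nat.le_of_mem_primeFactors hq
  rw [if_neg (by omega)]
  exact Finset.le_sup (f := id) hq

lemma Pfac_mul {p m : ℕ} (hp : p.Prime) (hm : 1 ≤ m) (hmp : m < p) : Pfac (p * m) = p := by
  have h1 : p.primeFactors = {p} := hp.primeFactors
  have h2 : 2 ≤ p * m := by nlinarith [hp.two_le]
  have h3 := Pfac_mem h2
  have h4 : p ≤ Pfac (p * m) := le_Pfac (by
    rw [Nat.primeFactors_mul hp.ne_zero (by omega), h1]; simp)
  rw [Nat.primeFactors_mul hp.ne_zero (by omega), h1, mem_union, mem_singleton] at h3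
  rcases h3 with h3 | h3
  · exact h3
  · have := Nat.le_of_mem_primeFactors h3; omega

lemma fs_mul {p m : ℕ} (hp : p.Prime) (hm : 1 ≤ m) (hmp : m < p) (s : Finset ℕ) :
    fs s (p * m) = sg s p * fs s m := by
  have hd : ¬ p ∣ m := fun h => by have := Nat.le_of_dvd hm h; omega
  have hc : p.Coprime m := (Nat.Prime.coprime_iff_not_dvd hp).2 hd
  unfold fs
  have h0 := Nat.squarefree_mul hc
  have h1 : Squarefree p := hp.squarefree
  by_cases h : Squarefree m
  · rw [if_pos (h0.2 ⟨h1, h⟩), if_pos h, Nat.primeFactors_mul hp.ne_zero (by omega), hp.primeFactors]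
    unfold chi
    rw [Finset.prod_union, Finset.prod_singleton]
    rw [Finset.disjoint_singleton_left]
    exact fun h => hd (Nat.dvd_of_mem_primeFactors h)
  · rw [if_neg (fun h' => h (h0.1 h').2), if_neg h, mul_zero]

/-- the sum in question -/
def MM (N : ℕ) (s : Finset ℕ) : ℝ := ∑ n ∈ (Icc 1 N).filter (fun n => N < Pfac n * Pfac n), fs s n

lemma MM_eq (N : ℕ) (s : Finset ℕ) : MM N s = ∑ p ∈ QQ N, sg s p * SS s (N / p) := by
  unfold MM SS
  simp_rw [Finset.mul_sum]
  rw [Finset.sum_sigma']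
  have hlt : ∀ p ∈ QQ N, ∀ m ∈ Icc 1 (N / p), p.Prime ∧ 1 ≤ m ∧ m < p ∧ p * m ≤ N ∧ N < p * p := by
    intro p hp m hm
    simp only [QQ, mem_filter, mem_Icc] at hp hm
    have h1 : N / p < p := by rw [Nat.div_lt_iff_lt_mul hp.2.1.pos]; exact hp.2.2
    refine ⟨hp.2.1, hm.1, by omega, ?_, hp.2.2⟩
    have := (Nat.le_div_iff_mul_le hp.2.1.pos).1 hm.2
    linarith [mul_comm p m]
  symm
  apply Finset.sum_nbij' (fun x : (_ : ℕ) × ℕ => x.1 * x.2) (fun n => ⟨Pfac n, n / Pfac n⟩)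
  · rintro ⟨p, m⟩ h
    rw [mem_sigma] at h
    obtain ⟨a, b, c, d, e⟩ := hlt p h.1 m h.2
    simp only [mem_filter, mem_Icc]
    rw [Pfac_mul a b c]
    exact ⟨⟨Nat.mul_pos a.pos b, d⟩, e⟩
  · intro n hn
    simp only [mem_filter, mem_Icc] at hn
    have h2 : 2 ≤ n := by
      by_contra hlt
      have : n = 1 := by omega
      subst this
      simp [Pfac] at hn
      omega
    have h3 := Pfac_mem h2
    have h4 := Nat.prime_of_mem_primeFactors h3
    have h5 := Nat.le_of_mem_primeFactors h3
    simp only [mem_sigma, QQ, mem_filter, mem_Icc]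
    refine ⟨⟨⟨h4.one_lt.le, by omega⟩, h4, hn.2⟩, Nat.div_pos h5 h4.pos, Nat.div_le_div_right hn.1.2⟩
  · rintro ⟨p, m⟩ h
    rw [mem_sigma] at h
    obtain ⟨a, b, c, d, e⟩ := hlt p h.1 m h.2
    simp only [Pfac_mul a b c, Nat.mul_div_cancel_left m a.pos]
  · intro n hn
    simp only [mem_filter, mem_Icc] at hn
    have h2 : 2 ≤ n := by
      by_contra hlt
      have : n = 1 := by omega
      subst this
      simp [Pfac] at hn
      omega
    exact Nat.mul_div_cancel' (Nat.dvd_of_mem_primeFactors (Pfac_mem h2))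
  · rintro ⟨p, m⟩ h
    rw [mem_sigma] at h
    obtain ⟨a, b, c, d, e⟩ := hlt p h.1 m h.2
    rw [fs_mul a b c]

lemma dep_fs {N m : ℕ} (h : m < N) : Dep N (fun s => fs s m) := by
  unfold fs
  by_cases hm : Squarefree m
  · simp only [hm, if_true]
    exact dep_chi (fun p hp => mem_range.2 ((Nat.le_of_mem_primeFactors hp).trans_lt h))
  · simp only [hm, if_false]; exact dep_const _

lemma dep_SS {N j : ℕ} (h : j < N) : Dep N (fun s => SS s j) := by
  unfold SS
  exact dep_sum _ _ (fun m hm => dep_fs ((mem_Icc.1 hm).2.trans_lt h))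

lemma dep_MM {N J : ℕ} (h : J < N) : Dep N (MM J) := by
  unfold MM
  exact dep_sum _ _ (fun m hm => dep_fs ((mem_Icc.1 (mem_filter.1 hm).1).2.trans_lt h))

lemma exp_mart (N : ℕ) (X : ℕ → Finset ℕ → ℝ) (hX : ∀ j, Dep j (X j)) (lam : ℝ) :
    Ex N (fun s => Real.exp (∑ j ∈ range N, (lam * (sg s j * X j s) - lam ^ 2 / 2 * X j s ^ 2))) ≤ 1 := by
  induction N with
  | zero => simp [Ex]
  | succ N ih =>
    have hd : Dep N (fun s => Real.exp (∑ j ∈ range N, (lam * (sg s j * X j s) - lam ^ 2 / 2 * X j s ^ 2))) := by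
      apply Dep.comp _ Real.exp
      apply dep_sum
      intro j hj
      rw [mem_range] at hj
      exact Dep.comp₂ (dep_sg hj) ((hX j).mono hj.le) (fun x y => lam * (x * y) - lam ^ 2 / 2 * y ^ 2)
    have := Ex_step (N := N) (fun s x => Real.exp (∑ j ∈ range N, (lam * (sg s j * X j s) - lam ^ 2 / 2 * X j s ^ 2)) *
      Real.exp (lam * (x * X N s) - lam ^ 2 / 2 * X N s ^ 2))
      (fun x => Dep.comp₂ hd (hX N) (fun a b => a * Real.exp (lam * (x * b) - lam ^ 2 / 2 * b ^ 2)))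
    simp_rw [Finset.sum_range_succ, Real.exp_add]
    rw [this]
    refine le_trans (Ex_mono' fun s => ?_) ih
    set A := Real.exp (∑ j ∈ range N, (lam * (sg s j * X j s) - lam ^ 2 / 2 * X j s ^ 2))
    have hA : 0 ≤ A := (Real.exp_pos _).le
    have h1 := Real.cosh_le_exp_half_sq (lam * X N s)
    have h2 : (Real.exp (lam * (1 * X N s) - lam ^ 2 / 2 * X N s ^ 2) + Real.exp (lam * (-1 * X N s) - lam ^ 2 / 2 * X N s ^ 2)) / 2 ≤ 1 := by
      have e1 : Real.exp (lam * (1 * X N s) - lam ^ 2 / 2 * X N s ^ 2) = Real.exp (lam * X N s) * Real.exp (-((lam * X N s) ^ 2 / 2)) := by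
        rw [← Real.exp_add]; congr 1; ring
      have e2 : Real.exp (lam * (-1 * X N s) - lam ^ 2 / 2 * X N s ^ 2) = Real.exp (-(lam * X N s)) * Real.exp (-((lam * X N s) ^ 2 / 2)) := by
        rw [← Real.exp_add]; congr 1; ring
      rw [e1, e2, ← add_mul, mul_div_right_comm, ← Real.cosh_eq]
      calc _ ≤ Real.exp ((lam * X N s) ^ 2 / 2) * Real.exp (-((lam * X N s) ^ 2 / 2)) := by gcongr
        _ = 1 := by rw [← Real.exp_add]; simp
    calc _ = A * ((Real.exp (lam * (1 * X N s) - lam ^ 2 / 2 * X N s ^ 2) + Real.exp (lam * (-1 * X N s) - lam ^ 2 / 2 * X N s ^ 2)) / 2) := by ring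
      _ ≤ A * 1 := by gcongr
      _ = A := mul_one _

lemma MM_exp (N : ℕ) (lam : ℝ) :
    Ex (N + 1) (fun s => Real.exp (lam * MM N s - lam ^ 2 / 2 * VV N s)) ≤ 1 := by
  classical
  have := exp_mart (N + 1) (fun j s => if j ∈ QQ N then SS s (N / j) else 0) (by
    intro j
    by_cases h : j ∈ QQ N
    · simp only [h, if_true]
      apply dep_SS
      simp only [QQ, mem_filter, mem_Icc] at h
      rw [Nat.div_lt_iff_lt_mul (by omega)]; exact h.2.2
    · simp only [h, if_false]; exact dep_const _) lam
  refine le_of_eq_of_le ?_ this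
  congr 1
  ext s
  congr 1
  have hsub : QQ N ⊆ range (N + 1) := by
    intro p hp
    simp only [QQ, mem_filter, mem_Icc] at hp
    rw [mem_range]; omega
  rw [MM_eq, VV, Finset.mul_sum, Finset.mul_sum, ← Finset.sum_sub_distrib]
  rw [← Finset.sum_subset hsub]
  · apply Finset.sum_congr rfl
    intro p hp
    simp only [hp, if_true]
  · intro p _ hp
    simp [hp]

lemma MM_tail {N : ℕ} (hN : 1 ≤ N) {H v : ℝ} (hH : 0 < H) (hv : 0 < v) :
    Pr (N + 1) (fun s => VV N s ≤ v * N ∧ Real.sqrt N * H < |MM N s|) ≤ 2 * Real.exp (-(H ^ 2 / (2 * v))) := by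
  have hN' : (0:ℝ) < N := by exact_mod_cast hN
  have hsq : Real.sqrt N ^ 2 = N := Real.sq_sqrt hN'.le
  have hs0 : 0 < Real.sqrt N := Real.sqrt_pos.2 hN'
  set lam := H / (v * Real.sqrt N) with hlam
  have hl0 : 0 < lam := by positivity
  have e1 : lam * (Real.sqrt N * H) = H ^ 2 / v := by
    rw [hlam]; field_simp
  have e2 : lam ^ 2 / 2 * (v * N) = H ^ 2 / (2 * v) := by
    rw [hlam, div_pow, mul_pow, hsq]; field_simp
  have e3 : H ^ 2 / v = 2 * (H ^ 2 / (2 * v)) := by field_simp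
  have hb : ∀ s, ind (VV N s ≤ v * N ∧ Real.sqrt N * H < |MM N s|) ≤
      Real.exp (-(H ^ 2 / (2 * v))) * (Real.exp (lam * MM N s - lam ^ 2 / 2 * VV N s) + Real.exp ((-lam) * MM N s - (-lam) ^ 2 / 2 * VV N s)) := by
    intro s
    by_cases h : VV N s ≤ v * N ∧ Real.sqrt N * H < |MM N s|
    · rw [ind_true h]
      have h1 : lam ^ 2 / 2 * VV N s ≤ H ^ 2 / (2 * v) := by rw [← e2]; gcongr; exact h.1
      have h2 : H ^ 2 / v ≤ lam * |MM N s| := by rw [← e1]; gcongr; exact h.2.le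
      rw [mul_add, ← Real.exp_add, ← Real.exp_add]
      rcases abs_cases (MM N s) with ⟨ha, _⟩ | ⟨ha, _⟩
      · rw [ha] at h2
        have : 1 ≤ Real.exp (-(H ^ 2 / (2 * v)) + (lam * MM N s - lam ^ 2 / 2 * VV N s)) := Real.one_le_exp (by linarith)
        linarith [Real.exp_pos (-(H ^ 2 / (2 * v)) + ((-lam) * MM N s - (-lam) ^ 2 / 2 * VV N s))]
      · rw [ha] at h2
        have : 1 ≤ Real.exp (-(H ^ 2 / (2 * v)) + ((-lam) * MM N s - (-lam) ^ 2 / 2 * VV N s)) := Real.one_le_exp (by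
          rw [neg_sq]; linarith)
        linarith [Real.exp_pos (-(H ^ 2 / (2 * v)) + (lam * MM N s - lam ^ 2 / 2 * VV N s))]
    · rw [ind_false h]; positivity
  unfold Pr
  refine (Ex_mono' hb).trans ?_
  rw [Ex_mul_left, Ex_add]
  have h1 := MM_exp N lam
  have h2 := MM_exp N (-lam)
  have := Real.exp_pos (-(H ^ 2 / (2 * v)))
  nlinarith
end RMF

namespace RMF
open Finset

def om9 (x : ℕ) : ℝ := ∑ m ∈ Icc 1 x, if Squarefree m then (9:ℝ) ^ m.primeFactors.card else 0

lemma om9_le (x : ℕ) : om9 x ≤ x * Pi (x + 1) ^ 9 := by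
  have h1 : om9 x ≤ x * ∑ m ∈ Icc 1 x, if Squarefree m then ∏ j ∈ m.primeFactors, (9 * aq j) else 0 := by
    unfold om9
    rw [Finset.mul_sum]
    apply Finset.sum_le_sum
    intro m hm
    rw [mem_Icc] at hm
    split_ifs with h
    · have e : ∏ j ∈ m.primeFactors, (9 * aq j) = 9 ^ m.primeFactors.card / m := by
        rw [Finset.prod_mul_distrib, Finset.prod_const]
        have : ∏ j ∈ m.primeFactors, aq j = 1 / (m:ℝ) := by
          have e2 : ∀ j ∈ m.primeFactors, aq j = (j:ℝ)⁻¹ := by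
            intro j hj
            simp [aq, Nat.prime_of_mem_primeFactors hj]
          rw [Finset.prod_congr rfl e2, Finset.prod_inv_distrib, ← Nat.cast_prod,
            Nat.prod_primeFactors_of_squarefree h, one_div]
        rw [this]; ring
      rw [e]
      have hm0 : (0:ℝ) < m := by exact_mod_cast hm.1
      have hx : (m:ℝ) ≤ x := by exact_mod_cast hm.2
      rw [← mul_div_assoc, le_div_iff₀ hm0, mul_comm]
      gcongr
    · simp
  refine h1.trans ?_
  have hb := sum_sqfree_bij (Nat.lt_succ_self x) (fun u => ∏ j ∈ u, (9 * aq j))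
  rw [← hb]
  gcongr
  have hnn : ∀ u : Finset ℕ, 0 ≤ ∏ j ∈ u, (9 * aq j) := fun u =>
    Finset.prod_nonneg fun j _ => mul_nonneg (by norm_num) (aq_nonneg j)
  have hsub : (PP x.succ).powerset.filter (fun u => nn u ≤ x) ⊆ (range (x + 1)).powerset := by
    intro u hu
    rw [mem_filter, mem_powerset] at hu
    exact mem_powerset.2 (hu.1.trans (filter_subset _ _))
  refine (Finset.sum_le_sum_of_subset_of_nonneg hsub (fun u _ _ => hnn u)).trans ?_
  rw [← Finset.prod_one_add, Pi, ← Finset.prod_pow]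
  apply Finset.prod_le_prod
  · intro j _; have := aq_nonneg j; linarith
  · intro j _
    have := one_add_mul_le_pow (a := aq j) (by linarith [aq_nonneg j]) 9
    exact_mod_cast this

lemma om9_pow (k : ℕ) : om9 (2 ^ (k + 1)) ≤ 2 ^ (k + 1) * (Real.exp 36 * (k + 2) ^ 9) := by
  refine (om9_le _).trans ?_
  have h1 : 1 ≤ 2 ^ (k + 1) := Nat.one_le_two_pow
  have h2 := Pi_le (2 ^ (k + 1) + 1) (by omega)
  have h3 : Real.log ((2 ^ (k + 1) + 1 : ℕ) : ℝ) ≤ k + 2 := by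
    have : ((2 ^ (k + 1) + 1 : ℕ) : ℝ) ≤ 2 ^ (k + 2) := by
      have : 2 ^ (k + 1) + 1 ≤ 2 ^ (k + 2) := by rw [pow_succ 2 (k+1)]; omega
      exact_mod_cast this
    have h4 := Real.log_le_log (by positivity) this
    rw [Real.log_pow] at h4
    have h5 : Real.log 2 ≤ 1 := by linarith [Real.log_two_lt_d9]
    push_cast at h4 ⊢
    have : ((k:ℝ) + 2) * Real.log 2 ≤ (k + 2) * 1 := by gcongr
    linarith
  have h6 : Pi (2 ^ (k + 1) + 1) ≤ Real.exp 4 * (k + 2) := h2.trans (by gcongr)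
  have h7 := (Pi_pos (2 ^ (k + 1) + 1)).le
  push_cast
  gcongr
  calc Pi (2 ^ (k + 1) + 1) ^ 9 ≤ (Real.exp 4 * (k + 2)) ^ 9 := by gcongr
    _ = _ := by rw [mul_pow, ← Real.exp_nat_mul]; norm_num

lemma chain_gen (g : ℕ → ℝ) {δ : ℝ} {k N : ℕ} (hN1 : 2 ^ k ≤ N) (hN2 : N < 2 ^ (k + 1)) (h : ℕ) (hk : h ≤ k)
    (H : ∀ i < h, ∀ q, 2 ^ k ≤ q * 2 ^ i → (q + 1) * 2 ^ i ≤ 2 ^ (k + 1) → |g ((q + 1) * 2 ^ i) - g (q * 2 ^ i)| ≤ δ) (hδ : 0 ≤ δ) :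
    |g N - g (N / 2 ^ h * 2 ^ h)| ≤ h * δ := by
  induction h with
  | zero => simp
  | succ h ih =>
    have ih' := ih (by omega) (fun i hi => H i (by omega))
    have e : N / 2 ^ (h + 1) = N / 2 ^ h / 2 := by rw [pow_succ, Nat.div_div_eq_div_mul]
    have hle : 2 ^ k ≤ N / 2 ^ (h + 1) * 2 ^ (h + 1) := by
      have : 2 ^ (k - (h + 1)) ≤ N / 2 ^ (h + 1) := by
        rw [Nat.le_div_iff_mul_le (by positivity), ← pow_add]
        rwa [show k - (h + 1) + (h + 1) = k by omega]
      calc 2 ^ k = 2 ^ (k - (h + 1)) * 2 ^ (h + 1) := by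
            rw [← pow_add, show k - (h + 1) + (h + 1) = k by omega]
        _ ≤ _ := Nat.mul_le_mul_right _ this
    have step : |g (N / 2 ^ h * 2 ^ h) - g (N / 2 ^ (h + 1) * 2 ^ (h + 1))| ≤ δ := by
      set q := N / 2 ^ h with hq
      have hqN : q * 2 ^ h ≤ N := Nat.div_mul_le_self N _
      rw [e] at hle ⊢
      have e2 : q / 2 * 2 ^ (h + 1) = (q / 2 * 2) * 2 ^ h := by rw [pow_succ]; ring
      rw [e2] at hle ⊢
      rcases Nat.even_or_odd q with ⟨r, hr⟩ | ⟨r, hr⟩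
      · have : q / 2 * 2 = q := by omega
        rw [this]; simpa using hδ
      · have h1 : q / 2 * 2 + 1 = q := by omega
        have := H h (by omega) (q / 2 * 2) hle (by rw [h1]; omega)
        rwa [h1] at this
    push_cast
    have := abs_sub_le (g N) (g (N / 2 ^ h * 2 ^ h)) (g (N / 2 ^ (h + 1) * 2 ^ (h + 1)))
    linarith

/-- support of the increment -/
def DS (a b : ℕ) : Finset ℕ := (Icc 1 b).filter (fun n => a < n ∨ (a < Pfac n * Pfac n ∧ Pfac n * Pfac n ≤ b))

lemma DS_card {a b : ℕ} (ha : 1 ≤ a) (hab : a ≤ b) : ((DS a b).card : ℝ) ≤ 2 * (b - a) + Real.sqrt a := by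
  have h1 : DS a b ⊆ Ioc a b ∪ (Icc 1 a).filter (fun n => a < Pfac n * Pfac n ∧ Pfac n * Pfac n ≤ b) := by
    intro n hn
    simp only [DS, mem_filter, mem_Icc, mem_union, mem_Ioc] at *
    by_cases h : a < n
    · left; omega
    · right; exact ⟨by omega, hn.2.resolve_left h⟩
  have h2 : ((Icc 1 a).filter (fun n => a < Pfac n * Pfac n ∧ Pfac n * Pfac n ≤ b)).card ≤ (b.sqrt - a.sqrt) * a.sqrt := by
    have : (Ioc a.sqrt b.sqrt ×ˢ Icc 1 a.sqrt).card = (b.sqrt - a.sqrt) * a.sqrt := by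
      rw [card_product]; simp
    rw [← this]
    have hmem : ∀ n ∈ (Icc 1 a).filter (fun n => a < Pfac n * Pfac n ∧ Pfac n * Pfac n ≤ b),
        Pfac n ∈ n.primeFactors := by
      intro n hn
      simp only [mem_filter, mem_Icc] at hn
      apply Pfac_mem
      by_contra hlt
      have : n = 1 := by omega
      subst this
      simp [Pfac] at hn
      omega
    apply Finset.card_le_card_of_injOn (fun n => (Pfac n, n / Pfac n))
    · intro n hn
      have hm := hmem n hn
      have h4 := Nat.prime_of_mem_primeFactors hm
      have h5 := Nat.le_of_mem_primeFactors hm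
      have h6 := Nat.div_mul_cancel (Nat.dvd_of_mem_primeFactors hm)
      simp only [coe_filter, Set.mem_setOf_eq, mem_Icc] at hn
      simp only [coe_product, Set.mem_prod, mem_coe, mem_Ioc, mem_Icc]
      refine ⟨⟨Nat.sqrt_lt.2 hn.2.1, Nat.le_sqrt.2 hn.2.2⟩, Nat.div_pos h5 h4.pos, ?_⟩
      rw [Nat.le_sqrt]
      set m := n / Pfac n
      set p := Pfac n
      have : m < p := by
        by_contra hc
        push Not at hc
        have : p * p ≤ m * p := Nat.mul_le_mul_right p hc
        omega
      nlinarith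
    · intro n hn n' hn' he
      have hm := hmem n hn
      have hm' := hmem n' hn'
      have h6 := Nat.div_mul_cancel (Nat.dvd_of_mem_primeFactors hm)
      have h6' := Nat.div_mul_cancel (Nat.dvd_of_mem_primeFactors hm')
      simp only [Prod.mk.injEq] at he
      rw [← h6, ← h6', he.2, he.1]
  have h3 : (b.sqrt - a.sqrt) * a.sqrt ≤ (b - a) + a.sqrt := by
    have e1 := Nat.sqrt_le b
    have e2 := Nat.lt_succ_sqrt a
    simp only [Nat.succ_eq_add_one] at e2
    have e3 := Nat.sqrt_le_sqrt hab
    rcases Nat.lt_or_ge a.sqrt b.sqrt with h | h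
    · obtain ⟨d, hd⟩ : ∃ d, b.sqrt = a.sqrt + 1 + d := ⟨b.sqrt - a.sqrt - 1, by omega⟩
      obtain ⟨c, hc⟩ : ∃ c, b = a + c := ⟨b - a, by omega⟩
      rw [hd] at e1 ⊢
      rw [show a.sqrt + 1 + d - a.sqrt = d + 1 by omega, show b - a = c by omega]
      nlinarith
    · rw [Nat.sub_eq_zero_of_le h]; simp
  have h4 : (DS a b).card ≤ (b - a) + ((b - a) + a.sqrt) := by
    refine (card_le_card h1).trans ((card_union_le _ _).trans ?_)
    rw [Nat.card_Ioc]
    exact Nat.add_le_add_left (h2.trans h3) _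
  have h5 : ((DS a b).card : ℝ) ≤ ((b - a : ℕ):ℝ) + (((b - a : ℕ):ℝ) + (a.sqrt:ℝ)) := by exact_mod_cast h4
  rw [Nat.cast_sub hab] at h5
  have h6 : (a.sqrt : ℝ) ≤ Real.sqrt a := Real.nat_sqrt_le_real_sqrt
  linarith

lemma MM_incr {a b : ℕ} (hab : a ≤ b) (s : Finset ℕ) : MM b s - MM a s = ∑ n ∈ Icc 1 b,
    ((if b < Pfac n * Pfac n then (1:ℝ) else 0) - (if n ≤ a ∧ a < Pfac n * Pfac n then 1 else 0)) * fs s n := by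
  unfold MM
  have : (Icc 1 a).filter (fun n => a < Pfac n * Pfac n) = (Icc 1 b).filter (fun n => n ≤ a ∧ a < Pfac n * Pfac n) := by
    ext n; simp only [mem_filter, mem_Icc]; constructor
    · rintro ⟨⟨h1, h2⟩, h3⟩; exact ⟨⟨h1, by omega⟩, h2, h3⟩
    · rintro ⟨⟨h1, h2⟩, h3, h4⟩; exact ⟨⟨h1, h3⟩, h4⟩
  rw [this, Finset.sum_filter, Finset.sum_filter, ← Finset.sum_sub_distrib]
  apply Finset.sum_congr rfl
  intro n _
  split_ifs <;> simp

lemma MM_four {a b M : ℕ} (ha : 1 ≤ a) (hab : a ≤ b) (hM : b < M) :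
    Ex M (fun s => (MM b s - MM a s) ^ 4) ≤ (2 * (b - a) + Real.sqrt a) *
      ∑ n ∈ DS a b, if Squarefree n then (9:ℝ) ^ n.primeFactors.card else 0 := by
  simp_rw [MM_incr hab]
  refine (Ex_lin_four hM _).trans ?_
  have h1 : ∑ m ∈ Icc 1 b, (if Squarefree m then ((if b < Pfac m * Pfac m then (1:ℝ) else 0) - (if m ≤ a ∧ a < Pfac m * Pfac m then 1 else 0)) ^ 2 * 3 ^ m.primeFactors.card else 0)
      ≤ ∑ m ∈ DS a b, if Squarefree m then (3:ℝ) ^ m.primeFactors.card else 0 := by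
    unfold DS
    rw [Finset.sum_filter]
    apply Finset.sum_le_sum
    intro m _
    by_cases hs : Squarefree m
    · simp only [hs, if_true]
      have h3 : (0:ℝ) ≤ 3 ^ m.primeFactors.card := by positivity
      split_ifs <;> first | (exfalso; omega) | (norm_num) 
    · simp [hs]
  have h0 : 0 ≤ ∑ m ∈ Icc 1 b, (if Squarefree m then ((if b < Pfac m * Pfac m then (1:ℝ) else 0) - (if m ≤ a ∧ a < Pfac m * Pfac m then 1 else 0)) ^ 2 * 3 ^ m.primeFactors.card else 0) := by
    apply Finset.sum_nonneg
    intro m _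
    split_ifs <;> positivity
  refine (pow_le_pow_left₀ h0 h1 2).trans ?_
  have h2 := sq_sum_le_card_mul_sum_sq (s := DS a b) (f := fun m => if Squarefree m then (3:ℝ) ^ m.primeFactors.card else 0)
  refine h2.trans ?_
  have h3 : ∀ m ∈ DS a b, (if Squarefree m then (3:ℝ) ^ m.primeFactors.card else 0) ^ 2 = if Squarefree m then (9:ℝ) ^ m.primeFactors.card else 0 := by
    intro m _
    split_ifs
    · rw [← pow_mul, mul_comm, pow_mul]; norm_num
    · simp
  rw [Finset.sum_congr rfl h3]
  have h4 := DS_card ha hab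
  apply mul_le_mul_of_nonneg_right h4
  apply Finset.sum_nonneg
  intro m _
  split_ifs <;> positivity

lemma chain_level {k i : ℕ} (hi : i ≤ k) {δ : ℝ} (hδ : 0 < δ) :
    Pr (2 ^ (k + 1) + 1) (fun s => ∃ q ∈ Ico (2 ^ (k - i)) (2 ^ (k + 1 - i)), δ ≤ |MM ((q + 1) * 2 ^ i) s - MM (q * 2 ^ i) s|) ≤
      (2 * 2 ^ i + Real.sqrt (2 ^ (k + 1))) * (2 * om9 (2 ^ (k + 1))) / δ ^ 4 := by
  refine (Pr_exists _).trans ?_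
  have h1 : ∀ q ∈ Ico (2 ^ (k - i)) (2 ^ (k + 1 - i)), Pr (2 ^ (k + 1) + 1) (fun s => δ ≤ |MM ((q + 1) * 2 ^ i) s - MM (q * 2 ^ i) s|) ≤
      (2 * 2 ^ i + Real.sqrt (2 ^ (k + 1))) * (∑ n ∈ DS (q * 2 ^ i) ((q + 1) * 2 ^ i), if Squarefree n then (9:ℝ) ^ n.primeFactors.card else 0) / δ ^ 4 := by
    intro q hq
    rw [mem_Ico] at hq
    have e1 : 2 ^ (k + 1 - i) * 2 ^ i = 2 ^ (k + 1) := by rw [← pow_add]; congr 1; omega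
    have hq1 : 1 ≤ q := Nat.one_le_two_pow.trans hq.1
    have hb : (q + 1) * 2 ^ i ≤ 2 ^ (k + 1) := by rw [← e1]; exact Nat.mul_le_mul_right _ hq.2
    have ha : 1 ≤ q * 2 ^ i := Nat.mul_pos hq1 (by positivity)
    have hab : q * 2 ^ i ≤ (q + 1) * 2 ^ i := Nat.mul_le_mul_right _ (by omega)
    have h2 : Pr (2 ^ (k + 1) + 1) (fun s => δ ≤ |MM ((q + 1) * 2 ^ i) s - MM (q * 2 ^ i) s|) ≤
        Pr (2 ^ (k + 1) + 1) (fun s => δ ^ 4 ≤ (MM ((q + 1) * 2 ^ i) s - MM (q * 2 ^ i) s) ^ 4) := by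
      apply Pr_mono
      intro s hs
      have := pow_le_pow_left₀ hδ.le hs 4
      rwa [Even.pow_abs (by decide)] at this
    refine h2.trans ((Pr_markov (fun s => by positivity) (by positivity)).trans ?_)
    gcongr
    refine (MM_four ha hab (by omega)).trans ?_
    apply mul_le_mul_of_nonneg_right
    · have e2 : (((q + 1) * 2 ^ i : ℕ) : ℝ) - ((q * 2 ^ i : ℕ) : ℝ) = 2 ^ i := by push_cast; ring
      rw [e2]
      gcongr
      have : q * 2 ^ i ≤ 2 ^ (k + 1) := by omega
      exact_mod_cast this
    · apply Finset.sum_nonneg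
      intro m _
      split_ifs <;> positivity
  refine (Finset.sum_le_sum h1).trans ?_
  rw [← Finset.sum_div, ← Finset.mul_sum]
  gcongr
  have h3 : ∀ q ∈ Ico (2 ^ (k - i)) (2 ^ (k + 1 - i)), (∑ n ∈ DS (q * 2 ^ i) ((q + 1) * 2 ^ i), if Squarefree n then (9:ℝ) ^ n.primeFactors.card else 0)
      = ∑ n ∈ Icc 1 (2 ^ (k + 1)), if n ∈ DS (q * 2 ^ i) ((q + 1) * 2 ^ i) then (if Squarefree n then (9:ℝ) ^ n.primeFactors.card else 0) else 0 := by
    intro q hq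
    rw [mem_Ico] at hq
    have e1 : 2 ^ (k + 1 - i) * 2 ^ i = 2 ^ (k + 1) := by rw [← pow_add]; congr 1; omega
    have hb : (q + 1) * 2 ^ i ≤ 2 ^ (k + 1) := by rw [← e1]; exact Nat.mul_le_mul_right _ hq.2
    rw [← Finset.sum_filter (fun n => n ∈ DS (q * 2 ^ i) ((q + 1) * 2 ^ i))]
    apply Finset.sum_congr _ (fun _ _ => rfl)
    ext n
    simp only [mem_filter, mem_Icc]
    constructor
    · intro h
      refine ⟨?_, h⟩
      simp only [DS, mem_filter, mem_Icc] at h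
      omega
    · exact fun h => h.2
  rw [Finset.sum_congr rfl h3, Finset.sum_comm, om9, Finset.mul_sum]
  apply Finset.sum_le_sum
  intro n hn
  rw [← Finset.sum_filter, Finset.sum_const, nsmul_eq_mul]
  apply mul_le_mul_of_nonneg_right
  · have hsub : (Ico (2 ^ (k - i)) (2 ^ (k + 1 - i))).filter (fun q => n ∈ DS (q * 2 ^ i) ((q + 1) * 2 ^ i)) ⊆
        {(n - 1) / 2 ^ i, (Pfac n * Pfac n - 1) / 2 ^ i} := by
      intro q hq
      simp only [DS, mem_filter, mem_Icc] at hq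
      have key : ∀ x, q * 2 ^ i < x → x ≤ (q + 1) * 2 ^ i → q = (x - 1) / 2 ^ i := by
        intro x h1 h2
        have e0 : (q + 1) * 2 ^ i = q * 2 ^ i + 2 ^ i := by ring
        have hpos : 0 < 2 ^ i := by positivity
        have h3 : (x - 1) / 2 ^ i < q + 1 := by rw [Nat.div_lt_iff_lt_mul hpos]; omega
        have h4 : q ≤ (x - 1) / 2 ^ i := by rw [Nat.le_div_iff_mul_le hpos]; omega
        omega
      rw [mem_insert, mem_singleton]
      rcases hq.2.2 with h | h
      · left; exact key n h hq.2.1.2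
      · right; exact key _ h.1 h.2
    have := (card_le_card hsub).trans (card_le_two)
    exact_mod_cast this
  · split_ifs <;> positivity

lemma chain_prob {k h : ℕ} (hk : h ≤ k) {δ : ℝ} (hδ : 0 < δ) :
    Pr (2 ^ (k + 1) + 1) (fun s => ∃ i ∈ range h, ∃ q ∈ Ico (2 ^ (k - i)) (2 ^ (k + 1 - i)), δ ≤ |MM ((q + 1) * 2 ^ i) s - MM (q * 2 ^ i) s|) ≤
      k * ((2 * 2 ^ h + Real.sqrt (2 ^ (k + 1))) * (2 * (2 ^ (k + 1) * (Real.exp 36 * (k + 2) ^ 9))) / δ ^ 4) := by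
  refine (Pr_exists _).trans ?_
  have h1 : ∀ i ∈ range h, Pr (2 ^ (k + 1) + 1) (fun s => ∃ q ∈ Ico (2 ^ (k - i)) (2 ^ (k + 1 - i)), δ ≤ |MM ((q + 1) * 2 ^ i) s - MM (q * 2 ^ i) s|) ≤
      (2 * 2 ^ h + Real.sqrt (2 ^ (k + 1))) * (2 * (2 ^ (k + 1) * (Real.exp 36 * (k + 2) ^ 9))) / δ ^ 4 := by
    intro i hi
    rw [mem_range] at hi
    refine (chain_level (by omega) hδ).trans ?_
    have := om9_pow k
    have h0 : 0 ≤ om9 (2 ^ (k + 1)) := by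
      unfold om9
      apply Finset.sum_nonneg
      intro m _
      split_ifs <;> positivity
    gcongr
    · norm_num
  refine (Finset.sum_le_sum h1).trans ?_
  rw [Finset.sum_const, card_range, nsmul_eq_mul]
  gcongr
end RMF

namespace RMF
open Finset

def pf (s : Finset ℕ) : Finset ℕ := s.filter Nat.Prime

def PDep {α : Type*} (Φ : Finset ℕ → α) : Prop := ∀ s, Φ (pf s) = Φ s

lemma sg_pf {s : Finset ℕ} {p : ℕ} (hp : p.Prime) : sg (pf s) p = sg s p := by
  simp [sg, pf, hp]

lemma fs_pf (s : Finset ℕ) (m : ℕ) : fs (pf s) m = fs s m := by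
  unfold fs chi
  split_ifs
  · exact Finset.prod_congr rfl fun p hp => sg_pf (Nat.prime_of_mem_primeFactors hp)
  · rfl

lemma SS_pf (s : Finset ℕ) (m : ℕ) : SS (pf s) m = SS s m := by simp only [SS, fs_pf]
lemma MM_pf (N : ℕ) (s : Finset ℕ) : MM N (pf s) = MM N s := by simp only [MM, fs_pf]
lemma VV_pf (N : ℕ) (s : Finset ℕ) : VV N (pf s) = VV N s := by simp only [VV, SS_pf]
lemma WW_pf (h N : ℕ) (s : Finset ℕ) : WW h N (pf s) = WW h N s := by simp only [WW, SS_pf]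
lemma ZZ_pf (M : ℕ) (t : ℝ) (s : Finset ℕ) : ZZ M t (pf s) = ZZ M t s := by
  unfold ZZ
  apply Finset.prod_congr rfl
  intro j _
  by_cases hj : j.Prime
  · rw [sg_pf hj]
  · have : aa j = 0 := by simp [aa, aq, hj]
    rw [this]; ring
lemma RR_pf (M : ℕ) (s : Finset ℕ) : RR M (pf s) = RR M s := by simp only [RR, II, ZZ_pf]

lemma PP_succ_prime {N : ℕ} (h : N.Prime) : PP (N + 1) = insert N (PP N) := by
  unfold PP; rw [range_add_one, filter_insert, if_pos h]

lemma PP_succ_not {N : ℕ} (h : ¬ N.Prime) : PP (N + 1) = PP N := by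
  unfold PP; rw [range_add_one, filter_insert, if_neg h]

lemma Ex_PP (N : ℕ) (Φ : Finset ℕ → ℝ) (h : PDep Φ) :
    Ex N Φ = (∑ u ∈ (PP N).powerset, Φ u) / 2 ^ (PP N).card := by
  induction N generalizing Φ with
  | zero => simp [Ex, PP]
  | succ N ih =>
    have hsucc : Ex (N + 1) Φ = Ex N (fun s => (Φ s + Φ (insert N s)) / 2) := by
      rw [Ex_succ, ← Ex_add]
      simp_rw [div_eq_mul_inv]
      rw [Ex_mul_right]
    rw [hsucc]
    by_cases hN : N.Prime
    · have hp : PDep (fun s => (Φ s + Φ (insert N s)) / 2) := by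
        intro s
        have e1 := h (insert N s)
        have e2 := h (insert N (pf s))
        have e3 : pf (insert N (pf s)) = pf (insert N s) := by
          unfold pf; rw [filter_insert, filter_insert, if_pos hN, if_pos hN, filter_filter]; simp
        simp only [h s]
        rw [← e2, e3, e1]
      rw [ih _ hp, PP_succ_prime hN, Finset.sum_powerset_insert (by simp [PP]), card_insert_of_notMem (by simp [PP]),
        pow_succ, ← Finset.sum_div, Finset.sum_add_distrib]
      field_simp
    · have hp : ∀ s, (Φ s + Φ (insert N s)) / 2 = Φ s := by
        intro s
        have e1 := h (insert N s)
        have e3 : pf (insert N s) = pf s := by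
          unfold pf; rw [filter_insert, if_neg hN]
        rw [← e1, e3, h]; ring
      simp_rw [hp]
      rw [PP_succ_not hN]
      exact ih _ h

section bridge
variable {Ω : Type*} [MeasurableSpace Ω] {μ : Measure Ω} [IsProbabilityMeasure μ] {f : Ω → ℕ → ℝ}

/-- sign pattern of a sample point -/
def so (f : Ω → ℕ → ℝ) (N : ℕ) (ω : Ω) : Finset ℕ := (PP N).filter (fun p => f ω p = -1)

lemma so_inter (f : Ω → ℕ → ℝ) {N M : ℕ} (h : M ≤ N) (ω : Ω) : so f N ω ∩ range M = so f M ω := by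
  ext p
  simp only [so, PP, mem_inter, mem_filter, mem_range]
  constructor
  · rintro ⟨⟨⟨a, b⟩, c⟩, d⟩; exact ⟨⟨d, b⟩, c⟩
  · rintro ⟨⟨a, b⟩, c⟩; exact ⟨⟨⟨by omega, b⟩, c⟩, a⟩

lemma so_dep (f : Ω → ℕ → ℝ) {α : Type*} {N M : ℕ} {Φ : Finset ℕ → α} (hΦ : Dep M Φ) (h : M ≤ N) (ω : Ω) :
    Φ (so f N ω) = Φ (so f M ω) := by
  rw [← so_inter f h, hΦ]

lemma mu_so (hf : IsRademacherRMF μ f) (N : ℕ) (u : Finset ℕ) (hu : u ⊆ PP N) :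
    μ {ω | so f N ω = u} = (1 / 2) ^ (PP N).card := by
  classical
  let S : Finset Nat.Primes := (PP N).subtype Nat.Prime
  let sets : Nat.Primes → Set ℝ := fun p => if (p : ℕ) ∈ u then {-1} else {-1}ᶜ
  have hms : ∀ p ∈ S, MeasurableSet (sets p) := by
    intro p _
    simp only [sets]
    split_ifs
    · exact measurableSet_singleton _
    · exact (measurableSet_singleton _).compl
  have h1 := hf.indep.measure_inter_preimage_eq_mul S hms
  have h2 : ∀ p ∈ S, μ ((fun ω => f ω (p : ℕ)) ⁻¹' sets p) = 1 / 2 := by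
    intro p _
    have hm : MeasurableSet ((fun ω => f ω (p:ℕ)) ⁻¹' {(-1:ℝ)}) := hf.meas _ (measurableSet_singleton _)
    have h3 : μ ((fun ω => f ω (p:ℕ)) ⁻¹' {(-1:ℝ)}) = 1 / 2 := hf.prob_neg_one p p.2
    simp only [sets]
    split_ifs
    · exact h3
    · rw [Set.preimage_compl, prob_compl_eq_one_sub hm, h3]
      simp [ENNReal.one_sub_inv_two]
  rw [Finset.prod_congr rfl h2, Finset.prod_const] at h1
  have hc : S.card = (PP N).card := by
    have : S.card = ((PP N).filter Nat.Prime).card := Finset.card_subtype _ _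
    rw [this]
    unfold PP
    rw [filter_filter]
    simp
  have hS : ∀ p : Nat.Primes, p ∈ S ↔ (p:ℕ) ∈ PP N := fun p => Finset.mem_subtype
  rw [← hc, ← h1]
  congr 1
  ext ω
  simp only [Set.mem_setOf_eq, Set.mem_iInter, Set.mem_preimage]
  constructor
  · intro h p hp
    have hp' : (p:ℕ) ∈ PP N := (hS p).1 hp
    simp only [sets]
    have : (p:ℕ) ∈ u ↔ f ω p = -1 := by rw [← h]; simp [so, hp']
    split_ifs with h3
    · exact this.1 h3
    · exact fun h4 => h3 (this.2 h4)
  · intro h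
    ext p
    constructor
    · intro hp
      simp only [so, mem_filter] at hp
      have := h ⟨p, (mem_filter.1 hp.1).2⟩ ((hS _).2 hp.1)
      simp only [sets] at this
      by_contra h3
      rw [if_neg h3] at this
      exact this hp.2
    · intro hp
      have hp1 := hu hp
      have := h ⟨p, (mem_filter.1 hp1).2⟩ ((hS _).2 hp1)
      simp only [sets] at this
      rw [if_pos hp] at this
      simp only [so, mem_filter]
      exact ⟨hp1, this⟩

lemma mu_le (hf : IsRademacherRMF μ f) (N : ℕ) (Q : Finset ℕ → Prop) (hQ : PDep Q) :
    μ {ω | Q (so f N ω)} ≤ ENNReal.ofReal (Pr N Q) := by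
  classical
  have hsub : {ω | Q (so f N ω)} ⊆ ⋃ u ∈ (PP N).powerset.filter Q, {ω | so f N ω = u} := by
    intro ω hω
    simp only [Set.mem_iUnion, Set.mem_setOf_eq, mem_filter, mem_powerset]
    exact ⟨so f N ω, ⟨filter_subset _ _, hω⟩, rfl⟩
  refine (measure_mono hsub).trans ((measure_biUnion_finset_le _ _).trans ?_)
  have h1 : ∀ u ∈ (PP N).powerset.filter Q, μ {ω | so f N ω = u} = ENNReal.ofReal ((1 / 2) ^ (PP N).card) := by
    intro u hu
    rw [mem_filter, mem_powerset] at hu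
    rw [mu_so hf N u hu.1, ENNReal.ofReal_pow (by norm_num)]
    congr 1
    rw [ENNReal.ofReal_div_of_pos (by norm_num)]; simp
  rw [Finset.sum_congr rfl h1, Finset.sum_const, ← ENNReal.ofReal_nsmul]
  apply le_of_eq
  congr 1
  unfold Pr
  rw [Ex_PP N _ (fun s => by rw [hQ s])]
  have : ∑ u ∈ (PP N).powerset, ind (Q u) = ((PP N).powerset.filter Q).card := by
    rw [Finset.card_filter]
    push_cast
    apply Finset.sum_congr rfl
    intro u _
    unfold ind
    split_ifs <;> simp
  rw [this, nsmul_eq_mul, one_div, inv_pow, div_eq_mul_inv]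

lemma borel (hf : IsRademacherRMF μ f) (Nk : ℕ → ℕ) (Q : ℕ → Finset ℕ → Prop) (hQ : ∀ k, PDep (Q k))
    (a : ℕ → ℝ) (ha : Summable a) (h : ∀ᶠ k in atTop, Pr (Nk k) (Q k) ≤ a k) :
    ∀ᵐ ω ∂μ, ∀ᶠ k in atTop, ¬ Q k (so f (Nk k) ω) := by
  obtain ⟨k0, hk0⟩ := eventually_atTop.1 h
  have h1 : ∑' k, μ {ω | Q (k + k0) (so f (Nk (k + k0)) ω)} ≠ ⊤ := by
    have ha' : Summable (fun k => a (k + k0)) := (summable_nat_add_iff k0).2 ha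
    have hnn : ∀ k, 0 ≤ a (k + k0) := fun k => Pr_nonneg.trans (hk0 _ (by omega))
    have h2 := ENNReal.ofReal_tsum_of_nonneg hnn ha'
    refine ne_top_of_le_ne_top (ENNReal.ofReal_ne_top (r := ∑' k, a (k + k0))) ?_
    rw [h2]
    exact ENNReal.tsum_le_tsum fun k => (mu_le hf _ _ (hQ _)).trans (ENNReal.ofReal_le_ofReal (hk0 _ (by omega)))
  filter_upwards [ae_eventually_notMem h1] with ω hω
  obtain ⟨k1, hk1⟩ := eventually_atTop.1 hω
  refine eventually_atTop.2 ⟨k1 + k0, fun k hk => ?_⟩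
  have := hk1 (k - k0) (by omega)
  rw [show k - k0 + k0 = k by omega] at this
  exact this

lemma fs_so (hf : IsRademacherRMF μ f) :
    ∀ᵐ ω ∂μ, ∀ N m, m < N → fs (so f N ω) m = f ω m := by
  have h1 : ∀ᵐ ω ∂μ, ∀ p : Nat.Primes, f ω p = 1 ∨ f ω p = -1 := by
    rw [ae_all_iff]
    intro p
    have hm1 : MeasurableSet {ω | f ω (p:ℕ) = 1} := hf.meas _ (measurableSet_singleton _)
    have hm2 : MeasurableSet {ω | f ω (p:ℕ) = -1} := hf.meas _ (measurableSet_singleton _)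
    have hd : Disjoint {ω | f ω (p:ℕ) = 1} {ω | f ω (p:ℕ) = -1} := by
      rw [Set.disjoint_left]
      intro ω h1 h2
      simp only [Set.mem_setOf_eq] at h1 h2
      rw [h1] at h2; norm_num at h2
    have := measure_union (μ := μ) hd hm2
    rw [hf.prob_one p p.2, hf.prob_neg_one p p.2, ENNReal.add_halves] at this
    exact (mem_ae_iff_prob_eq_one (hm1.union hm2)).2 this
  filter_upwards [h1] with ω hω N m hm
  unfold fs
  split_ifs with hs
  · rw [hf.eq_prod_of_squarefree ω m hs]
    unfold chi
    apply Finset.prod_congr rfl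
    intro p hp
    have hpp := Nat.prime_of_mem_primeFactors hp
    have hle := Nat.le_of_mem_primeFactors hp
    have hPP : p ∈ PP N := by simp only [PP, mem_filter, mem_range]; exact ⟨by omega, hpp⟩
    rcases hω ⟨p, hpp⟩ with h | h
    · change f ω p = 1 at h
      rw [h]
      apply sg_of_not_mem
      simp only [so, mem_filter, h]
      norm_num
    · change f ω p = -1 at h
      rw [h]
      simp [sg, so, hPP, h]
  · rw [hf.eq_zero_of_not_squarefree ω m hs]

end bridge
end RMF

namespace RMF
open Finset

lemma pow_ev (P : ℕ) : ∀ᶠ k : ℕ in atTop, (k:ℝ) ^ P ≤ 2 ^ k := by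
  have h := tendsto_pow_const_div_const_pow_of_one_lt P (r := (2:ℝ)) (by norm_num)
  filter_upwards [h.eventually (ge_mem_nhds (show (0:ℝ) < 1 by norm_num))] with k hk
  rwa [div_le_one (by positivity)] at hk

def wk (k : ℕ) : ℕ := Nat.log 2 (k ^ 20) + 1

lemma wk_lower (k : ℕ) : (k:ℝ) ^ 20 ≤ 2 ^ wk k := by
  have : k ^ 20 < 2 ^ wk k := Nat.lt_pow_succ_log_self (by norm_num) _
  exact_mod_cast this.le

lemma wk_upper {k : ℕ} (hk : 1 ≤ k) : (2:ℝ) ^ wk k ≤ 2 * k ^ 20 := by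
  have h : 2 ^ Nat.log 2 (k ^ 20) ≤ k ^ 20 := Nat.pow_log_le_self 2 (by positivity)
  have : 2 ^ wk k ≤ 2 * k ^ 20 := by unfold wk; rw [pow_succ]; omega
  exact_mod_cast this

lemma wk_le_ev : ∀ᶠ k : ℕ in atTop, wk k ≤ k := by
  filter_upwards [pow_ev 21, eventually_ge_atTop 2] with k h1 h2
  have h3 := wk_upper (k := k) (by omega)
  have h4 : (2:ℝ) ≤ k := by exact_mod_cast h2
  have h5 : (2:ℝ) ^ wk k ≤ 2 ^ k := by
    refine h3.trans (le_trans ?_ h1)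
    calc 2 * (k:ℝ) ^ 20 ≤ (k:ℝ) * (k:ℝ) ^ 20 := by gcongr
      _ = (k:ℝ) ^ 21 := by ring
  exact (pow_le_pow_iff_right₀ (by norm_num : (1:ℝ) < 2)).1 h5

/-- test points -/
def TT (k : ℕ) : Finset ℕ := (Ico (2 ^ wk k) (2 ^ (wk k + 1))).image (fun q => q * 2 ^ (k - wk k))

lemma TT_card {k : ℕ} (hk : 1 ≤ k) : ((TT k).card : ℝ) ≤ 2 * k ^ 20 := by
  have h : (TT k).card ≤ 2 ^ wk k := by
    refine card_image_le.trans ?_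
    rw [Nat.card_Ico, pow_succ]; omega
  have : ((TT k).card : ℝ) ≤ 2 ^ wk k := by exact_mod_cast h
  exact this.trans (wk_upper hk)

lemma TT_mem {k N : ℕ} (hk : wk k ≤ k) (h : N ∈ TT k) : 2 ^ k ≤ N ∧ N < 2 ^ (k + 1) := by
  simp only [TT, mem_image, mem_Ico] at h
  obtain ⟨q, ⟨h1, h2⟩, rfl⟩ := h
  have e1 : 2 ^ k = 2 ^ wk k * 2 ^ (k - wk k) := by rw [← pow_add]; congr 1; omega
  have e2 : 2 ^ (k + 1) = 2 ^ (wk k + 1) * 2 ^ (k - wk k) := by rw [← pow_add]; congr 1; omega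
  rw [e1, e2]
  exact ⟨Nat.mul_le_mul_right _ h1, Nat.mul_lt_mul_of_pos_right h2 (by positivity)⟩

lemma TT_base {k N : ℕ} (hk : wk k ≤ k) (h1 : 2 ^ k ≤ N) (h2 : N < 2 ^ (k + 1)) :
    N / 2 ^ (k - wk k) * 2 ^ (k - wk k) ∈ TT k := by
  simp only [TT, mem_image, mem_Ico]
  refine ⟨N / 2 ^ (k - wk k), ⟨?_, ?_⟩, rfl⟩
  · rw [Nat.le_div_iff_mul_le (by positivity), ← pow_add, show wk k + (k - wk k) = k by omega]; exact h1
  · rw [Nat.div_lt_iff_lt_mul (by positivity), ← pow_add, show wk k + 1 + (k - wk k) = k + 1 by omega]; exact h2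

lemma dep_VV {N M : ℕ} (h : N < M) : Dep M (VV N) := by
  unfold VV
  exact dep_sum _ _ (fun p _ => (dep_SS ((Nat.div_le_self N p).trans_lt h)).comp (fun x => x ^ 2))

lemma ev_W : ∀ᶠ k : ℕ in atTop, Pr (2 ^ (k + 1) + 1) (fun s => ∃ N ∈ TT k, (N:ℝ) / k ≤ WW (2 ^ (k / 4)) N s) ≤ 4 * (1 / (k:ℝ) ^ 2) := by
  filter_upwards [wk_le_ev, pow_ev 100, eventually_ge_atTop 1] with k hw hp hk
  have hk' : (1:ℝ) ≤ k := by exact_mod_cast hk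
  set B := Real.sqrt (2 ^ k) with hB
  set A := Real.sqrt B with hA
  have hB2 : B ^ 2 = 2 ^ k := Real.sq_sqrt (by positivity)
  have hA2 : A ^ 2 = B := Real.sq_sqrt (Real.sqrt_nonneg _)
  have hA0 : 0 ≤ A := Real.sqrt_nonneg _
  have hA4 : A ^ 4 = 2 ^ k := by rw [← hB2, ← hA2]; ring
  have hA25 : (k:ℝ) ^ 25 ≤ A := by
    apply le_of_pow_le_pow_left₀ (n := 4) (by norm_num) hA0
    rw [hA4, ← pow_mul]; exact hp
  have hApos : 0 < A := lt_of_lt_of_le (by positivity) hA25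
  have hh : (2:ℝ) ^ (k / 4) ≤ A := by
    apply le_of_pow_le_pow_left₀ (n := 4) (by norm_num) hA0
    rw [hA4, ← pow_mul]
    exact pow_le_pow_right₀ (by norm_num) (by omega)
  have h1 : ∀ N ∈ TT k, Pr (2 ^ (k + 1) + 1) (fun s => (N:ℝ) / k ≤ WW (2 ^ (k / 4)) N s) ≤ 2 * k / A := by
    intro N hN
    obtain ⟨a, b⟩ := TT_mem hw hN
    have hN0 : (0:ℝ) < N := by
      have : 0 < N := lt_of_lt_of_le (by positivity) a
      exact_mod_cast this
    refine (Pr_markov (fun s => ?_) (by positivity)).trans ?_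
    · unfold WW
      exact mul_nonneg (by positivity) (Finset.sum_nonneg fun _ _ => Finset.sum_nonneg fun _ _ => sq_nonneg _)
    · have h2 := Ex_WW (h := 2 ^ (k / 4)) (N := N) (M := 2 ^ (k + 1) + 1) Nat.one_le_two_pow (by omega)
      push_cast at h2
      have hs : B ≤ Real.sqrt N := Real.sqrt_le_sqrt (by exact_mod_cast a)
      have hs0 : 0 < Real.sqrt N := Real.sqrt_pos.2 hN0
      have e : Real.sqrt N ^ 2 = N := Real.sq_sqrt hN0.le
      rw [div_div_eq_mul_div, div_le_div_iff₀ hN0 hApos]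
      calc Ex (2 ^ (k + 1) + 1) (WW (2 ^ (k / 4)) N) * k * A ≤ (2 * A * Real.sqrt N) * k * A := by
            gcongr; exact h2.trans (by gcongr)
        _ = 2 * k * (A ^ 2 * Real.sqrt N) := by ring
        _ ≤ 2 * k * (Real.sqrt N * Real.sqrt N) := by rw [hA2]; gcongr
        _ = 2 * k * N := by rw [← pow_two, e]
  refine (Pr_exists _).trans ((Finset.sum_le_sum h1).trans ?_)
  rw [Finset.sum_const, nsmul_eq_mul]
  calc _ ≤ 2 * (k:ℝ) ^ 20 * (2 * k / k ^ 25) := by gcongr; exact TT_card hk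
    _ = 4 * (1 / (k:ℝ) ^ 4) := by field_simp; ring
    _ ≤ 4 * (1 / (k:ℝ) ^ 2) := by
      gcongr
      norm_num

lemma ev_M {ε C : ℝ} (hε : 0 < ε) (hC : 0 < C) : ∀ᶠ k : ℕ in atTop, Pr (2 ^ (k + 1) + 1)
    (fun s => ∃ N ∈ TT k, VV N s ≤ C * Real.log k ^ (-(1/2) + ε) * N ∧
      Real.sqrt N * (1/2 * Real.log k ^ (1/4 + ε)) < |MM N s|) ≤ 4 * (1 / (k:ℝ) ^ 2) := by
  have hl : Tendsto (fun k : ℕ => Real.log k) atTop atTop := Real.tendsto_log_atTop.comp tendsto_natCast_atTop_atTop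
  have hl2 := ((tendsto_rpow_atTop hε).comp hl).eventually_ge_atTop (176 * C)
  filter_upwards [wk_le_ev, hl2, hl.eventually_ge_atTop 1, eventually_ge_atTop 1] with k hw h1 h2 hk
  simp only [Function.comp] at h1
  have hk' : (1:ℝ) ≤ k := by exact_mod_cast hk
  have hk0 : (0:ℝ) < k := by linarith
  set L := Real.log k with hL
  have hL0 : 0 < L := by linarith
  have hexp : (1/2 * L ^ (1/4 + ε)) ^ 2 / (2 * (C * L ^ (-(1/2) + ε))) = L * L ^ ε / (8 * C) := by
    have e1 : (L ^ (1/4 + ε)) ^ 2 = L * L ^ ε * L ^ (-(1/2) + ε) := by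
      rw [← Real.rpow_natCast, ← Real.rpow_mul hL0.le, ← Real.rpow_one_add' hL0.le (by linarith), ← Real.rpow_add hL0]
      congr 1; push_cast; ring
    have : 0 < L ^ (-(1/2) + ε) := Real.rpow_pos_of_pos hL0 _
    rw [mul_pow, e1]
    field_simp; ring
  have hP : ∀ N ∈ TT k, Pr (2 ^ (k + 1) + 1) (fun s => VV N s ≤ C * L ^ (-(1/2) + ε) * N ∧
      Real.sqrt N * (1/2 * L ^ (1/4 + ε)) < |MM N s|) ≤ 2 * (1 / (k:ℝ) ^ 22) := by
    intro N hN
    obtain ⟨a, b⟩ := TT_mem hw hN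
    have hN1 : 1 ≤ N := Nat.one_le_two_pow.trans a
    have hd : Dep (N + 1) (fun s => VV N s ≤ C * L ^ (-(1/2) + ε) * N ∧
      Real.sqrt N * (1/2 * L ^ (1/4 + ε)) < |MM N s|) :=
      Dep.comp₂ (dep_VV (Nat.lt_succ_self N)) (dep_MM (Nat.lt_succ_self N)) (fun x y => x ≤ C * L ^ (-(1/2) + ε) * N ∧
      Real.sqrt N * (1/2 * L ^ (1/4 + ε)) < |y|)
    rw [Pr_dep hd (by omega)]
    refine (MM_tail hN1 (by positivity) (by positivity)).trans ?_
    rw [hexp]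
    gcongr
    have h3 : 22 * L ≤ L * L ^ ε / (8 * C) := by
      rw [le_div_iff₀ (by positivity)]
      nlinarith
    calc Real.exp (-(L * L ^ ε / (8 * C))) ≤ Real.exp (-(22 * L)) := Real.exp_le_exp.2 (by linarith)
      _ = 1 / (k:ℝ) ^ 22 := by
        rw [Real.exp_neg, one_div]
        congr 1
        rw [show (22:ℝ) = ((22:ℕ):ℝ) by norm_num, Real.exp_nat_mul, hL, Real.exp_log hk0]
  refine (Pr_exists _).trans ((Finset.sum_le_sum hP).trans ?_)
  rw [Finset.sum_const, nsmul_eq_mul]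
  calc _ ≤ 2 * (k:ℝ) ^ 20 * (2 * (1 / (k:ℝ) ^ 22)) := by gcongr; exact TT_card hk
    _ = 4 * (1 / (k:ℝ) ^ 2) := by field_simp; ring

lemma ev_chain : ∀ᶠ k : ℕ in atTop, Pr (2 ^ (k + 1) + 1) (fun s => ∃ i ∈ range (k - wk k), ∃ q ∈ Ico (2 ^ (k - i)) (2 ^ (k + 1 - i)),
      Real.sqrt (2 ^ k) / k ≤ |MM ((q + 1) * 2 ^ i) s - MM (q * 2 ^ i) s|) ≤ 8192 * 3 ^ 9 * Real.exp 36 * (1 / (k:ℝ) ^ 2) := by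
  filter_upwards [wk_le_ev, pow_ev 40, eventually_ge_atTop 1] with k hw hp hk
  have hk' : (1:ℝ) ≤ k := by exact_mod_cast hk
  have hk0 : (0:ℝ) < k := by linarith
  refine (chain_prob (Nat.sub_le k (wk k)) (by positivity)).trans ?_
  set B := Real.sqrt (2 ^ k) with hB
  have hB2 : B ^ 2 = 2 ^ k := Real.sq_sqrt (by positivity)
  have hB0 : 0 < B := by positivity
  have hB20 : (k:ℝ) ^ 20 ≤ B := by
    apply le_of_pow_le_pow_left₀ (n := 2) (by norm_num) hB0.le
    rw [hB2, ← pow_mul]; exact hp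
  have h1 : (2:ℝ) ^ (k - wk k) ≤ B ^ 2 / k ^ 20 := by
    rw [le_div_iff₀ (by positivity), hB2]
    calc (2:ℝ) ^ (k - wk k) * k ^ 20 ≤ 2 ^ (k - wk k) * 2 ^ wk k := by gcongr; exact wk_lower k
      _ = 2 ^ k := by rw [← pow_add]; congr 1; omega
  have h2 : Real.sqrt (2 ^ (k + 1)) ≤ 2 * (B ^ 2 / k ^ 20) := by
    have : Real.sqrt (2 ^ (k + 1)) ≤ 2 * B := by
      rw [Real.sqrt_le_left (by positivity), mul_pow, hB2, pow_succ]
      have : (0:ℝ) < 2 ^ k := by positivity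
      linarith
    refine this.trans ?_
    gcongr
    rw [le_div_iff₀ (by positivity), pow_two]
    gcongr
  have h3 : (k:ℝ) + 2 ≤ 3 * k := by linarith
  have h4 : (2:ℝ) ^ (k + 1) = 2 * B ^ 2 := by rw [hB2, pow_succ]; ring
  rw [h4]
  calc (k:ℝ) * ((2 * 2 ^ (k - wk k) + Real.sqrt (2 * B ^ 2)) * (2 * (2 * B ^ 2 * (Real.exp 36 * (k + 2) ^ 9))) / (B / k) ^ 4)
      ≤ k * ((2 * (B ^ 2 / k ^ 20) + 2 * (B ^ 2 / k ^ 20)) * (2 * (2 * B ^ 2 * (Real.exp 36 * (3 * k) ^ 9))) / (B / k) ^ 4) := by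
        rw [h4] at h2
        gcongr
    _ = 16 * 3 ^ 9 * Real.exp 36 * (1 / (k:ℝ) ^ 6) := by
        field_simp; ring
    _ ≤ 8192 * 3 ^ 9 * Real.exp 36 * (1 / (k:ℝ) ^ 2) := by
        gcongr
        · norm_num
        · norm_num

lemma ev_R {δ : ℝ} (hδ : 0 < δ) (hδ1 : δ ≤ 1/8) {K : ℕ} (hK : 2 ≤ K * δ) : ∀ᶠ l : ℕ in atTop,
    Pr (yy ((l + 1) ^ K)) (fun s => ∃ m, yy (l ^ K) ≤ m ∧ m ≤ yy ((l + 1) ^ K) ∧ ((l ^ K : ℕ):ℝ) ^ (-(1/2) + 3 * δ) ≤ RR m s) ≤ 8 * (1 / (l:ℝ) ^ 2) := by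
  have hK0 : K ≠ 0 := by rintro rfl; simp at hK; linarith
  have ht : Tendsto (fun l : ℕ => l ^ K) atTop atTop := tendsto_pow_atTop hK0
  filter_upwards [ht.eventually (RR_prob hδ hδ1), eventually_ge_atTop 1] with l hl hl1
  have hl' : (1:ℝ) ≤ l := by exact_mod_cast hl1
  refine (hl ((l + 1) ^ K) (Nat.pow_le_pow_left (by omega) K)).trans ?_
  gcongr
  push_cast
  rw [← Real.rpow_natCast, ← Real.rpow_mul (by positivity), one_div, ← Real.rpow_natCast, ← Real.rpow_neg (by positivity)]
  apply Real.rpow_le_rpow_of_exponent_le hl'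
  push_cast
  linarith

lemma R_final {δ : ℝ} (hδ : 0 < δ) (hδ1 : δ ≤ 1/8) {K : ℕ} (hK0 : K ≠ 0) (F : ℕ → ℝ)
    (h : ∀ᶠ l : ℕ in atTop, ∀ m, yy (l ^ K) ≤ m → m ≤ yy ((l + 1) ^ K) → F m < ((l ^ K : ℕ):ℝ) ^ (-(1/2) + 3 * δ)) :
    ∀ᶠ k : ℕ in atTop, ∀ N, 2 ^ k ≤ N → F N ≤ 2 ^ K * Real.log k ^ (-(1/2) + 3 * δ) ∨ 2 ^ (k + 1) < N := by
  obtain ⟨l0, hl0⟩ := eventually_atTop.1 h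
  set l1 := max l0 1 with hl1
  filter_upwards [eventually_ge_atTop (yy (l1 ^ K)), eventually_ge_atTop 2] with k hk1 hk2 N hN
  left
  have hkN : yy (l1 ^ K) ≤ N := hk1.trans ((Nat.lt_two_pow_self).le.trans hN)
  have hex : ∃ j, N ≤ yy ((l1 + j + 1) ^ K) := by
    refine ⟨N, ?_⟩
    have a1 : N ≤ (l1 + N + 1) ^ K := le_trans (by omega) (Nat.le_self_pow hK0 _)
    have a2 : (l1 + N + 1) ^ K ≤ yy ((l1 + N + 1) ^ K) := by
      unfold yy
      exact (Nat.lt_two_pow_self).le.trans (Nat.lt_two_pow_self).le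
    exact a1.trans a2
  classical
  set j := Nat.find hex with hj
  have hj1 : N ≤ yy ((l1 + j + 1) ^ K) := Nat.find_spec hex
  have hj2 : yy ((l1 + j) ^ K) ≤ N := by
    rcases Nat.eq_zero_or_pos j with h0 | h0
    · rw [h0]; exact hkN
    · have := Nat.find_min hex (m := j - 1) (by omega)
      rw [show l1 + (j - 1) + 1 = l1 + j by omega] at this
      omega
  set l := l1 + j with hl
  have hF := hl0 l (by omega) N hj2 hj1
  refine hF.le.trans ?_
  have hk : k ≤ 2 ^ ((l + 1) ^ K) := by
    have : 2 ^ k ≤ 2 ^ (2 ^ ((l + 1) ^ K)) := hN.trans hj1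
    exact (Nat.pow_le_pow_iff_right (by norm_num)).1 this
  have hl1' : 1 ≤ l := by omega
  have hlR : (1:ℝ) ≤ l := by exact_mod_cast hl1'
  have hkR : (2:ℝ) ≤ k := by exact_mod_cast hk2
  have hlog0 : 0 < Real.log k := Real.log_pos (by linarith)
  have hlog : Real.log k ≤ 2 ^ K * (l:ℝ) ^ K := by
    have h1 : (k:ℝ) ≤ 2 ^ ((l + 1) ^ K) := by exact_mod_cast hk
    have h2 := Real.log_le_log (by linarith) h1
    rw [Real.log_pow] at h2
    have h3 : Real.log 2 ≤ 1 := by linarith [Real.log_two_lt_d9]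
    push_cast at h2
    calc Real.log k ≤ ((l:ℝ) + 1) ^ K * Real.log 2 := h2
      _ ≤ (l + 1) ^ K * 1 := by gcongr
      _ ≤ (2 * l) ^ K := by rw [mul_one]; gcongr; linarith
      _ = _ := mul_pow _ _ _
  have h5 : Real.log k / 2 ^ K ≤ (l:ℝ) ^ K := by
    rw [div_le_iff₀ (by positivity)]; linarith
  push_cast
  calc ((l:ℝ) ^ K) ^ (-(1/2) + 3 * δ) ≤ (Real.log k / 2 ^ K) ^ (-(1/2) + 3 * δ) :=
        Real.rpow_le_rpow_of_nonpos (by positivity) h5 (by linarith)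
    _ = Real.log k ^ (-(1/2) + 3 * δ) * (2 ^ K) ^ (-(-(1/2) + 3 * δ)) := by
        rw [Real.div_rpow hlog0.le (by positivity), Real.rpow_neg (by positivity), div_eq_mul_inv]
    _ ≤ Real.log k ^ (-(1/2) + 3 * δ) * (2 ^ K) ^ (1:ℝ) := by
        gcongr
        · exact one_le_pow₀ (by norm_num)
        · linarith
    _ = _ := by rw [Real.rpow_one, mul_comm]
end RMF

namespace RMF
open Finset

/-- the deterministic part at scale `2 ^ k` -/
lemma MM_final {k N : ℕ} {s : Finset ℕ} {C D ε : ℝ} (hw : wk k ≤ k) (hk8 : 8 ≤ k) (hL : 1 ≤ Real.log k)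
    (hε1 : ε ≤ 1/4) (hε : 0 < ε) (hC : C = 2000 * Real.exp 4 * D + 1) (hN1 : 2 ^ k ≤ N) (hN2 : N < 2 ^ (k + 1))
    (hR : ∀ m, 2 ^ k ≤ m → m < 2 ^ (k + 1) → RR m s ≤ D * Real.log k ^ (-(1/2) + ε))
    (hW : ¬ ∃ N ∈ TT k, (N:ℝ) / k ≤ WW (2 ^ (k / 4)) N s)
    (hM : ¬ ∃ N ∈ TT k, VV N s ≤ C * Real.log k ^ (-(1/2) + ε) * N ∧
      Real.sqrt N * (1/2 * Real.log k ^ (1/4 + ε)) < |MM N s|)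
    (hc : ¬ ∃ i ∈ range (k - wk k), ∃ q ∈ Ico (2 ^ (k - i)) (2 ^ (k + 1 - i)),
      Real.sqrt (2 ^ k) / k ≤ |MM ((q + 1) * 2 ^ i) s - MM (q * 2 ^ i) s|) :
    |MM N s| ≤ Real.sqrt N * (1/2 * Real.log k ^ (1/4 + ε) + 1) := by
  have hk1 : (1:ℝ) ≤ k := by exact_mod_cast (by omega : 1 ≤ k)
  have hk0 : (0:ℝ) < k := by linarith
  set L := Real.log k with hLd
  have hL0 : 0 < L := by linarith
  set N0 := N / 2 ^ (k - wk k) * 2 ^ (k - wk k) with hN0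
  have hmem : N0 ∈ TT k := TT_base hw hN1 hN2
  obtain ⟨a, b⟩ := TT_mem hw hmem
  have hN0N : N0 ≤ N := Nat.div_mul_le_self _ _
  have hN0r : (0:ℝ) ≤ N0 := by positivity
  have hkL : 1 / (k:ℝ) ≤ L ^ (-(1/2) + ε) := by
    have h1 : L ≤ k := (Real.log_le_sub_one_of_pos hk0).trans (by linarith)
    calc 1 / (k:ℝ) ≤ 1 / L := one_div_le_one_div_of_le hL0 h1
      _ = L ^ (-1:ℝ) := by rw [Real.rpow_neg_one, one_div]
      _ ≤ L ^ (-(1/2) + ε) := Real.rpow_le_rpow_of_exponent_le hL (by linarith)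
  have hV : VV N0 s ≤ C * L ^ (-(1/2) + ε) * N0 := by
    have h1 := VV_bound hk8 a b.le s
    have h2 : WW (2 ^ (k / 4)) N0 s ≤ N0 / k := by
      by_contra hh
      exact hW ⟨N0, hmem, (not_le.1 hh).le⟩
    have h3 := hR N0 a b
    calc VV N0 s ≤ 2000 * Real.exp 4 * N0 * (D * L ^ (-(1/2) + ε)) + N0 * (1 / k) := by
          refine h1.trans (add_le_add (by gcongr) (h2.trans (by rw [mul_one_div])))
      _ ≤ 2000 * Real.exp 4 * N0 * (D * L ^ (-(1/2) + ε)) + N0 * L ^ (-(1/2) + ε) := by gcongr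
      _ = _ := by rw [hC]; ring
  have hM0 : |MM N0 s| ≤ Real.sqrt N0 * (1/2 * L ^ (1/4 + ε)) := by
    by_contra hh
    exact hM ⟨N0, hmem, hV, not_le.1 hh⟩
  have hch := chain_gen (fun n => MM n s) (δ := Real.sqrt (2 ^ k) / k) hN1 hN2 (k - wk k) (Nat.sub_le _ _) (by
    intro i hi q hq1 hq2
    by_contra hh
    refine hc ⟨i, mem_range.2 hi, q, mem_Ico.2 ⟨?_, ?_⟩, (not_le.1 hh).le⟩
    · have e : 2 ^ k = 2 ^ (k - i) * 2 ^ i := by rw [← pow_add]; congr 1; omega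
      rw [e] at hq1
      exact Nat.le_of_mul_le_mul_right hq1 (by positivity)
    · have e : 2 ^ (k + 1) = 2 ^ (k + 1 - i) * 2 ^ i := by rw [← pow_add]; congr 1; omega
      rw [e] at hq2
      exact Nat.le_of_mul_le_mul_right hq2 (by positivity)) (by positivity)
  have hsq : Real.sqrt (2 ^ k) ≤ Real.sqrt N := Real.sqrt_le_sqrt (by exact_mod_cast hN1)
  have hd : |MM N s - MM N0 s| ≤ Real.sqrt N := by
    refine hch.trans ?_
    have hh : ((k - wk k : ℕ):ℝ) ≤ k := by exact_mod_cast Nat.sub_le _ _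
    calc ((k - wk k : ℕ):ℝ) * (Real.sqrt (2 ^ k) / k) ≤ k * (Real.sqrt (2 ^ k) / k) := by gcongr
      _ = Real.sqrt (2 ^ k) := by field_simp
      _ ≤ _ := hsq
  have hsq0 : Real.sqrt N0 ≤ Real.sqrt N := Real.sqrt_le_sqrt (by exact_mod_cast hN0N)
  have hLp : 0 ≤ L ^ (1/4 + ε) := by positivity
  have h5 : Real.sqrt N0 * (1/2 * L ^ (1/4 + ε)) ≤ Real.sqrt N * (1/2 * L ^ (1/4 + ε)) := by gcongr
  have h6 : |MM N s| ≤ |MM N s - MM N0 s| + |MM N0 s| := by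
    have := abs_add_le (MM N s - MM N0 s) (MM N0 s)
    simpa using this
  linarith

lemma loglog_ev {a : ℝ} (ha0 : 0 < a) (ha1 : a ≤ 1) : ∀ᶠ k : ℕ in atTop, ∀ x : ℝ, 2 ^ k ≤ x →
    1/2 * Real.log k ^ a + 1 ≤ Real.log (Real.log x) ^ a := by
  have hl : Tendsto (fun k : ℕ => Real.log k) atTop atTop := Real.tendsto_log_atTop.comp tendsto_natCast_atTop_atTop
  have hl2 := ((tendsto_rpow_atTop ha0).comp hl).eventually_ge_atTop 6
  filter_upwards [hl2, hl.eventually_ge_atTop 3, eventually_ge_atTop 1] with k h1 h2 h3 x hx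
  simp only [Function.comp] at h1
  have hk0 : (0:ℝ) < k := by exact_mod_cast h3
  set L := Real.log k with hLd
  have hlog2 : (1/2:ℝ) < Real.log 2 := by have := Real.log_two_gt_d9; linarith
  have e1 : (k:ℝ) * Real.log 2 ≤ Real.log x := by
    rw [← Real.log_pow]; exact Real.log_le_log (by positivity) hx
  have e2 : Real.log (1/2) + L ≤ Real.log (Real.log x) := by
    rw [hLd, ← Real.log_mul (by norm_num) hk0.ne']
    exact Real.log_le_log (by positivity) (by nlinarith)
  have e3 : -1 ≤ Real.log (1/2) := by
    rw [one_div, Real.log_inv]; have := Real.log_two_lt_d9; linarith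
  have e4 : 2/3 * L ≤ Real.log (Real.log x) := by linarith
  calc 1/2 * L ^ a + 1 ≤ 2/3 * L ^ a := by linarith
    _ ≤ (2/3:ℝ) ^ a * L ^ a := by
      gcongr
      have := Real.rpow_le_rpow_of_exponent_ge (by norm_num : (0:ℝ) < 2/3) (by norm_num) ha1
      simpa using this
    _ = (2/3 * L) ^ a := by rw [Real.mul_rpow (by norm_num) (by linarith)]
    _ ≤ _ := by gcongr

lemma summ (c : ℝ) : Summable (fun k : ℕ => c * (1 / (k:ℝ) ^ 2)) :=
  (Real.summable_one_div_nat_pow.2 (by norm_num)).mul_left c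

theorem main {Ω : Type*} [MeasurableSpace Ω] (μ : Measure Ω) [IsProbabilityMeasure μ]
    (f : Ω → ℕ → ℝ) (hf : IsRademacherRMF μ f) {ε : ℝ} (hε : 0 < ε) (hε1 : ε < 1/4) :
      ∀ᵐ ω ∂μ, ∀ᶠ x : ℝ in atTop,
        |∑ n ∈ (Finset.Icc 1 ⌊x⌋₊).filter (fun n => Real.sqrt x < (Pfac n : ℝ)), f ω n| ≤
          Real.sqrt x * Real.log (Real.log x) ^ ((1 : ℝ) / 4 + ε) := by
  set δ := ε / 3 with hδd
  have hδ : 0 < δ := by positivity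
  have hδ1 : δ ≤ 1/8 := by linarith
  have h3δ : 3 * δ = ε := by rw [hδd]; ring
  set K := ⌈2 / δ⌉₊ with hKd
  have hK : 2 ≤ K * δ := by
    have := Nat.le_ceil (2 / δ)
    rwa [div_le_iff₀ hδ] at this
  have hK0 : K ≠ 0 := by rintro h; rw [h] at hK; simp at hK; linarith
  set C : ℝ := 2000 * Real.exp 4 * 2 ^ K + 1 with hC
  have hC0 : 0 < C := by positivity
  have b1 := borel hf (fun l => yy ((l + 1) ^ K))
    (fun l s => ∃ m, yy (l ^ K) ≤ m ∧ m ≤ yy ((l + 1) ^ K) ∧ ((l ^ K : ℕ):ℝ) ^ (-(1/2) + 3 * δ) ≤ RR m s)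
    (fun l s => by simp only [RR_pf]) _ (summ 8) (ev_R hδ hδ1 hK)
  have b2 := borel hf (fun k => 2 ^ (k + 1) + 1) (fun k s => ∃ N ∈ TT k, (N:ℝ) / k ≤ WW (2 ^ (k / 4)) N s)
    (fun l s => by simp only [WW_pf]) _ (summ 4) ev_W
  have b3 := borel hf (fun k => 2 ^ (k + 1) + 1) (fun k s => ∃ N ∈ TT k, VV N s ≤ C * Real.log k ^ (-(1/2) + ε) * N ∧
      Real.sqrt N * (1/2 * Real.log k ^ (1/4 + ε)) < |MM N s|)
    (fun l s => by simp only [VV_pf, MM_pf]) _ (summ 4) (ev_M hε hC0)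
  have b4 := borel hf (fun k => 2 ^ (k + 1) + 1) (fun k s => ∃ i ∈ range (k - wk k), ∃ q ∈ Ico (2 ^ (k - i)) (2 ^ (k + 1 - i)),
      Real.sqrt (2 ^ k) / k ≤ |MM ((q + 1) * 2 ^ i) s - MM (q * 2 ^ i) s|)
    (fun l s => by simp only [MM_pf]) _ (summ _) ev_chain
  filter_upwards [b1, b2, b3, b4, fs_so hf] with ω c1 c2 c3 c4 c5
  have hRf := R_final hδ hδ1 hK0 (fun m => RR m (so f m ω)) (by
    filter_upwards [c1] with l hl m hm1 hm2
    by_contra hh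
    refine hl ⟨m, hm1, hm2, ?_⟩
    rw [so_dep f (dep_RR m) hm2 ω]
    exact not_lt.1 hh)
  have hl : Tendsto (fun k : ℕ => Real.log k) atTop atTop := Real.tendsto_log_atTop.comp tendsto_natCast_atTop_atTop
  have key : ∀ᶠ k : ℕ in atTop, ∀ N, 2 ^ k ≤ N → N < 2 ^ (k + 1) →
      |MM N (so f (2 ^ (k + 1) + 1) ω)| ≤ Real.sqrt N * (1/2 * Real.log k ^ (1/4 + ε) + 1) := by
    filter_upwards [c2, c3, c4, hRf, wk_le_ev, eventually_ge_atTop 8, hl.eventually_ge_atTop 1] with k d2 d3 d4 dR hw hk8 hL N hN1 hN2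
    refine MM_final (D := 2 ^ K) hw hk8 hL hε1.le hε hC hN1 hN2 ?_ d2 d3 d4
    intro m hm1 hm2
    rw [so_dep f (dep_RR m) (by omega) ω]
    rcases dR m hm1 with h | h
    · rw [h3δ] at h; exact h
    · omega
  have hall := key.and (loglog_ev (a := 1/4 + ε) (by linarith) (by linarith))
  obtain ⟨k0, hk0⟩ := eventually_atTop.1 hall
  filter_upwards [eventually_ge_atTop ((2:ℝ) ^ k0)] with x hx
  have hx1 : (1:ℝ) ≤ x := (one_le_pow₀ (by norm_num)).trans hx
  have hx0 : (0:ℝ) ≤ x := by linarith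
  set N := ⌊x⌋₊ with hN
  have hNx : (N:ℝ) ≤ x := Nat.floor_le hx0
  have hN0 : 2 ^ k0 ≤ N := Nat.le_floor (by exact_mod_cast hx)
  have hNne : N ≠ 0 := by have : 0 < 2 ^ k0 := by positivity
                          omega
  set k := Nat.log 2 N with hk
  have hkk : k0 ≤ k := (Nat.le_log_iff_pow_le (by norm_num) hNne).2 hN0
  have hN1 : 2 ^ k ≤ N := Nat.pow_log_le_self 2 hNne
  have hN2 : N < 2 ^ (k + 1) := Nat.lt_pow_succ_log_self (by norm_num) N
  obtain ⟨g1, g2⟩ := hk0 k hkk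
  have g1 := g1 N hN1 hN2
  have g2 := g2 x (le_trans (by exact_mod_cast hN1) hNx)
  have hsum : ∑ n ∈ (Finset.Icc 1 N).filter (fun n => Real.sqrt x < (Pfac n : ℝ)), f ω n
      = MM N (so f (2 ^ (k + 1) + 1) ω) := by
    unfold MM
    have hfil : (Finset.Icc 1 N).filter (fun n => Real.sqrt x < (Pfac n : ℝ)) = (Icc 1 N).filter (fun n => N < Pfac n * Pfac n) := by
      apply Finset.filter_congr
      intro n _
      rw [hN, Nat.floor_lt hx0, Real.sqrt_lt hx0 (by positivity), pow_two]
      push_cast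
      rfl
    rw [hfil]
    apply Finset.sum_congr rfl
    intro n hn
    rw [c5]
    have := (mem_Icc.1 (mem_filter.1 hn).1).2
    omega
  rw [hsum]
  calc _ ≤ Real.sqrt N * (1/2 * Real.log k ^ (1/4 + ε) + 1) := g1
    _ ≤ Real.sqrt x * (1/2 * Real.log k ^ (1/4 + ε) + 1) := by
      gcongr
    _ ≤ _ := by gcongr

end RMF

/-- Almost surely, for all sufficiently large `x`,
`|∑_{n ≤ x, P(n) > √x} f(n)| ≤ √x (log log x)^{1/4+ε}`. -/
theorem almost_sure_upper_bound_rademacher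
    {Ω : Type*} [MeasurableSpace Ω] (μ : Measure Ω) [IsProbabilityMeasure μ]
    (f : Ω → ℕ → ℝ) (hf : IsRademacherRMF μ f) :
    ∃ ε₀ : ℝ, 0 < ε₀ ∧ ∀ ε : ℝ, 0 < ε → ε < ε₀ →
      ∀ᵐ ω ∂μ, ∀ᶠ x : ℝ in atTop,
        |∑ n ∈ (Finset.Icc 1 ⌊x⌋₊).filter (fun n => Real.sqrt x < (Pfac n : ℝ)), f ω n| ≤
          Real.sqrt x * Real.log (Real.log x) ^ ((1 : ℝ) / 4 + ε) := by
  exact ⟨1/4, by norm_num, fun ε h1 h2 => RMF.main μ f hf h1 h2⟩
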